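/- Let U and V be weak quantum vertex algebras and let R(x) be an invertible twisting operator for (U,V). Assume that U as a module over itself and V as a module over itself are irreducible and of countable dimension over ℂ. Then U⊗_R V as a module over itself is irreducible, and U⊗_R V is a non-degenerate quantum vertex algebra. -/

import Mathlib

open scoped TensorProduct BigOperators

noncomputable section

/-- Integer binomial coefficient `C(n, k)` for `n : ℤ`, `k : ℕ`. -/
def zchoose (n : ℤ) (k : ℕ) : ℤ :=
  if 0 ≤ n then ((n.toNat).choose k : ℤ)
  else (-1) ^ k * ((((k : ℤ) - n - 1).toNat).choose k)

section Series

variable {V : Type*} [AddCommGroup V] [Module ℂ V]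

/-- `a` is (the coefficient family of) an element of `V((x))`. -/
def IsLaurent (a : ℤ → V) : Prop := ∃ N : ℤ, ∀ n : ℤ, n < N → a n = 0

/-- `a` is an element of `V[[x]]`. -/
def IsPowerSeries (a : ℤ → V) : Prop := ∀ n : ℤ, n < 0 → a n = 0

/-- `A` is an element of `V((x₁, x₂))` (first index: exponent of `x₁`). -/
def IsLaurent2 (A : ℤ → ℤ → V) : Prop :=
  ∃ N : ℤ, ∀ m n : ℤ, (m < N ∨ n < N) → A m n = 0

/-- `a` is an element of `V ⊗ ℂ((x)) ⊆ V((x))`: truncated below, with coefficients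
lying in a finitely generated (i.e. finite dimensional) subspace. -/
def IsTensorLaurent (a : ℤ → V) : Prop :=
  IsLaurent a ∧ ∃ F : Submodule ℂ V, F.FG ∧ ∀ n, a n ∈ F

/-- Multiply the double series `A(x₁,x₂)` by `(x₁+x₂)^k`. -/
def mulAddPow (k : ℕ) (A : ℤ → ℤ → V) : ℤ → ℤ → V := fun a b =>
  ∑ j ∈ Finset.range (k + 1), ((k.choose j : ℕ) : ℂ) • A (a - (k : ℤ) + j) (b - j)

/-- Multiply the double series `A(x₁,x₂)` by `(x₁-x₂)^k`. -/
def mulSubPow (k : ℕ) (A : ℤ → ℤ → V) : ℤ → ℤ → V := fun a b =>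
  ∑ j ∈ Finset.range (k + 1),
    ((-1 : ℂ) ^ j * ((k.choose j : ℕ) : ℂ)) • A (a - (k : ℤ) + j) (b - j)

/-- Multiply the double series `A(x₁,x₂)` by `(x₂-x₁)^k`. -/
def mulSubPow' (k : ℕ) (A : ℤ → ℤ → V) : ℤ → ℤ → V := fun a b =>
  ∑ j ∈ Finset.range (k + 1),
    ((-1 : ℂ) ^ j * ((k.choose j : ℕ) : ℂ)) • A (a - j) (b - (k : ℤ) + j)

/-- Substitute `x₁ = x₀ + x₂` in `A(x₁,x₂)`, expanding in nonnegative powers of `x₂`.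
The result is indexed by (exponent of `x₀`, exponent of `x₂`). -/
def substAdd02 (A : ℤ → ℤ → V) : ℤ → ℤ → V := fun a b =>
  ∑ᶠ i : ℕ, ((zchoose (a + i) i : ℤ) : ℂ) • A (a + i) (b - i)

/-- Substitute `x₁ = x₂ + x₀` in `A(x₁,x₂)`, expanding in nonnegative powers of `x₀`.
The result is indexed by (exponent of `x₀`, exponent of `x₂`). -/
def substAdd20 (A : ℤ → ℤ → V) : ℤ → ℤ → V := fun a b =>
  if 0 ≤ a then ∑ᶠ m : ℤ, ((zchoose m a.toNat : ℤ) : ℂ) • A m (b - m + a) else 0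

/-- Multiply the double series `A(x₁,x₂)` by `f(x₂ - x₁)`, expanded in nonnegative
powers of `x₁`. -/
def scalarMulSub (f : ℤ → ℂ) (A : ℤ → ℤ → V) : ℤ → ℤ → V := fun m n =>
  ∑ᶠ (i : ℕ) (p : ℤ),
    ((-1 : ℂ) ^ i * ((zchoose p i : ℤ) : ℂ) * f p) • A (m - i) (n - p + i)

/-- Multiply a double series by a polynomial in two variables. -/
def polyMul2 (p : MvPolynomial (Fin 2) ℂ) (A : ℤ → ℤ → V) : ℤ → ℤ → V := fun m n =>
  ∑ d ∈ p.support, MvPolynomial.coeff d p • A (m - (d 0 : ℤ)) (n - (d 1 : ℤ))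

/-- The relation `A ∼ B`: `p·A = p·B` for some nonzero polynomial `p(x₁,x₂)`. -/
def SimEq2 (A B : ℤ → ℤ → V) : Prop :=
  ∃ p : MvPolynomial (Fin 2) ℂ, p ≠ 0 ∧ ∀ m n : ℤ, polyMul2 p A m n = polyMul2 p B m n

/-- `a` is an element of the iterated Laurent series space `V((x₁))⋯((x_n))`. -/
def IsIterLaurent : (n : ℕ) → ((Fin n → ℤ) → V) → Prop
  | 0, _ => True
  | n + 1, a =>
      (∃ N : ℤ, ∀ k : Fin (n + 1) → ℤ, k (Fin.last n) < N → a k = 0) ∧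
      ∀ m : ℤ, IsIterLaurent n fun k => a (Fin.snoc k m)

end Series

/-- A nonlocal vertex algebra over `ℂ`, with `Y u v n` the coefficient of `x^n`
in `Y(u,x)v` (so `u_m v = Y u v (-m-1)`). -/
structure NLVA (V : Type*) [AddCommGroup V] [Module ℂ V] where
  Y : V →ₗ[ℂ] V →ₗ[ℂ] (ℤ → V)
  one : V
  trunc : ∀ u v : V, IsLaurent (Y u v)
  vacuum_left : ∀ (v : V) (n : ℤ), Y one v n = if n = 0 then v else 0
  creation_reg : ∀ v : V, IsPowerSeries (Y v one)
  creation_zero : ∀ v : V, Y v one 0 = v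
  weak_assoc : ∀ u v w : V, ∃ k : ℕ, ∀ a b : ℤ,
    mulAddPow k (substAdd02 fun m n => Y u (Y v w n) m) a b
      = mulAddPow k (fun a' b' => Y (Y u v a') w b') a b

namespace NLVA

variable {U V K : Type*} [AddCommGroup U] [Module ℂ U] [AddCommGroup V] [Module ℂ V]
  [AddCommGroup K] [Module ℂ K]

/-- The coefficient `Y(·)_n(·)` as a bilinear map. -/
def Yc (𝒱 : NLVA V) (n : ℤ) : V →ₗ[ℂ] V →ₗ[ℂ] V :=
  𝒱.Y.compr₂ (LinearMap.proj n)

/-- The operator `D(v) = v_{-2}𝟙`, i.e. the coefficient of `x^1` in `Y(v,x)𝟙`. -/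
def D (𝒱 : NLVA V) : V →ₗ[ℂ] V :=
  (LinearMap.proj (1 : ℤ)).comp (𝒱.Y.flip 𝒱.one)

/-- Homomorphisms of nonlocal vertex algebras. -/
def IsHom (𝒰 : NLVA U) (𝒱 : NLVA V) (f : U →ₗ[ℂ] V) : Prop :=
  f 𝒰.one = 𝒱.one ∧ ∀ (a b : U) (n : ℤ), f (𝒰.Y a b n) = 𝒱.Y (f a) (f b) n

/-- `𝒦` is generated, as a nonlocal vertex algebra, by the subset `S`. -/
def IsGeneratedBy (𝒦 : NLVA K) (S : Set K) : Prop :=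
  ∀ P : Submodule ℂ K, 𝒦.one ∈ P →
    (∀ a ∈ P, ∀ b ∈ P, ∀ n : ℤ, 𝒦.Y a b n ∈ P) → S ⊆ P → P = ⊤

/-- `𝒰` is irreducible as a module over itself. -/
def SelfIrreducible (𝒰 : NLVA U) : Prop :=
  Nontrivial U ∧
    ∀ P : Submodule ℂ U, (∀ u : U, ∀ p ∈ P, ∀ n : ℤ, 𝒰.Y u p n ∈ P) → P = ⊥ ∨ P = ⊤

/-- The coefficients of the product `Y(v₁,x₁)⋯Y(v_n,x_n)𝟙`. -/
def prodY (𝒱 : NLVA V) : (n : ℕ) → (Fin n → V) → (Fin n → ℤ) → V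
  | 0, _, _ => 𝒱.one
  | n + 1, v, k => 𝒱.Y (v 0) (prodY 𝒱 n (fun i => v i.succ) fun i => k i.succ) (k 0)

/-- Non-degeneracy in the sense of Etingof–Kazhdan: the maps
`Z_n : V^{⊗n} ⊗ ℂ((x₁))⋯((x_n)) → V((x₁))⋯((x_n))` are injective. -/
def NonDegenerate (𝒱 : NLVA V) : Prop :=
  ∀ n : ℕ, 0 < n → ∀ (r : ℕ) (v : Fin r → Fin n → V) (f : Fin r → (Fin n → ℤ) → ℂ),
    (∀ j, IsIterLaurent n (f j)) →
    LinearIndependent ℂ (fun j : Fin r => PiTensorProduct.tprod ℂ (v j)) →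
    (∀ K' : Fin n → ℤ,
      (∑ j : Fin r, ∑ᶠ L : Fin n → ℤ,
        f j L • 𝒱.prodY n (v j) fun i => K' i - L i) = 0) →
    ∀ j, f j = 0

end NLVA

/-- Countable dimension over `ℂ`. -/
def CountableDim (U : Type*) [AddCommGroup U] [Module ℂ U] : Prop :=
  ∃ s : Set U, s.Countable ∧ Submodule.span ℂ s = ⊤

/-- `𝒱` satisfies `𝒮`-locality, i.e. is a weak quantum vertex algebra. -/
def SLocal {V : Type*} [AddCommGroup V] [Module ℂ V] (𝒱 : NLVA V) : Prop :=
  ∀ u v : V, ∃ (r : ℕ) (uu vv : Fin r → V) (f : Fin r → ℤ → ℂ) (k : ℕ),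
    (∀ i, IsLaurent (f i)) ∧ ∀ (w : V) (m n : ℤ),
      mulSubPow k (fun a b => 𝒱.Y u (𝒱.Y v w b) a) m n
        = mulSubPow k (fun a b => ∑ i, scalarMulSub (f i)
            (fun a' b' => 𝒱.Y (vv i) (𝒱.Y (uu i) w a') b') a b) m n

/-- A module for a nonlocal vertex algebra. -/
structure NLVAModule {V : Type*} [AddCommGroup V] [Module ℂ V] (𝒱 : NLVA V)
    (W : Type*) [AddCommGroup W] [Module ℂ W] where
  Yw : V →ₗ[ℂ] W →ₗ[ℂ] (ℤ → W)
  trunc : ∀ (v : V) (w : W), IsLaurent (Yw v w)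
  vacuum : ∀ (w : W) (n : ℤ), Yw 𝒱.one w n = if n = 0 then w else 0
  weak_assoc : ∀ (u v : V) (w : W), ∃ k : ℕ, ∀ a b : ℤ,
    mulAddPow k (substAdd02 fun m n => Yw u (Yw v w n) m) a b
      = mulAddPow k (fun a' b' => Yw (𝒱.Y u v a') w b') a b

section Twist

variable {U V : Type*} [AddCommGroup U] [Module ℂ U] [AddCommGroup V] [Module ℂ V]

/-- Coefficient of `x₁^m x₂^n` in `(Y(x₂)⊗1)R²³(x₁)R¹²(x₁+x₂)` applied to `v ⊗ u ⊗ u'`. -/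
def hex1RHS (𝒰 : NLVA U) (Rc : ℤ → (V ⊗[ℂ] U →ₗ[ℂ] U ⊗[ℂ] V))
    (v : V) (u u' : U) (m n : ℤ) : U ⊗[ℂ] V :=
  ∑ᶠ (i : ℕ) (c : ℤ),
    ((zchoose (m - c + i) i : ℤ) : ℂ) •
      (TensorProduct.map (TensorProduct.lift (𝒰.Yc (n - i))) LinearMap.id)
        ((TensorProduct.assoc ℂ U U V).symm
          ((LinearMap.lTensor U (Rc c))
            ((TensorProduct.assoc ℂ U V U)
              ((Rc (m - c + i) (v ⊗ₜ u)) ⊗ₜ u'))))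

/-- Coefficient of `x₁^m x₂^n` in `(1⊗Y(x₂))R¹²(x₁-x₂)R²³(x₁)` applied to `v ⊗ v' ⊗ u`. -/
def hex2RHS (𝒱 : NLVA V) (Rc : ℤ → (V ⊗[ℂ] U →ₗ[ℂ] U ⊗[ℂ] V))
    (v v' : V) (u : U) (m n : ℤ) : U ⊗[ℂ] V :=
  ∑ᶠ (i : ℕ) (c : ℤ),
    ((-1 : ℂ) ^ i * ((zchoose (m - c + i) i : ℤ) : ℂ)) •
      (LinearMap.lTensor U (TensorProduct.lift (𝒱.Yc (n - i))))
        ((TensorProduct.assoc ℂ U V V)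
          ((TensorProduct.map (Rc (m - c + i)) LinearMap.id)
            ((TensorProduct.assoc ℂ V U V).symm
              (v ⊗ₜ (Rc c (v' ⊗ₜ u))))))

/-- A twisting operator `R(x) : V ⊗ U → U ⊗ V ⊗ ℂ((x))` for the ordered pair `(U,V)`,
given by its family of coefficients `Rc n`. -/
structure TwistingOp (𝒰 : NLVA U) (𝒱 : NLVA V) where
  Rc : ℤ → (V ⊗[ℂ] U →ₗ[ℂ] U ⊗[ℂ] V)
  laurent : ∀ t : V ⊗[ℂ] U, IsTensorLaurent fun n => Rc n t
  vac_right : ∀ (v : V) (n : ℤ),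
    Rc n (v ⊗ₜ 𝒰.one) = if n = 0 then 𝒰.one ⊗ₜ v else 0
  vac_left : ∀ (u : U) (n : ℤ),
    Rc n (𝒱.one ⊗ₜ u) = if n = 0 then u ⊗ₜ 𝒱.one else 0
  hex1 : ∀ (v : V) (u u' : U) (m n : ℤ),
    Rc m (v ⊗ₜ (𝒰.Y u u' n)) = hex1RHS 𝒰 Rc v u u' m n
  hex2 : ∀ (v v' : V) (u : U) (m n : ℤ),
    Rc m ((𝒱.Y v v' n) ⊗ₜ u) = hex2RHS 𝒱 Rc v v' u m n

/-- `Sc` is a two-sided inverse of `Rc` as `ℂ((x))`-linear maps (coefficientwise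
convolution), with values in the tensor with `ℂ((x))`. -/
def IsInvPair {A B : Type*} [AddCommGroup A] [Module ℂ A] [AddCommGroup B] [Module ℂ B]
    (Rc : ℤ → (A →ₗ[ℂ] B)) (Sc : ℤ → (B →ₗ[ℂ] A)) : Prop :=
  (∀ t : B, IsTensorLaurent fun n => Sc n t) ∧
  (∀ (t : A) (n : ℤ), (∑ᶠ c : ℤ, Sc c (Rc (n - c) t)) = if n = 0 then t else 0) ∧
  (∀ (t : B) (n : ℤ), (∑ᶠ c : ℤ, Rc c (Sc (n - c) t)) = if n = 0 then t else 0)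

/-- The canonical embedding `u ↦ u ⊗ 𝟙`. -/
def iotaU (𝒱 : NLVA V) : U →ₗ[ℂ] U ⊗[ℂ] V := (TensorProduct.mk ℂ U V).flip 𝒱.one

/-- The canonical embedding `v ↦ 𝟙 ⊗ v`. -/
def iotaV (𝒰 : NLVA U) : V →ₗ[ℂ] U ⊗[ℂ] V := TensorProduct.mk ℂ U V 𝒰.one

/-- The operator `D ⊗ 1 + 1 ⊗ D` on `U ⊗ V`. -/
def DUV (𝒰 : NLVA U) (𝒱 : NLVA V) : U ⊗[ℂ] V →ₗ[ℂ] U ⊗[ℂ] V :=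
  LinearMap.rTensor V 𝒰.D + LinearMap.lTensor U 𝒱.D

/-- The coefficient of `x^n` in `Y_R(u⊗v, x)(u'⊗v') = (Y(x)⊗Y(x))R²³(-x)(u⊗v⊗u'⊗v')`. -/
def YRcoef (𝒰 : NLVA U) (𝒱 : NLVA V) (Rop : TwistingOp 𝒰 𝒱)
    (u : U) (v : V) (u' : U) (v' : V) (n : ℤ) : U ⊗[ℂ] V :=
  ∑ᶠ (c : ℤ) (a : ℤ),
    ((-1 : ℂ) ^ c) •
      (TensorProduct.map (𝒰.Yc a u) ((𝒱.Yc (n - c - a)).flip v'))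
        (Rop.Rc c (v ⊗ₜ u'))

/-- `𝒯` is the twisted tensor product nonlocal vertex algebra `U ⊗_R V`. -/
def IsTwistedTensor (𝒰 : NLVA U) (𝒱 : NLVA V) (Rop : TwistingOp 𝒰 𝒱)
    (𝒯 : NLVA (U ⊗[ℂ] V)) : Prop :=
  𝒯.one = 𝒰.one ⊗ₜ 𝒱.one ∧
  ∀ (u u' : U) (v v' : V) (n : ℤ),
    𝒯.Y (u ⊗ₜ v) (u' ⊗ₜ v') n = YRcoef 𝒰 𝒱 Rop u v u' v' n

end Twist

section Aux

variable {A B W T : Type*} [AddCommGroup A] [Module ℂ A] [AddCommGroup B] [Module ℂ B]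
  [AddCommGroup W] [Module ℂ W] [AddCommGroup T] [Module ℂ T]

/-- The linear map `(a ⊗ b) ↦ Y_A(a)_e (Y_B(b)_j w)`, i.e. the coefficient
of `Y_A(x₂)(1 ⊗ Y_B(x₁)) (· ⊗ · ⊗ w)` at `x₂^e x₁^j`. -/
def sandwichMod (YA : A →ₗ[ℂ] W →ₗ[ℂ] (ℤ → W)) (YB : B →ₗ[ℂ] W →ₗ[ℂ] (ℤ → W))
    (w : W) (e j : ℤ) : A ⊗[ℂ] B →ₗ[ℂ] W :=
  TensorProduct.lift
    ((YA.compr₂ (LinearMap.proj e)).compl₂ ((YB.compr₂ (LinearMap.proj j)).flip w))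

/-- Coefficient of `x₁^m x₂^n` in `Y_A(x₂)(1 ⊗ Y_B(x₁)) q(x₂ - x₁) (⋯ ⊗ w)`, where the
series `q` is evaluated at `x₂ - x₁`, expanded in nonnegative powers of `x₁`. -/
def twistRHS (YA : A →ₗ[ℂ] W →ₗ[ℂ] (ℤ → W)) (YB : B →ₗ[ℂ] W →ₗ[ℂ] (ℤ → W))
    (q : ℤ → A ⊗[ℂ] B) (w : W) : ℤ → ℤ → W := fun m n =>
  ∑ᶠ (i : ℕ) (p : ℤ),
    ((-1 : ℂ) ^ i * ((zchoose p i : ℤ) : ℂ)) •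
      sandwichMod YA YB w (n - p + i) (m - i) (q p)

/-- As `twistRHS`, but with `q` evaluated at `-x₂ + x₁`, expanded in nonnegative
powers of `x₂`. -/
def twistRHSalt (YA : A →ₗ[ℂ] W →ₗ[ℂ] (ℤ → W)) (YB : B →ₗ[ℂ] W →ₗ[ℂ] (ℤ → W))
    (q : ℤ → A ⊗[ℂ] B) (w : W) : ℤ → ℤ → W := fun m n =>
  ∑ᶠ (i : ℕ) (p : ℤ),
    ((-1 : ℂ) ^ i * ((zchoose p i : ℤ) : ℂ)) •
      sandwichMod YA YB w (n - i) (m - p + i) (q p)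

/-- Coefficient of `x^n` in `e^{xD} F(x)` where `F` is given by its coefficients. -/
def expD (Dop : T →ₗ[ℂ] T) (F : ℤ → T) (n : ℤ) : T :=
  ∑ᶠ j : ℕ, ((j.factorial : ℂ))⁻¹ • (Dop ^ j) (F (n - j))

end Aux

section YBE

variable {V : Type*} [AddCommGroup V] [Module ℂ V]

/-- The flip of the last two tensor factors of `(V⊗V)⊗V`. -/
def swap23 : (V ⊗[ℂ] V) ⊗[ℂ] V →ₗ[ℂ] (V ⊗[ℂ] V) ⊗[ℂ] V :=
  ((TensorProduct.assoc ℂ V V V).symm.toLinearMap).comp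
    ((LinearMap.lTensor V (TensorProduct.comm ℂ V V).toLinearMap).comp
      (TensorProduct.assoc ℂ V V V).toLinearMap)

/-- `S¹²` acting on `(V⊗V)⊗V`. -/
def S12m (Sc : ℤ → (V ⊗[ℂ] V →ₗ[ℂ] V ⊗[ℂ] V)) (c : ℤ) :
    (V ⊗[ℂ] V) ⊗[ℂ] V →ₗ[ℂ] (V ⊗[ℂ] V) ⊗[ℂ] V :=
  TensorProduct.map (Sc c) LinearMap.id

/-- `S²³` acting on `(V⊗V)⊗V`. -/
def S23m (Sc : ℤ → (V ⊗[ℂ] V →ₗ[ℂ] V ⊗[ℂ] V)) (c : ℤ) :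
    (V ⊗[ℂ] V) ⊗[ℂ] V →ₗ[ℂ] (V ⊗[ℂ] V) ⊗[ℂ] V :=
  ((TensorProduct.assoc ℂ V V V).symm.toLinearMap).comp
    ((LinearMap.lTensor V (Sc c)).comp (TensorProduct.assoc ℂ V V V).toLinearMap)

/-- `S¹³` acting on `(V⊗V)⊗V`. -/
def S13m (Sc : ℤ → (V ⊗[ℂ] V →ₗ[ℂ] V ⊗[ℂ] V)) (c : ℤ) :
    (V ⊗[ℂ] V) ⊗[ℂ] V →ₗ[ℂ] (V ⊗[ℂ] V) ⊗[ℂ] V :=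
  swap23.comp ((S12m Sc c).comp swap23)

/-- `S²¹(x) = σ S(x) σ`. -/
def S21c (Sc : ℤ → (V ⊗[ℂ] V →ₗ[ℂ] V ⊗[ℂ] V)) (c : ℤ) :
    V ⊗[ℂ] V →ₗ[ℂ] V ⊗[ℂ] V :=
  ((TensorProduct.comm ℂ V V).toLinearMap).comp
    ((Sc c).comp (TensorProduct.comm ℂ V V).toLinearMap)

/-- The quantum Yang–Baxter equation
`S¹²(x)S¹³(x+z)S²³(z) = S²³(z)S¹³(x+z)S¹²(x)` (coefficient of `x^a z^b`, with
`S¹³(x+z)` expanded in nonnegative powers of `z`). -/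
def QYBE (Sc : ℤ → (V ⊗[ℂ] V →ₗ[ℂ] V ⊗[ℂ] V)) : Prop :=
  ∀ (t : (V ⊗[ℂ] V) ⊗[ℂ] V) (a b : ℤ),
    (∑ᶠ (i : ℕ) (p : ℤ), ((zchoose p i : ℤ) : ℂ) •
        S12m Sc (a - p + i) (S13m Sc p (S23m Sc (b - i) t)))
      = ∑ᶠ (i : ℕ) (p : ℤ), ((zchoose p i : ℤ) : ℂ) •
          S23m Sc (b - i) (S13m Sc p (S12m Sc (a - p + i) t))

/-- Unitarity: `S(x) S²¹(-x) = 1`. -/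
def Unitary (Sc : ℤ → (V ⊗[ℂ] V →ₗ[ℂ] V ⊗[ℂ] V)) : Prop :=
  ∀ (t : V ⊗[ℂ] V) (n : ℤ),
    (∑ᶠ c : ℤ, ((-1 : ℂ) ^ (n - c)) • Sc c (S21c Sc (n - c) t))
      = if n = 0 then t else 0

/-- `[D ⊗ 1, S(x)] = -(d/dx) S(x)`. -/
def DComm1 (𝒱 : NLVA V) (Sc : ℤ → (V ⊗[ℂ] V →ₗ[ℂ] V ⊗[ℂ] V)) : Prop :=
  ∀ (t : V ⊗[ℂ] V) (n : ℤ),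
    (LinearMap.rTensor V 𝒱.D) (Sc n t) - Sc n ((LinearMap.rTensor V 𝒱.D) t)
      = (-((n : ℂ) + 1)) • Sc (n + 1) t

/-- `Y(u,x)v = e^{xD} Y(-x) S(-x)(v⊗u)`. -/
def SkewS (𝒱 : NLVA V) (Sc : ℤ → (V ⊗[ℂ] V →ₗ[ℂ] V ⊗[ℂ] V)) : Prop :=
  ∀ (u v : V) (n : ℤ),
    𝒱.Y u v n = expD 𝒱.D (fun p => ((-1 : ℂ) ^ p) •
      ∑ᶠ c : ℤ, (TensorProduct.lift (𝒱.Yc (p - c))) (Sc c (v ⊗ₜ u))) n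

/-- `S(x₁)(Y(x₂)⊗1) = (Y(x₂)⊗1)S²³(x₁)S¹³(x₁+x₂)`. -/
def HexY1 (𝒱 : NLVA V) (Sc : ℤ → (V ⊗[ℂ] V →ₗ[ℂ] V ⊗[ℂ] V)) : Prop :=
  ∀ (t : (V ⊗[ℂ] V) ⊗[ℂ] V) (m n : ℤ),
    Sc m ((TensorProduct.map (TensorProduct.lift (𝒱.Yc n)) LinearMap.id) t)
      = ∑ᶠ (i : ℕ) (p : ℤ), ((zchoose p i : ℤ) : ℂ) •
          (TensorProduct.map (TensorProduct.lift (𝒱.Yc (n - i))) LinearMap.id)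
            (S23m Sc (m - p + i) (S13m Sc p t))

/-- `S(x₁)(1⊗Y(x₂)) = (1⊗Y(x₂))S¹²(x₁-x₂)S¹³(x₁)`. -/
def HexY2 (𝒱 : NLVA V) (Sc : ℤ → (V ⊗[ℂ] V →ₗ[ℂ] V ⊗[ℂ] V)) : Prop :=
  ∀ (t : (V ⊗[ℂ] V) ⊗[ℂ] V) (m n : ℤ),
    Sc m ((LinearMap.lTensor V (TensorProduct.lift (𝒱.Yc n)))
        ((TensorProduct.assoc ℂ V V V) t))
      = ∑ᶠ (i : ℕ) (p : ℤ), ((-1 : ℂ) ^ i * ((zchoose p i : ℤ) : ℂ)) •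
          (LinearMap.lTensor V (TensorProduct.lift (𝒱.Yc (n - i))))
            ((TensorProduct.assoc ℂ V V V)
              (S12m Sc p (S13m Sc (m - p + i) t)))

/-- A quantum vertex algebra `(V, 𝒮)`. -/
structure QVA (V : Type*) [AddCommGroup V] [Module ℂ V] where
  alg : NLVA V
  sloc : SLocal alg
  Sc : ℤ → (V ⊗[ℂ] V →ₗ[ℂ] V ⊗[ℂ] V)
  laurent : ∀ t : V ⊗[ℂ] V, IsTensorLaurent fun n => Sc n t
  qybe : QYBE Sc
  unitary : Unitary Sc
  vac : ∀ (v : V) (n : ℤ), Sc n (alg.one ⊗ₜ v) = if n = 0 then alg.one ⊗ₜ v else 0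
  dcomm : DComm1 alg Sc
  skew : SkewS alg Sc
  hex : HexY1 alg Sc

end YBE

section Bialg

variable {H : Type*} [AddCommGroup H] [Module ℂ H]

/-- A nonlocal vertex bialgebra. -/
structure NLVBialg (H : Type*) [AddCommGroup H] [Module ℂ H] where
  alg : NLVA H
  comul : H →ₗ[ℂ] H ⊗[ℂ] H
  counit : H →ₗ[ℂ] ℂ
  coassoc : ∀ h : H, (LinearMap.lTensor H comul) (comul h)
      = (TensorProduct.assoc ℂ H H H) ((LinearMap.rTensor H comul) (comul h))
  counit_comul_left : ∀ h : H,
      (TensorProduct.lid ℂ H) ((LinearMap.rTensor H counit) (comul h)) = h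
  counit_comul_right : ∀ h : H,
      (TensorProduct.rid ℂ H) ((LinearMap.lTensor H counit) (comul h)) = h
  counit_one : counit alg.one = 1
  counit_mul : ∀ (a b : H) (n : ℤ),
      counit (alg.Y a b n) = if n = 0 then counit a * counit b else 0
  comul_one : comul alg.one = alg.one ⊗ₜ alg.one
  comul_mul : ∀ (a b : H) (n : ℤ),
      comul (alg.Y a b n)
        = ∑ᶠ p : ℤ, (TensorProduct.map₂ (alg.Yc p) (alg.Yc (n - p))) (comul a) (comul b)

/-- A nonlocal vertex `H`-module-algebra. -/
structure NLVModAlg (𝓗 : NLVBialg H) (U : Type*) [AddCommGroup U] [Module ℂ U] where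
  alg : NLVA U
  act : NLVAModule 𝓗.alg U
  scalar : ∀ (h : H) (u : U), IsTensorLaurent fun n => act.Yw h u n
  vac : ∀ (h : H) (n : ℤ),
      act.Yw h alg.one n = if n = 0 then 𝓗.counit h • alg.one else 0
  compat : ∀ (h : H) (u v : U) (m n : ℤ),
      act.Yw h (alg.Y u v n) m
        = ∑ᶠ (i : ℕ) (p : ℤ), ((-1 : ℂ) ^ i * ((zchoose p i : ℤ) : ℂ)) •
            (TensorProduct.lift
              (((alg.Yc (n - i)).comp ((act.Yw.compr₂ (LinearMap.proj p)).flip u)).compl₂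
                ((act.Yw.compr₂ (LinearMap.proj (m - p + i))).flip v)))
            (𝓗.comul h)

/-- A nonlocal vertex `H`-comodule-algebra. -/
structure NLVComodAlg (𝓗 : NLVBialg H) (V : Type*) [AddCommGroup V] [Module ℂ V] where
  alg : NLVA V
  rho : V →ₗ[ℂ] H ⊗[ℂ] V
  coassoc : ∀ v : V, (LinearMap.lTensor H rho) (rho v)
      = (TensorProduct.assoc ℂ H H V) ((LinearMap.rTensor V 𝓗.comul) (rho v))
  counit_rho : ∀ v : V,
      (TensorProduct.lid ℂ V) ((LinearMap.rTensor V 𝓗.counit) (rho v)) = v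
  rho_one : rho alg.one = 𝓗.alg.one ⊗ₜ alg.one
  rho_mul : ∀ (v v' : V) (n : ℤ),
      rho (alg.Y v v' n)
        = ∑ᶠ p : ℤ, (TensorProduct.map₂ (𝓗.alg.Yc p) (alg.Yc (n - p))) (rho v) (rho v')

/-- The coefficient of `x^n` in
`Y_♯(u⊗v, x)(u'⊗v') = Y(u,x)Y(b¹(v),x)u' ⊗ Y(v²,x)v'`. -/
def Ysharp (𝓗 : NLVBialg H) {U V : Type*} [AddCommGroup U] [Module ℂ U]
    [AddCommGroup V] [Module ℂ V] (MU : NLVModAlg 𝓗 U) (CV : NLVComodAlg 𝓗 V)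
    (u : U) (v : V) (u' : U) (v' : V) (n : ℤ) : U ⊗[ℂ] V :=
  ∑ᶠ (a : ℤ) (p : ℤ),
    (TensorProduct.map
      ((MU.alg.Yc a u).comp ((MU.act.Yw.compr₂ (LinearMap.proj p)).flip u'))
      ((CV.alg.Yc (n - a - p)).flip v'))
    (CV.rho v)

/-- Rearrangement `(H⊗V)⊗U → (H⊗U)⊗V`. -/
def smashSwap {U V : Type*} [AddCommGroup U] [Module ℂ U]
    [AddCommGroup V] [Module ℂ V] :
    (H ⊗[ℂ] V) ⊗[ℂ] U →ₗ[ℂ] (H ⊗[ℂ] U) ⊗[ℂ] V :=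
  ((TensorProduct.assoc ℂ H U V).symm.toLinearMap).comp
    ((LinearMap.lTensor H (TensorProduct.comm ℂ V U).toLinearMap).comp
      (TensorProduct.assoc ℂ H V U).toLinearMap)

/-- The coefficient of `x^n` in `R(x)(v⊗u) = Y(b¹(v),-x)u ⊗ v²`. -/
def Rsmash (𝓗 : NLVBialg H) {U V : Type*} [AddCommGroup U] [Module ℂ U]
    [AddCommGroup V] [Module ℂ V] (MU : NLVModAlg 𝓗 U) (CV : NLVComodAlg 𝓗 V)
    (n : ℤ) : V ⊗[ℂ] U →ₗ[ℂ] U ⊗[ℂ] V :=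
  ((-1 : ℂ) ^ n) •
    ((TensorProduct.map
        (TensorProduct.lift (MU.act.Yw.compr₂ (LinearMap.proj n))) LinearMap.id).comp
      (smashSwap.comp (LinearMap.rTensor U CV.rho)))

end Bialg

noncomputable section

section SchurDensity

variable {W M : Type*} [AddCommGroup W] [Module ℂ W] [AddCommGroup M] [Module ℂ M]

/-- The space `W` is simple under the set `𝒜` of operators. -/
def IsSimpleUnder (𝒜 : Set (Module.End ℂ W)) : Prop :=
  Nontrivial W ∧ ∀ P : Submodule ℂ W, (∀ a ∈ 𝒜, ∀ p ∈ P, a p ∈ P) → P = ⊥ ∨ P = ⊤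

lemma CountableDim.rank_le (h : CountableDim W) : Module.rank ℂ W ≤ Cardinal.aleph0 := by
  obtain ⟨s, hs, hspan⟩ := h
  have := rank_span_le (R := ℂ) s
  rw [hspan, rank_top] at this
  exact this.trans (Cardinal.le_aleph0_iff_set_countable.mpr hs)

lemma exists_eigen_of_countableDim [Nontrivial W] (hcd : CountableDim W)
    (θ : Module.End ℂ W) : ∃ c : ℂ, ¬ Function.Bijective (θ - algebraMap ℂ (Module.End ℂ W) c) := by
  by_contra! hbij
  obtain ⟨w₀, hw₀⟩ := exists_ne (0 : W)
  choose g hg using fun c => (hbij c).2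
  have hdep : ¬ LinearIndependent ℂ (fun c : ℂ => g c w₀) := by
    intro hli
    have h1 := hli.cardinal_lift_le_rank
    have h2 := (Cardinal.lift_le.{0}.mpr hcd.rank_le)
    have h3 : Cardinal.lift.{0} (Module.rank ℂ W) ≤ Cardinal.aleph0 := by
      simpa using h2
    have h4 := h1.trans h3
    rw [Cardinal.lift_le_aleph0] at h4
    exact absurd h4 (not_le.mpr (by rw [Cardinal.mk_complex]; exact Cardinal.aleph0_lt_continuum))
  rw [not_linearIndependent_iff] at hdep
  obtain ⟨s, a, hsum, c₀, hc₀, hac₀⟩ := hdep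
  classical
  let p : Polynomial ℂ :=
    ∑ c ∈ s, Polynomial.C (a c) * ∏ d ∈ s.erase c, (Polynomial.X - Polynomial.C d)
  have hp : p ≠ 0 := by
    intro h0
    have : p.eval c₀ = a c₀ * ∏ d ∈ s.erase c₀, (c₀ - d) := by
      simp only [p, Polynomial.eval_finsetSum, Polynomial.eval_mul, Polynomial.eval_C,
        Polynomial.eval_prod, Polynomial.eval_sub, Polynomial.eval_X]
      refine Finset.sum_eq_single c₀ (fun b hb hbc => ?_) (fun h => absurd hc₀ h)
      rw [Finset.prod_eq_zero (i := c₀), mul_zero]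
      · exact Finset.mem_erase.mpr ⟨hbc.symm, hc₀⟩
      · simp
    rw [h0, Polynomial.eval_zero] at this
    refine mul_ne_zero hac₀ (Finset.prod_ne_zero_iff.mpr fun d hd => ?_) this.symm
    exact sub_ne_zero.mpr (Finset.ne_of_mem_erase hd).symm
  have hpw : Polynomial.aeval θ p w₀ = 0 := by
    have key : ∀ c ∈ s, Polynomial.aeval θ (Polynomial.C (a c) *
        ∏ d ∈ s.erase c, (Polynomial.X - Polynomial.C d)) w₀
        = Polynomial.aeval θ (∏ d ∈ s, (Polynomial.X - Polynomial.C d)) (a c • g c w₀) := by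
      intro c hc
      rw [← Finset.prod_erase_mul s _ hc, map_mul, map_mul, Module.End.mul_apply,
        Module.End.mul_apply, map_sub, Polynomial.aeval_X, Polynomial.aeval_C, Polynomial.aeval_C,
        map_smul, hg c w₀, map_smul]
      simp
    simp only [p, map_sum, LinearMap.sum_apply]
    rw [Finset.sum_congr rfl key, ← map_sum, hsum, map_zero]
  have hunit : ∀ c : ℂ, c ∉ spectrum ℂ θ := by
    intro c hc
    rw [spectrum.mem_iff] at hc
    apply hc
    rw [← neg_sub, IsUnit.neg_iff, Module.End.isUnit_iff]
    exact hbij c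
  have hu : IsUnit (Polynomial.aeval θ
      (p.roots.map fun x => Polynomial.X - Polynomial.C x).prod) := by
    by_contra h
    obtain ⟨k, hk, -⟩ := spectrum.exists_mem_of_not_isUnit_aeval_prod h
    exact hunit k hk
  have hsplit := (IsAlgClosed.splits p).eq_prod_roots
  rw [hsplit, map_mul, Polynomial.aeval_C, Module.End.mul_apply] at hpw
  rw [Module.algebraMap_end_apply, smul_eq_zero] at hpw
  rcases hpw with h | h
  · exact hp (Polynomial.leadingCoeff_eq_zero.mp h)
  · exact hw₀ (((Module.End.isUnit_iff _).mp hu).1 (h.trans (map_zero _).symm))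

lemma IsSimpleUnder.schur {𝒜 : Set (Module.End ℂ W)} (h𝒜 : IsSimpleUnder 𝒜)
    (hcd : CountableDim W) (θ : Module.End ℂ W) (hθ : ∀ a ∈ 𝒜, ∀ w, θ (a w) = a (θ w)) :
    ∃ c : ℂ, ∀ w, θ w = c • w := by
  have := h𝒜.1
  obtain ⟨c, hc⟩ := exists_eigen_of_countableDim hcd θ
  refine ⟨c, ?_⟩
  set η := θ - algebraMap ℂ (Module.End ℂ W) c with hη
  have hηc : ∀ a ∈ 𝒜, ∀ w, η (a w) = a (η w) := by
    intro a ha w; simp [hη, hθ a ha w]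
  have hker := h𝒜.2 (LinearMap.ker η) (fun a ha p hp => by
    rw [LinearMap.mem_ker] at hp ⊢; rw [hηc a ha, hp, map_zero])
  have hran := h𝒜.2 (LinearMap.range η) (by
    rintro a ha _ ⟨w, rfl⟩; exact ⟨a w, hηc a ha w⟩)
  have hzero : η = 0 := by
    rcases hker with hk | hk
    · rcases hran with hr | hr
      · exact LinearMap.range_eq_bot.mp hr
      · exact absurd ⟨LinearMap.ker_eq_bot.mp hk, LinearMap.range_eq_top.mp hr⟩ hc
    · exact LinearMap.ker_eq_top.mp hk
  intro w
  have := LinearMap.congr_fun hzero w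
  simpa [hη, sub_eq_zero] using this

lemma IsSimpleUnder.coeff_zero {𝒜 : Set (Module.End ℂ W)} (h𝒜 : IsSimpleUnder 𝒜)
    (hcd : CountableDim W) (K : Submodule ℂ (W ⊗[ℂ] M))
    (hK : ∀ a ∈ 𝒜, ∀ t ∈ K, LinearMap.rTensor M a t ∈ K) (w₀ : W) (hw₀ : w₀ ≠ 0)
    (hK₀ : ∀ m : M, w₀ ⊗ₜ m ∈ K → m = 0) {ι : Type*} (b : ι → M)
    (hb : LinearIndependent ℂ b) (s : Finset ι) :
    ∀ w : ι → W, ∑ i ∈ s, w i ⊗ₜ[ℂ] b i ∈ K → ∀ i ∈ s, w i = 0 := by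
  classical
  induction s using Finset.induction_on with
  | empty => simp
  | insert j s hj ih =>
    let L : (ι → W) →ₗ[ℂ] W ⊗[ℂ] M :=
      ∑ i ∈ insert j s, (((TensorProduct.mk ℂ W M).flip (b i)).comp (LinearMap.proj i))
    have hL : ∀ w, L w = ∑ i ∈ insert j s, w i ⊗ₜ[ℂ] b i := by
      intro w; simp [L, LinearMap.sum_apply]
    let G : Submodule ℂ (ι → W) := K.comap L ⊓
      { carrier := {w | ∀ i ∉ insert j s, w i = 0}
        add_mem' := fun {x y} hx hy i hi => by simp [hx i hi, hy i hi]
        zero_mem' := fun i _ => rfl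
        smul_mem' := fun c x hx i hi => by simp [hx i hi] }
    have hG : ∀ w, w ∈ G ↔ (∑ i ∈ insert j s, w i ⊗ₜ[ℂ] b i ∈ K) ∧ ∀ i ∉ insert j s, w i = 0 := by
      intro w
      rw [← hL]; rfl
    have hGs : ∀ a ∈ 𝒜, ∀ w ∈ G, (fun i => a (w i)) ∈ G := by
      intro a ha w hw
      rw [hG] at hw ⊢
      refine ⟨?_, fun i hi => by simp [hw.2 i hi]⟩
      have := hK a ha _ hw.1
      simpa [map_sum] using this
    have hinj : ∀ w ∈ G, w j = 0 → w = 0 := by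
      intro w hw hwj
      rw [hG] at hw
      have h1 := hw.1
      rw [Finset.sum_insert hj, hwj, TensorProduct.zero_tmul, zero_add] at h1
      funext i
      by_cases hi : i ∈ insert j s
      · rcases Finset.mem_insert.mp hi with rfl | hi
        · exact hwj
        · exact ih w h1 i hi
      · exact hw.2 i hi
    -- every element of `G` vanishes at `j`
    have hGj : ∀ w ∈ G, w j = 0 := by
      let pj : G →ₗ[ℂ] W := (LinearMap.proj j).comp G.subtype
      have hpinj : Function.Injective pj := by
        rw [← LinearMap.ker_eq_bot, LinearMap.ker_eq_bot']
        rintro ⟨w, hw⟩ h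
        exact Subtype.ext (hinj w hw h)
      rcases h𝒜.2 (LinearMap.range pj) (by
        rintro a ha _ ⟨w, rfl⟩
        exact ⟨⟨_, hGs a ha w.1 w.2⟩, rfl⟩) with hr | hr
      · intro w hw
        have : pj ⟨w, hw⟩ ∈ LinearMap.range pj := ⟨_, rfl⟩
        rw [hr] at this
        exact (Submodule.mem_bot ℂ).mp this
      · exfalso
        let e := (LinearEquiv.ofBijective pj ⟨hpinj, LinearMap.range_eq_top.mp hr⟩).symm
        have hej : ∀ w, (e w).1 j = w := fun w =>
          (LinearEquiv.ofBijective pj ⟨hpinj, LinearMap.range_eq_top.mp hr⟩).apply_symm_apply w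
        have hea : ∀ a ∈ 𝒜, ∀ w, (e (a w)).1 = fun i => a ((e w).1 i) := by
          intro a ha w
          have hd : (e (a w)).1 - (fun i => a ((e w).1 i)) ∈ G :=
            G.sub_mem (e (a w)).2 (hGs a ha _ (e w).2)
          have := hinj _ hd (by simp [hej])
          exact sub_eq_zero.mp this
        have hsc := fun i => h𝒜.schur hcd ((LinearMap.proj i).comp (G.subtype.comp e.toLinearMap))
          (fun a ha w => by simpa using congrFun (hea a ha w) i)
        choose c hc using hsc
        have hc' : ∀ i w, (e w).1 i = c i • w := fun i w => by simpa using hc i w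
        have hmem := ((hG _).mp (e w₀).2).1
        simp only [hc', TensorProduct.smul_tmul] at hmem
        rw [← TensorProduct.tmul_sum] at hmem
        have hz := hK₀ _ hmem
        have hcj := (linearIndependent_iff'.mp hb) _ _ hz j (Finset.mem_insert_self j s)
        have := hej w₀
        rw [hc', hcj, zero_smul] at this
        exact hw₀ this.symm
    intro w hw
    have hw' : (fun i => if i ∈ insert j s then w i else 0) ∈ G := by
      rw [hG]
      refine ⟨?_, fun i hi => by simp only [if_neg hi]⟩
      rwa [Finset.sum_congr rfl (g := fun i => w i ⊗ₜ[ℂ] b i)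
        (fun i hi => by simp only [if_pos hi])]
    have h0 := hinj _ hw' (hGj _ hw')
    intro i hi
    have := congrFun h0 i
    simpa only [if_pos hi, Pi.zero_apply] using this

/-- A subspace of `W ⊗ M` stable under operators on the simple factor `W`, and meeting
`w₀ ⊗ M` trivially, is zero. -/
lemma IsSimpleUnder.tensor_eq_bot {𝒜 : Set (Module.End ℂ W)} (h𝒜 : IsSimpleUnder 𝒜)
    (hcd : CountableDim W) (K : Submodule ℂ (W ⊗[ℂ] M))
    (hK : ∀ a ∈ 𝒜, ∀ t ∈ K, LinearMap.rTensor M a t ∈ K) (w₀ : W) (hw₀ : w₀ ≠ 0)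
    (hK₀ : ∀ m : M, w₀ ⊗ₜ m ∈ K → m = 0) : K = ⊥ := by
  rw [eq_bot_iff]
  intro t ht
  classical
  let b := Module.Basis.ofVectorSpace ℂ M
  let e := TensorProduct.equivFinsuppOfBasisRight (M := W) b
  have hts : t = ∑ i ∈ (e t).support, (e t) i ⊗ₜ[ℂ] b i := by
    have := TensorProduct.equivFinsuppOfBasisRight_symm_apply (M := W) b (e t)
    rwa [LinearEquiv.symm_apply_apply] at this
  have := h𝒜.coeff_zero hcd K hK w₀ hw₀ hK₀ b b.linearIndependent _ (e t) (hts ▸ ht)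
  rw [Submodule.mem_bot, hts]
  exact Finset.sum_eq_zero fun i hi => by rw [this i hi, TensorProduct.zero_tmul]

end SchurDensity

end

noncomputable section

lemma finsum_nat_eq_sum_range {M : Type*} [AddCommMonoid M] {f : ℕ → M} (n : ℕ)
    (h : ∀ i, n ≤ i → f i = 0) : ∑ᶠ i, f i = ∑ i ∈ Finset.range n, f i := by
  refine finsum_eq_sum_of_support_subset _ fun i hi => ?_
  simp only [Finset.coe_range, Set.mem_Iio]
  by_contra h'
  exact hi (h i (not_lt.mp h'))

lemma finsum_int_eq_sum_Ico {M : Type*} [AddCommMonoid M] {f : ℤ → M} (a b : ℤ)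
    (h₁ : ∀ i, i < a → f i = 0) (h₂ : ∀ i, b ≤ i → f i = 0) :
    ∑ᶠ i, f i = ∑ i ∈ Finset.Ico a b, f i := by
  refine finsum_eq_sum_of_support_subset _ fun i hi => ?_
  simp only [Finset.coe_Ico, Set.mem_Ico]
  constructor
  · by_contra h'
    exact hi (h₁ i (not_le.mp h'))
  · by_contra h'
    exact hi (h₂ i (not_lt.mp h'))

/-- The space `P((x))` of Laurent series with coefficients in the `R`-module `P`. -/
abbrev LS (R P : Type*) [CommRing R] [AddCommGroup P] [Module R P] := HahnModule ℤ R P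

namespace LS

section Ring

variable {R P Q M : Type*} [CommRing R] [AddCommGroup P] [Module R P]
  [AddCommGroup Q] [Module R Q] [AddCommGroup M] [Module R M]

/-- The coefficient of `x^n`. -/
def cf (n : ℤ) : LS R P →ₗ[R] P where
  toFun A := ((HahnModule.of R).symm A).coeff n
  map_add' A B := by simp
  map_smul' c A := rfl

lemma ext {A B : LS R P} (h : ∀ n, cf n A = cf n B) : A = B :=
  HahnModule.ext _ _ (funext h)

lemma exists_bound (A : LS R P) : ∃ N : ℤ, ∀ n < N, cf n A = 0 :=
  ⟨_, fun _ hn => HahnSeries.coeff_eq_zero_of_lt_order hn⟩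

lemma exists_bound_coeff (f : LaurentSeries R) : ∃ N : ℤ, ∀ n < N, f.coeff n = 0 :=
  ⟨_, fun _ hn => HahnSeries.coeff_eq_zero_of_lt_order hn⟩

/-- The Laurent series with a given truncated family of coefficients. -/
def mk (a : ℤ → P) (h : ∃ N : ℤ, ∀ n < N, a n = 0) : LS R P :=
  HahnModule.of R (HahnSeries.ofSuppBddBelow a (by
    obtain ⟨N, hN⟩ := h
    exact ⟨N, fun n hn => by_contra fun h' => hn (hN n (not_le.mp h'))⟩))

@[simp] lemma cf_mk (a : ℤ → P) (h : ∃ N : ℤ, ∀ n < N, a n = 0) (n : ℤ) :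
    cf n (mk (R := R) a h) = a n := rfl

lemma cf_smul_finsum (f : LaurentSeries R) (A : LS R P) (n : ℤ) :
    cf n (f • A) = ∑ᶠ p : ℤ, f.coeff p • cf (n - p) A := by
  change ((HahnModule.of R).symm (f • A)).coeff n = _
  rw [HahnModule.coeff_smul]
  obtain ⟨N, hN⟩ := exists_bound_coeff f
  obtain ⟨N', hN'⟩ := exists_bound A
  rw [finsum_eq_sum_of_support_subset (s := (Finset.VAddAntidiagonal n
    (Set.VAddAntidiagonal.finite_of_isPWO f.isPWO_support
      ((HahnModule.of R).symm A).isPWO_support n)).image Prod.fst)]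
  · rw [Finset.sum_image]
    · refine Finset.sum_congr rfl fun x hx => ?_
      rw [Finset.mem_vaddAntidiagonal] at hx
      have : x.2 = n - x.1 := by have := hx.2.2; simp only [vadd_eq_add] at this; omega
      rw [this]; rfl
    · intro x hx y hy hxy
      simp only [Finset.mem_coe, Finset.mem_vaddAntidiagonal, vadd_eq_add] at hx hy
      exact Prod.ext hxy (by omega)
  · intro p hp
    simp only [Finset.coe_image, Set.mem_image, Finset.mem_coe, Finset.mem_vaddAntidiagonal]
    refine ⟨(p, n - p), ⟨fun h => hp ?_, fun h => hp ?_, by simp⟩, rfl⟩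
    · simp only [h, zero_smul]
    · have : cf (n - p) A = 0 := h
      simp only [this, smul_zero]

lemma coeff_mul_finsum (f g : LaurentSeries R) (n : ℤ) :
    (f * g).coeff n = ∑ᶠ p : ℤ, f.coeff p * g.coeff (n - p) :=
  cf_smul_finsum f (HahnModule.of R g : LS R R) n

lemma cf_smul (f : LaurentSeries R) (A : LS R P) (n a b : ℤ)
    (ha : ∀ p < a, f.coeff p = 0) (hb : ∀ q ≤ n - b, cf q A = 0) :
    cf n (f • A) = ∑ p ∈ Finset.Ico a b, f.coeff p • cf (n - p) A := by
  rw [cf_smul_finsum, finsum_int_eq_sum_Ico a b]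
  · intro i hi; rw [ha i hi, zero_smul]
  · intro i hi; rw [hb _ (by omega), smul_zero]

lemma cf_smul_lt (f : LaurentSeries R) (A : LS R P) {a b n : ℤ}
    (ha : ∀ p < a, f.coeff p = 0) (hb : ∀ q < b, cf q A = 0) (hn : n < a + b) :
    cf n (f • A) = 0 := by
  rw [cf_smul f A n a a ha (fun q hq => hb q (by omega))]
  simp

lemma cf_single_smul (k : ℤ) (c : R) (A : LS R P) (n : ℤ) :
    cf n ((HahnSeries.single k c : LaurentSeries R) • A) = c • cf (n - k) A := by
  rw [cf_smul_finsum, finsum_eq_single _ k]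
  · simp
  · intro p hp; rw [HahnSeries.coeff_single_of_ne hp, zero_smul]

/-- The operator `∑ xⁱ Φᵢ` on Laurent series. -/
def Op (Φ : ℕ → P →ₗ[R] Q) : LS R P →ₗ[LaurentSeries R] LS R Q where
  toFun A := mk (fun n => ∑ᶠ i : ℕ, Φ i (cf (n - i) A)) (by
    obtain ⟨N, hN⟩ := exists_bound A
    refine ⟨N, fun n hn => ?_⟩
    rw [finsum_nat_eq_sum_range 0]
    · simp
    · intro i _; rw [hN _ (by omega), map_zero])
  map_add' A B := by
    apply ext; intro n
    simp only [cf_mk, map_add]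
    obtain ⟨N, hN⟩ := exists_bound A
    obtain ⟨N', hN'⟩ := exists_bound B
    have e : ∀ (C : LS R P) (b : ℤ) (_ : ∀ n < b, cf n C = 0) (i : ℕ)
      (_ : n - b < i), Φ i (cf (n - i) C) = 0 := by
      intro C b hb i hi; rw [hb _ (by omega), map_zero]
    have hM : n - N < ((n - N).natAbs + (n - N').natAbs + 1 : ℕ) := by omega
    have hM' : n - N' < ((n - N).natAbs + (n - N').natAbs + 1 : ℕ) := by omega
    set K : ℕ := (n - N).natAbs + (n - N').natAbs + 1
    rw [finsum_nat_eq_sum_range K fun i hi => e A N hN i (by omega),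
      finsum_nat_eq_sum_range K fun i hi => e B N' hN' i (by omega),
      finsum_nat_eq_sum_range K fun i hi => by
        rw [e A N hN i (by omega), e B N' hN' i (by omega), add_zero]]
    rw [← Finset.sum_add_distrib]
  map_smul' f A := by
    apply ext; intro n
    obtain ⟨N, hN⟩ := exists_bound A
    obtain ⟨Nf, hNf⟩ := exists_bound_coeff f
    have hM : n - N - Nf < ((n - N - Nf).natAbs + 1 : ℕ) := by omega
    set M : ℕ := (n - N - Nf).natAbs + 1
    simp only [cf_mk, RingHom.id_apply]
    rw [finsum_nat_eq_sum_range M, cf_smul _ _ n Nf (n - N + 1) hNf]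
    · have h1 : ∀ i ∈ Finset.range M, Φ i (cf (n - i) (f • A))
          = ∑ p ∈ Finset.Ico Nf (n - N + 1), f.coeff p • Φ i (cf (n - i - p) A) := by
        intro i _
        rw [cf_smul f A (n - i) Nf (n - N + 1) hNf (fun q hq => hN _ (by omega)), map_sum]
        simp
      rw [Finset.sum_congr rfl h1, Finset.sum_comm]
      refine Finset.sum_congr rfl fun p hp => ?_
      rw [Finset.mem_Ico] at hp
      rw [cf_mk, finsum_nat_eq_sum_range M, Finset.smul_sum]
      · refine Finset.sum_congr rfl fun i _ => ?_
        rw [show n - (i : ℤ) - p = n - p - i by ring]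
      · intro i hi; rw [hN _ (by omega), map_zero]
    · intro q hq
      rw [cf_mk, finsum_nat_eq_sum_range 0]
      · simp
      · intro i _; rw [hN _ (by omega), map_zero]
    · intro i hi
      rw [cf_smul_lt f A hNf hN (by omega), map_zero]

lemma cf_Op_finsum (Φ : ℕ → P →ₗ[R] Q) (A : LS R P) (n : ℤ) :
    cf n (Op Φ A) = ∑ᶠ i : ℕ, Φ i (cf (n - i) A) := rfl

lemma cf_Op (Φ : ℕ → P →ₗ[R] Q) (A : LS R P) (n N : ℤ) (M : ℕ) (hN : ∀ m < N, cf m A = 0)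
    (hM : n - N < M) : cf n (Op Φ A) = ∑ i ∈ Finset.range M, Φ i (cf (n - i) A) := by
  rw [cf_Op_finsum, finsum_nat_eq_sum_range M]
  intro i hi
  rw [hN _ (by omega), map_zero]

lemma cf_Op_lt (Φ : ℕ → P →ₗ[R] Q) (A : LS R P) {n N : ℤ} (hN : ∀ m < N, cf m A = 0)
    (hn : n < N) : cf n (Op Φ A) = 0 := by
  rw [cf_Op Φ A n N 0 hN (by simpa using by omega)]
  simp

/-- The convolution product of two sequences of operators. -/
def conv (Ψ : ℕ → Q →ₗ[R] M) (Φ : ℕ → P →ₗ[R] Q) (n : ℕ) : P →ₗ[R] M :=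
  ∑ p ∈ Finset.HasAntidiagonal.antidiagonal n, Ψ p.1 ∘ₗ Φ p.2

lemma Op_Op (Ψ : ℕ → Q →ₗ[R] M) (Φ : ℕ → P →ₗ[R] Q) (A : LS R P) :
    Op Ψ (Op Φ A) = Op (conv Ψ Φ) A := by
  apply ext; intro n
  obtain ⟨N, hN⟩ := exists_bound A
  have hM : n - N < ((n - N).natAbs + 1 : ℕ) := by omega
  set K : ℕ := (n - N).natAbs + 1
  rw [cf_Op Ψ _ n N K (fun m hm => cf_Op_lt Φ A hN hm) hM, cf_Op _ A n N K hN hM]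
  have h1 : ∀ i ∈ Finset.range K, Ψ i (cf (n - i) (Op Φ A))
      = ∑ j ∈ Finset.range (K - i), Ψ i (Φ j (cf (n - (i + j : ℕ)) A)) := by
    intro i hi
    rw [cf_Op Φ A (n - i) N (K - i) hN (by rw [Finset.mem_range] at hi; omega), map_sum]
    refine Finset.sum_congr rfl fun j _ => ?_
    rw [show n - (i : ℤ) - j = n - (i + j : ℕ) by push_cast; ring]
  rw [Finset.sum_congr rfl h1]
  have := Finset.sum_sigma' (Finset.range K) (fun i => Finset.range (K - i))
    (fun i j => Ψ i (Φ j (cf (n - (i + j : ℕ)) A)))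
  rw [this]
  simp only [conv, LinearMap.sum_apply, LinearMap.comp_apply]
  rw [Finset.sum_sigma']
  refine Finset.sum_bij' (fun x _ => ⟨x.1 + x.2, (x.1, x.2)⟩) (fun x _ => ⟨x.2.1, x.2.2⟩)
    ?_ ?_ ?_ ?_ ?_
  · rintro ⟨i, j⟩ h; simp at h ⊢; omega
  · rintro ⟨k, i, j⟩ h; simp at h ⊢; omega
  · rintro ⟨i, j⟩ h; simp
  · rintro ⟨k, i, j⟩ h; simp at h; obtain ⟨h1, h2⟩ := h; subst h2; simp
  · rintro ⟨i, j⟩ h; simp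

/-- Apply a linear map to all coefficients. -/
def map (φ : P →ₗ[R] Q) : LS R P →ₗ[LaurentSeries R] LS R Q :=
  Op (fun i => if i = 0 then φ else 0)

@[simp] lemma cf_map (φ : P →ₗ[R] Q) (A : LS R P) (n : ℤ) : cf n (map φ A) = φ (cf n A) := by
  rw [map, cf_Op_finsum, finsum_eq_single _ 0]
  · simp
  · intro i hi; simp [hi]

lemma map_id (A : LS R P) : map LinearMap.id A = A := ext fun n => by simp

lemma map_add_left (φ ψ : P →ₗ[R] Q) (A : LS R P) : map (φ + ψ) A = map φ A + map ψ A :=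
  ext fun n => by simp

lemma map_smul_left (c : R) (φ : P →ₗ[R] Q) (A : LS R P) : map (c • φ) A = c • map φ A :=
  ext fun n => by simp

/-- Multiplication by `x`. -/
def X : LS R P →ₗ[LaurentSeries R] LS R P :=
  LinearMap.lsmul (LaurentSeries R) (LS R P) (HahnSeries.single 1 1)

lemma X_apply (A : LS R P) : X A = (HahnSeries.single 1 1 : LaurentSeries R) • A := rfl

@[simp] lemma cf_X (A : LS R P) (n : ℤ) : cf n (X A) = cf (n - 1) A := by
  rw [X_apply, cf_single_smul, one_smul]

lemma cf_X_pow (k : ℕ) (A : LS R P) (n : ℤ) : cf n ((X ^ k) A) = cf (n - k) A := by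
  induction k generalizing n with
  | zero => simp
  | succ k ih =>
    rw [pow_succ', Module.End.mul_apply, cf_X, ih]; push_cast; ring_nf

lemma X_pow_injective (k : ℕ) : Function.Injective ((X : Module.End _ (LS R P)) ^ k) := by
  intro A B h
  apply ext; intro n
  have := congrArg (cf (n + k)) h
  rwa [cf_X_pow, cf_X_pow, add_sub_cancel_right] at this

lemma X_comm_Op (Φ : ℕ → P →ₗ[R] Q) (A : LS R P) : Op Φ (X A) = X (Op Φ A) := by
  rw [X_apply, map_smul, X_apply]

end Ring

section Field

variable {R P Q M : Type*} [Field R] [CharZero R] [AddCommGroup P] [Module R P]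
  [AddCommGroup Q] [Module R Q] [AddCommGroup M] [Module R M]

/-- The sequence of coefficients of `e^{xD}`. -/
def expSeq (D : P →ₗ[R] P) (i : ℕ) : P →ₗ[R] P := ((i.factorial : R)⁻¹) • D ^ i

/-- The operator `e^{xD}`. -/
def E (D : P →ₗ[R] P) : LS R P →ₗ[LaurentSeries R] LS R P := Op (expSeq D)

lemma expSeq_zero (D : P →ₗ[R] P) : expSeq D 0 = LinearMap.id := by
  simp [expSeq]; rfl

lemma expSeq_succ (D : P →ₗ[R] P) (i : ℕ) :
    ((i : R) + 1) • expSeq D (i + 1) = D ∘ₗ expSeq D i := by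
  have h : ((i : R) + 1) ≠ 0 := by exact_mod_cast Nat.succ_ne_zero i
  rw [expSeq, expSeq, LinearMap.comp_smul, smul_smul, Nat.factorial_succ, Nat.cast_mul,
    pow_succ']
  congr 1
  push_cast
  rw [mul_inv, ← mul_assoc, mul_inv_cancel₀ h, one_mul]

lemma expSeq_succ' (D : P →ₗ[R] P) (i : ℕ) :
    ((i : R) + 1) • expSeq D (i + 1) = expSeq D i ∘ₗ D := by
  rw [expSeq_succ, expSeq, LinearMap.comp_smul, LinearMap.smul_comp]
  congr 1
  exact ((Commute.refl D).pow_right i).eq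

lemma seq_unique {D : Q →ₗ[R] Q} {L L' : ℕ → P →ₗ[R] Q} (h0 : L 0 = L' 0)
    (h : ∀ i : ℕ, ((i : R) + 1) • L (i + 1) = D ∘ₗ L i)
    (h' : ∀ i : ℕ, ((i : R) + 1) • L' (i + 1) = D ∘ₗ L' i) : L = L' := by
  funext i
  induction i with
  | zero => exact h0
  | succ i ih =>
    have hi : ((i : R) + 1) ≠ 0 := by exact_mod_cast Nat.succ_ne_zero i
    have := (h i).trans ((congrArg _ ih).trans (h' i).symm)
    exact smul_right_injective _ hi this

lemma conv_expSeq {D : P →ₗ[R] P} {D' : Q →ₗ[R] Q} {φ : ℕ → P →ₗ[R] Q}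
    (h : ∀ i : ℕ, D' ∘ₗ φ i - φ i ∘ₗ D = ((i : R) + 1) • φ (i + 1)) :
    (fun n => expSeq D' n ∘ₗ φ 0) = conv φ (expSeq D) := by
  refine seq_unique (D := D') ?_ ?_ ?_
  · simp [conv, expSeq_zero]
  · intro i
    rw [← LinearMap.smul_comp, expSeq_succ, LinearMap.comp_assoc]
  · intro i
    have e : ((i : R) + 1) • conv φ (expSeq D) (i + 1)
        = ∑ p ∈ Finset.HasAntidiagonal.antidiagonal (i + 1), (((p.1 : R) • φ p.1 ∘ₗ expSeq D p.2)
          + ((p.2 : R) • φ p.1 ∘ₗ expSeq D p.2)) := by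
      rw [conv, Finset.smul_sum]
      refine Finset.sum_congr rfl fun p hp => ?_
      rw [← add_smul]
      congr 1
      rw [Finset.HasAntidiagonal.mem_antidiagonal] at hp
      exact_mod_cast hp.symm
    rw [e, Finset.sum_add_distrib, Finset.Nat.sum_antidiagonal_succ,
      Finset.Nat.sum_antidiagonal_succ']
    simp only [Nat.cast_zero, zero_smul, zero_add, Nat.cast_add, Nat.cast_one]
    rw [← Finset.sum_add_distrib, conv]
    ext x
    simp only [LinearMap.sum_apply, LinearMap.comp_apply, map_sum, LinearMap.add_apply,
      LinearMap.smul_apply]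
    refine Finset.sum_congr rfl fun p _ => ?_
    have h1 := LinearMap.congr_fun (h p.1) (expSeq D p.2 x)
    have h2 := LinearMap.congr_fun (expSeq_succ D p.2) x
    simp only [LinearMap.sub_apply, LinearMap.comp_apply, LinearMap.smul_apply] at h1 h2
    rw [← map_smul (φ p.1), h2, ← h1]
    abel

/-- Conjugation of a power series of operators by exponentials. -/
lemma E_map {D : P →ₗ[R] P} {D' : Q →ₗ[R] Q} (φ : ℕ → P →ₗ[R] Q)
    (h : ∀ i : ℕ, D' ∘ₗ φ i - φ i ∘ₗ D = ((i : R) + 1) • φ (i + 1)) (A : LS R P) :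
    E D' (map (φ 0) A) = Op φ (E D A) := by
  rw [E, E, Op_Op, ← conv_expSeq h, map, Op_Op]
  congr 2
  funext n
  rw [conv, Finset.Nat.sum_antidiagonal_eq_sum_range_succ_mk, Finset.sum_eq_single n]
  · simp
  · intro b hb hbn
    have : n - b ≠ 0 := by simp at hb; omega
    simp [this]
  · simp

lemma E_map_of_comm {D : P →ₗ[R] P} {D' : Q →ₗ[R] Q} (φ : P →ₗ[R] Q)
    (h : D' ∘ₗ φ = φ ∘ₗ D) (A : LS R P) : E D' (map φ A) = map φ (E D A) := by
  have := E_map (D := D) (D' := D') (fun i => if i = 0 then φ else 0) (fun i => by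
    by_cases hi : i = 0
    · simp [hi, h]
    · simp [hi]) A
  simp only [if_true] at this
  exact this

lemma Op_one (A : LS R P) : Op (fun i => if i = 0 then (LinearMap.id : P →ₗ[R] P) else 0) A = A :=
  map_id A

lemma E_add {D D' : P →ₗ[R] P} (h : D ∘ₗ D' = D' ∘ₗ D) (A : LS R P) :
    E (D + D') A = E D' (E D A) := by
  have := E_map (D := D) (D' := D + D') (expSeq D') (fun i => by
    rw [expSeq_succ, LinearMap.add_comp]
    have : D ∘ₗ expSeq D' i = expSeq D' i ∘ₗ D := by
      rw [expSeq, LinearMap.comp_smul, LinearMap.smul_comp]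
      congr 1
      exact (Commute.pow_right (show Commute D D' from h) i).eq
    rw [this]; abel) A
  rwa [expSeq_zero, map_id] at this

lemma E_zero (A : LS R P) : E (0 : P →ₗ[R] P) A = A := by
  rw [E]
  have : expSeq (0 : P →ₗ[R] P) = fun i => if i = 0 then (LinearMap.id : P →ₗ[R] P) else 0 := by
    funext i
    by_cases hi : i = 0
    · subst hi; simp [expSeq_zero]
    · simp [expSeq, hi]
  rw [this, Op_one]

lemma E_neg_E (D : P →ₗ[R] P) (A : LS R P) : E (-D) (E D A) = A := by
  rw [← E_add (by simp), add_neg_cancel, E_zero]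

lemma E_E_neg (D : P →ₗ[R] P) (A : LS R P) : E D (E (-D) A) = A := by
  rw [← E_add (by simp), neg_add_cancel, E_zero]

/-- If `[D', φ] = ψ` commutes with `D`, then `e^{xD'} φ = (φ + x ψ) e^{xD}`. -/
lemma E_map_of_comm_one {D : P →ₗ[R] P} {D' : Q →ₗ[R] Q} (φ ψ : P →ₗ[R] Q)
    (h : D' ∘ₗ φ - φ ∘ₗ D = ψ) (h' : D' ∘ₗ ψ = ψ ∘ₗ D) (A : LS R P) :
    E D' (map φ A) = map φ (E D A) + X (map ψ (E D A)) := by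
  have := E_map (D := D) (D' := D') (fun i => if i = 0 then φ else if i = 1 then ψ else 0)
    (fun i => by
      rcases i with _ | _ | i
      · simp [h]
      · simp [h']
      · simp) A
  simp only [if_true] at this
  rw [this]
  apply ext; intro n
  obtain ⟨N, hN⟩ := exists_bound (E D A)
  have hK : n - N < ((n - N).natAbs + 2 : ℕ) := by omega
  rw [cf_Op _ _ n N _ hN hK, map_add, cf_map, cf_X, cf_map, Finset.sum_range_succ',
    Finset.sum_range_succ']
  rw [Finset.sum_eq_zero]
  · simp [add_comm]
  · intro i _; simp

/-- The substitution `x ↦ -x`. -/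
def nu : LS R P →ₗ[R] LS R P where
  toFun A := mk (fun n => ((-1 : R) ^ n) • cf n A) (by
    obtain ⟨N, hN⟩ := exists_bound A
    exact ⟨N, fun n hn => by rw [hN n hn, smul_zero]⟩)
  map_add' A B := ext fun n => by simp
  map_smul' c A := ext fun n => by
    simp only [cf_mk, map_smul, RingHom.id_apply]
    rw [smul_comm]

@[simp] lemma cf_nu (A : LS R P) (n : ℤ) : cf n (nu A) = ((-1 : R) ^ n) • cf n A := rfl

lemma neg_one_zpow_mul_self (n : ℤ) : ((-1 : R) ^ n) * (-1) ^ n = 1 := by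
  rw [← mul_zpow]; simp

lemma nu_nu (A : LS R P) : nu (nu A) = A := ext fun n => by
  simp [smul_smul, neg_one_zpow_mul_self]

lemma nu_map (φ : P →ₗ[R] Q) (A : LS R P) : nu (map φ A) = map φ (nu A) := ext fun n => by simp

lemma nu_E (D : P →ₗ[R] P) (A : LS R P) : nu (E D A) = E (-D) (nu A) := by
  apply ext; intro n
  obtain ⟨N, hN⟩ := exists_bound A
  have hK : n - N < ((n - N).natAbs + 1 : ℕ) := by omega
  rw [cf_nu, E, E, cf_Op _ _ n N _ hN hK,
    cf_Op _ _ n N _ (fun m hm => by rw [cf_nu, hN m hm, smul_zero]) hK, Finset.smul_sum]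
  refine Finset.sum_congr rfl fun i _ => ?_
  rw [cf_nu, expSeq, expSeq, neg_pow, map_smul, LinearMap.smul_apply, LinearMap.smul_apply,
    smul_smul, smul_smul, ]
  rw [show ((-1 : P →ₗ[R] P) ^ i * D ^ i) = ((-1 : R) ^ i) • D ^ i by
    rcases Nat.even_or_odd i with h | h <;> simp [h.neg_one_pow]]
  rw [LinearMap.smul_apply, smul_smul]
  congr 1
  rw [zpow_sub₀ (by simp), zpow_natCast, div_eq_mul_inv, ← inv_pow]
  have : (-1 : R)⁻¹ = -1 := by rw [inv_neg, inv_one]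
  rw [this]
  have h2 : ((-1 : R) ^ i) * (-1) ^ i = 1 := by rw [← mul_pow]; simp
  linear_combination (-((-1 : R) ^ n * ((i.factorial : R))⁻¹)) * h2

/-- The substitution `x ↦ -x` on scalars. -/
def nuK : LaurentSeries R →+* LaurentSeries R where
  toFun f := HahnSeries.ofSuppBddBelow (fun n => ((-1 : R) ^ n) * f.coeff n) (by
    obtain ⟨N, hN⟩ := exists_bound_coeff f
    exact ⟨N, fun n hn => by_contra fun h' => hn (by
      change (-1 : R) ^ n * f.coeff n = 0
      rw [hN n (not_le.mp h'), mul_zero])⟩)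
  map_one' := by
    ext n
    by_cases hn : n = 0 <;> simp [hn, HahnSeries.coeff_one]
  map_mul' f g := by
    ext n
    change (-1) ^ n * (f * g).coeff n = HahnSeries.coeff (_ * _) n
    rw [coeff_mul_finsum, coeff_mul_finsum]
    obtain ⟨N, hN⟩ := exists_bound_coeff f
    obtain ⟨N', hN'⟩ := exists_bound_coeff g
    rw [finsum_int_eq_sum_Ico N (n - N' + 1), finsum_int_eq_sum_Ico N (n - N' + 1), Finset.mul_sum]
    · refine Finset.sum_congr rfl fun p _ => ?_
      simp only [HahnSeries.coeff_ofSuppBddBelow]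
      rw [zpow_sub₀ (by simp)]
      have := neg_one_zpow_mul_self (R := R) p
      have h0 : ((-1 : R) ^ p) ≠ 0 := zpow_ne_zero _ (by simp)
      field_simp
    · intro i hi; simp [hN i hi]
    · intro i hi; simp [hN' (n - i) (by omega)]
    · intro i hi; simp [hN i hi]
    · intro i hi; simp [hN' (n - i) (by omega)]
  map_zero' := by ext n; simp
  map_add' f g := by ext n; simp [mul_add]

end Field
end LS

end

noncomputable section

lemma zchoose_eq (n : ℤ) (k : ℕ) : zchoose n k = Ring.choose n k := by
  unfold zchoose
  split_ifs with h
  · obtain ⟨m, rfl⟩ := Int.eq_ofNat_of_zero_le h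
    rw [Int.toNat_natCast, Ring.choose_natCast]
  · obtain ⟨m, rfl⟩ : ∃ m : ℕ, n = -(m : ℤ) := ⟨n.natAbs, by omega⟩
    rw [Ring.choose_neg]
    rw [show (k : ℤ) - -(m : ℤ) - 1 = ((m + k - 1 : ℕ) : ℤ) by omega,
      show (m : ℤ) + k - 1 = ((m + k - 1 : ℕ) : ℤ) by omega, Int.toNat_natCast,
      Ring.choose_natCast]
    simp [Int.negOnePow, Units.smul_def]

lemma zchoose_zero (n : ℤ) : zchoose n 0 = 1 := by
  rw [zchoose_eq, Ring.choose_zero_right]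

lemma zchoose_succ (n : ℤ) (k : ℕ) :
    ((k : ℤ) + 1) * zchoose n (k + 1) = (n - k) * zchoose n k := by
  have h1 := Ring.descPochhammer_eq_factorial_smul_choose n (k + 1)
  have h2 := Ring.descPochhammer_eq_factorial_smul_choose n k
  rw [descPochhammer_succ_right, Polynomial.smeval_mul, h2, Nat.factorial_succ,
    ← zchoose_eq, ← zchoose_eq] at h1
  have h3 : (k.factorial : ℤ) ≠ 0 := by exact_mod_cast k.factorial_ne_zero
  apply mul_left_cancel₀ h3
  simp [Polynomial.smeval_sub, Polynomial.smeval_X, Polynomial.smeval_natCast] at h1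
  linear_combination -h1

namespace LS

section Two

variable {R P Q M : Type*} [Field R] [CharZero R] [AddCommGroup P] [Module R P]
  [AddCommGroup Q] [Module R Q] [AddCommGroup M] [Module R M]

/-- The formal derivative. -/
def der : LS R P →ₗ[R] LS R P where
  toFun A := mk (fun n => ((n : R) + 1) • cf (n + 1) A) (by
    obtain ⟨N, hN⟩ := exists_bound A
    exact ⟨N - 1, fun n hn => by rw [hN (n + 1) (by omega), smul_zero]⟩)
  map_add' A B := ext fun n => by simp
  map_smul' c A := ext fun n => by
    simp only [cf_mk, map_smul, RingHom.id_apply]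
    rw [smul_comm]

@[simp] lemma cf_der (A : LS R P) (n : ℤ) : cf n (der A) = ((n : R) + 1) • cf (n + 1) A := rfl

lemma cf_expSeq_der (i : ℕ) (A : LS R P) (n : ℤ) :
    cf n (expSeq der i A) = ((zchoose (n + i) i : ℤ) : R) • cf (n + i) A := by
  induction i generalizing n with
  | zero => simp [expSeq_zero, zchoose_zero]
  | succ i ih =>
    have h := congrArg (cf n) (LinearMap.congr_fun (expSeq_succ (der : LS R P →ₗ[R] LS R P) i) A)
    have hi : ((i : R) + 1) ≠ 0 := by exact_mod_cast Nat.succ_ne_zero i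
    apply smul_right_injective _ hi
    simp only [LinearMap.smul_apply, map_smul, LinearMap.comp_apply, cf_der] at h ⊢
    rw [h, ih, smul_smul, smul_smul]
    have h2 := zchoose_succ (n + (i + 1 : ℕ)) i
    have h3 : ((i : R) + 1) * (zchoose (n + (i + 1 : ℕ)) (i + 1) : ℤ)
      = ((n : R) + 1) * (zchoose (n + (i + 1 : ℕ)) i : ℤ) := by
      have := congrArg (Int.cast : ℤ → R) h2
      push_cast at this ⊢
      rw [this]; ring
    rw [h3, show n + 1 + (i : ℤ) = n + (i + 1 : ℕ) by push_cast; ring]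

/-- Multiplication by a scalar Laurent series. -/
def ml (f : LaurentSeries R) : LS R P →ₗ[R] LS R P :=
  (LinearMap.lsmul (LaurentSeries R) (LS R P) f).restrictScalars R

@[simp] lemma ml_apply (f : LaurentSeries R) (A : LS R P) : ml f A = f • A := rfl

/-- The derivative of a scalar Laurent series. -/
def dK (i : ℕ) (f : LaurentSeries R) : LaurentSeries R :=
  (HahnModule.of R).symm (expSeq der i (HahnModule.of R f : LS R R))

lemma coeff_dK (i : ℕ) (f : LaurentSeries R) (n : ℤ) :
    (dK i f).coeff n = ((zchoose (n + i) i : ℤ) : R) * f.coeff (n + i) :=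
  cf_expSeq_der i (HahnModule.of R f : LS R R) n

lemma dK_zero (f : LaurentSeries R) : dK 0 f = f := by
  rw [dK, expSeq_zero]; rfl

lemma coeff_dK_one (f : LaurentSeries R) (n : ℤ) :
    (dK 1 f).coeff n = ((n : R) + 1) * f.coeff (n + 1) := by
  rw [coeff_dK]
  congr 2
  have := zchoose_succ (n + (1 : ℕ)) 0
  rw [zchoose_zero] at this
  simp at this
  simp [this]

lemma dK_dK_one (i : ℕ) (f : LaurentSeries R) :
    dK 1 (dK i f) = ((i : R) + 1) • dK (i + 1) f := by
  ext n
  rw [coeff_dK_one]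
  exact (congrArg (cf n) (LinearMap.congr_fun
    (expSeq_succ (der : LS R R →ₗ[R] LS R R) i) (HahnModule.of R f))).symm

lemma der_smul (f : LaurentSeries R) (A : LS R P) :
    der (f • A) = dK 1 f • A + f • der A := by
  apply ext; intro n
  obtain ⟨N, hN⟩ := exists_bound_coeff f
  obtain ⟨N', hN'⟩ := exists_bound A
  rw [cf_der, map_add, cf_smul f A (n + 1) N (n + 2 - N') hN (fun q hq => hN' q (by omega)),
    cf_smul f (der A) n N (n + 2 - N') hN
      (fun q hq => by rw [cf_der, hN' (q + 1) (by omega), smul_zero]),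
    cf_smul (dK 1 f) A n (N - 1) (n + 1 - N')
      (fun q hq => by rw [coeff_dK_one, hN (q + 1) (by omega), mul_zero])
      (fun q hq => hN' q (by omega))]
  have e : ∑ p ∈ Finset.Ico (N - 1) (n + 1 - N'), (dK 1 f).coeff p • cf (n - p) A
      = ∑ p ∈ Finset.Ico N (n + 2 - N'), ((p : R) * f.coeff p) • cf (n + 1 - p) A := by
    refine Finset.sum_bij' (fun p _ => p + 1) (fun p _ => p - 1) ?_ ?_ ?_ ?_ ?_
    · intro p hp; simp at hp ⊢; omega
    · intro p hp; simp at hp ⊢; omega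
    · intro p hp; ring
    · intro p hp; ring
    · intro p hp; rw [coeff_dK_one]; push_cast
      rw [show n + 1 - (p + 1) = n - p by ring]
  rw [e, ← Finset.sum_add_distrib, Finset.smul_sum]
  refine Finset.sum_congr rfl fun p _ => ?_
  rw [cf_der, smul_smul, smul_smul, show n - p + 1 = n + 1 - p by ring, ← add_smul]
  congr 1
  push_cast; ring

/-- `e^{x∂}` intertwines multiplication by `f(y)` and by `f(y+x)`. -/
lemma E_der_map_ml (f : LaurentSeries R) (A : LS R (LS R P)) :
    E der (map (ml f) A) = Op (fun i => ml (dK i f)) (E der A) := by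
  have := E_map (D := (der : LS R P →ₗ[R] LS R P)) (D' := der) (fun i => ml (dK i f))
    (fun i => by
      refine LinearMap.ext fun B => ?_
      simp only [LinearMap.sub_apply, LinearMap.comp_apply, ml_apply, LinearMap.smul_apply]
      rw [der_smul, dK_dK_one]
      simp) A
  rwa [dK_zero] at this

lemma E_neg_der_map_ml (f : LaurentSeries R) (A : LS R (LS R P)) :
    E (-der) (map (ml f) A) = Op (fun i => ((-1 : R) ^ i) • ml (dK i f)) (E (-der) A) := by
  have := E_map (D := -(der : LS R P →ₗ[R] LS R P)) (D' := -der)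
    (fun i => ((-1 : R) ^ i) • ml (dK i f))
    (fun i => by
      refine LinearMap.ext fun B => ?_
      simp only [LinearMap.sub_apply, LinearMap.comp_apply, ml_apply, LinearMap.smul_apply,
        LinearMap.neg_apply, map_smul, smul_neg]
      rw [der_smul, dK_dK_one, smul_add, smul_assoc, smul_comm ((i : R) + 1), pow_succ,
        mul_neg_one, neg_smul]
      rw [neg_add, add_sub_right_comm, sub_neg_eq_add]
      simp
      rw [← ml_apply, map_smul, smul_comm ((-1 : R) ^ i), ml_apply]) A
  simpa [dK_zero] using this

/-- Multiplication by the outer variable of a double series. -/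
def Xo : Module.End R (LS R (LS R P)) := X.restrictScalars R

/-- Multiplication by the inner variable of a double series. -/
def Xi : Module.End R (LS R (LS R P)) := (map (X.restrictScalars R)).restrictScalars R

@[simp] lemma cf_Xo (A : LS R (LS R P)) (m : ℤ) : cf m (Xo A) = cf (m - 1) A := cf_X A m

@[simp] lemma cf_Xi (A : LS R (LS R P)) (m : ℤ) : cf m (Xi A) = X (cf m A) := cf_map _ A m

/-- Taylor shift of the inner variable by the outer one. -/
def Tp : Module.End R (LS R (LS R P)) := (E der).restrictScalars R

/-- Taylor shift of the inner variable by minus the outer one. -/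
def Tm : Module.End R (LS R (LS R P)) := (E (-der)).restrictScalars R

lemma Tp_apply (A : LS R (LS R P)) : Tp A = E der A := rfl
lemma Tm_apply (A : LS R (LS R P)) : Tm A = E (-der) A := rfl

lemma Tp_Tm (A : LS R (LS R P)) : Tp (Tm A) = A := E_E_neg _ _
lemma Tm_Tp (A : LS R (LS R P)) : Tm (Tp A) = A := E_neg_E _ _

lemma Xo_comm_Xi : Commute (Xo : Module.End R (LS R (LS R P))) Xi :=
  LinearMap.ext fun A => ext fun m => by simp

lemma der_X (A : LS R P) : der (X A) = A + X (der A) := by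
  apply ext; intro n
  rw [cf_der, map_add, cf_X, cf_X, cf_der]
  rw [show n + 1 - 1 = n by ring, show n - 1 + 1 = n by ring]
  push_cast
  module

lemma Tp_Xo (A : LS R (LS R P)) : Tp (Xo A) = Xo (Tp A) := X_comm_Op _ A
lemma Tm_Xo (A : LS R (LS R P)) : Tm (Xo A) = Xo (Tm A) := X_comm_Op _ A

lemma Tp_Xi (A : LS R (LS R P)) : Tp (Xi A) = (Xi + Xo : Module.End R (LS R (LS R P))) (Tp A) := by
  have := E_map_of_comm_one (D := (der : LS R P →ₗ[R] LS R P)) (D' := der)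
    (X.restrictScalars R) LinearMap.id
    (LinearMap.ext fun B => by simp [der_X]) (LinearMap.ext fun B => by simp) A
  rw [map_id] at this
  exact this

lemma Tm_Xi (A : LS R (LS R P)) : Tm (Xi A) = (Xi - Xo : Module.End R (LS R (LS R P))) (Tm A) := by
  have := E_map_of_comm_one (D := -(der : LS R P →ₗ[R] LS R P)) (D' := -der)
    (X.restrictScalars R) (-LinearMap.id)
    (LinearMap.ext fun B => by simp [der_X]) (LinearMap.ext fun B => by simp) A
  rw [show map (-LinearMap.id) (E (-der) A) = -(E (-der) A) from ext fun n => by simp] at this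
  rw [sub_eq_add_neg]
  rw [map_neg] at this
  exact this

lemma semiconj_Tp_Xi : SemiconjBy (Tp : Module.End R (LS R (LS R P))) Xi (Xi + Xo) :=
  LinearMap.ext Tp_Xi
lemma semiconj_Tp_Xo : SemiconjBy (Tp : Module.End R (LS R (LS R P))) Xo Xo :=
  LinearMap.ext Tp_Xo
lemma semiconj_Tm_Xi : SemiconjBy (Tm : Module.End R (LS R (LS R P))) Xi (Xi - Xo) :=
  LinearMap.ext Tm_Xi
lemma semiconj_Tm_Xo : SemiconjBy (Tm : Module.End R (LS R (LS R P))) Xo Xo :=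
  LinearMap.ext Tm_Xo

lemma injective_Xi_add (c : R) :
    Function.Injective ((Xi + c • Xo : Module.End R (LS R (LS R P)))) := by
  rw [injective_iff_map_eq_zero]
  intro A hA
  obtain ⟨N, hN⟩ := exists_bound A
  have key : ∀ n : ℕ, cf (N - 1 + n) A = 0 := by
    intro n
    induction n with
    | zero => exact hN _ (by simp)
    | succ n ih =>
      have := congrArg (cf (N - 1 + (n + 1 : ℕ))) hA
      simp only [LinearMap.add_apply, LinearMap.smul_apply, map_add, cf_Xi, map_smul, cf_Xo,
        map_zero] at this
      rw [show N - 1 + ((n + 1 : ℕ) : ℤ) - 1 = N - 1 + n by push_cast; ring, ih] at this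
      replace this := this.symm.trans (congrArg _ (smul_zero c))
      have h2 := X_pow_injective (R := R) (P := P) 1
      rw [pow_one] at h2
      exact h2 (by rw [map_zero]; simpa using this.symm)
  apply ext; intro n
  rw [map_zero]
  by_cases hn : n < N
  · exact hN n hn
  · have := key (n - (N - 1)).toNat
    rwa [Int.toNat_of_nonneg (by omega), add_sub_cancel] at this

lemma injective_Xi_add_Xo_pow (k : ℕ) :
    Function.Injective ((Xi + Xo : Module.End R (LS R (LS R P))) ^ k) := by
  rw [Module.End.coe_pow]
  have := injective_Xi_add (P := P) (1 : R)
  rw [one_smul] at this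
  exact this.iterate k

lemma injective_Xi_sub_Xo_pow (k : ℕ) :
    Function.Injective ((Xi - Xo : Module.End R (LS R (LS R P))) ^ k) := by
  rw [Module.End.coe_pow]
  have := injective_Xi_add (P := P) (-1 : R)
  rw [show (Xi + (-1 : R) • Xo : Module.End R (LS R (LS R P))) = Xi - Xo by
    rw [sub_eq_add_neg]; congr 1; exact neg_one_smul R (Xo : Module.End R (LS R (LS R P)))] at this
  exact this.iterate k

/-- Two double series agree up to exchanging the roles of the variables. -/
def Sw (A B : LS R (LS R P)) : Prop := ∀ m n : ℤ, cf n (cf m A) = cf m (cf n B)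

lemma Sw.symm {A B : LS R (LS R P)} (h : Sw A B) : Sw B A := fun m n => (h n m).symm

lemma Sw.add {A B A' B' : LS R (LS R P)} (h : Sw A B) (h' : Sw A' B') : Sw (A + A') (B + B') :=
  fun m n => by simp only [map_add]; rw [h, h']

lemma Sw.sum {ι : Type*} (s : Finset ι) {A B : ι → LS R (LS R P)} (h : ∀ i ∈ s, Sw (A i) (B i)) :
    Sw (∑ i ∈ s, A i) (∑ i ∈ s, B i) :=
  fun m n => by simp only [map_sum]; exact Finset.sum_congr rfl fun i hi => h i hi m n

lemma Sw.smul (c : R) {A B : LS R (LS R P)} (h : Sw A B) : Sw (c • A) (c • B) :=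
  fun m n => by simp only [map_smul]; rw [h]

lemma Sw.sub {A B A' B' : LS R (LS R P)} (h : Sw A B) (h' : Sw A' B') : Sw (A - A') (B - B') :=
  fun m n => by simp only [map_sub]; rw [h, h']

lemma Sw.Xo_Xi {A B : LS R (LS R P)} (h : Sw A B) : Sw (Xo A) (Xi B) :=
  fun m n => by simp; exact h _ _

lemma Sw.Xi_Xo {A B : LS R (LS R P)} (h : Sw A B) : Sw (Xi A) (Xo B) :=
  h.symm.Xo_Xi.symm

/-- Pairs of operators compatible with `Sw`. -/
def SwOp (Φ Ψ : Module.End R (LS R (LS R P))) : Prop := ∀ A B, Sw A B → Sw (Φ A) (Ψ B)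

lemma SwOp.pow {Φ Ψ : Module.End R (LS R (LS R P))} (h : SwOp Φ Ψ) (k : ℕ) :
    SwOp (Φ ^ k) (Ψ ^ k) := by
  induction k with
  | zero => intro A B h; exact h
  | succ k ih => intro A B hAB; rw [pow_succ', pow_succ']; exact h _ _ (ih _ _ hAB)

lemma SwOp.add {Φ Ψ Φ' Ψ' : Module.End R (LS R (LS R P))} (h : SwOp Φ Ψ) (h' : SwOp Φ' Ψ') :
    SwOp (Φ + Φ') (Ψ + Ψ') := fun A B hAB => (h _ _ hAB).add (h' _ _ hAB)

lemma SwOp.sub {Φ Ψ Φ' Ψ' : Module.End R (LS R (LS R P))} (h : SwOp Φ Ψ) (h' : SwOp Φ' Ψ') :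
    SwOp (Φ - Φ') (Ψ - Ψ') := fun A B hAB => (h _ _ hAB).sub (h' _ _ hAB)

lemma swOp_Xo : SwOp (Xo : Module.End R (LS R (LS R P))) Xi := fun _ _ h => h.Xo_Xi
lemma swOp_Xi : SwOp (Xi : Module.End R (LS R (LS R P))) Xo := fun _ _ h => h.Xi_Xo

lemma Sw.eq {A B B' : LS R (LS R P)} (h : Sw A B) (h' : Sw A B') : B = B' :=
  ext fun n => ext fun m => by rw [← h m n, ← h' m n]

end Two
end LS

end

noncomputable section

namespace LS

section More

variable {R P Q M : Type*} [Field R] [CharZero R] [AddCommGroup P] [Module R P]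
  [AddCommGroup Q] [Module R Q] [AddCommGroup M] [Module R M]

/-- Constant series. -/
def cst : P →ₗ[R] LS R P where
  toFun v := mk (fun n => if n = 0 then v else 0)
    ⟨0, fun n hn => by simp [hn.ne]⟩
  map_add' u v := ext fun n => by by_cases hn : n = 0 <;> simp [hn]
  map_smul' c v := ext fun n => by by_cases hn : n = 0 <;> simp [hn]

@[simp] lemma cf_cst (v : P) (n : ℤ) : cf n (cst v : LS R P) = if n = 0 then v else 0 := rfl

lemma Op_cst (Φ : ℕ → P →ₗ[R] Q) (v : P) (n : ℕ) : cf n (Op Φ (cst v)) = Φ n v := by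
  rw [cf_Op_finsum, finsum_eq_single _ n]
  · simp
  · intro i hi
    rw [cf_cst, if_neg (by omega), map_zero]

lemma Op_cst_neg (Φ : ℕ → P →ₗ[R] Q) (v : P) (n : ℤ) (hn : n < 0) :
    cf n (Op Φ (cst v)) = 0 :=
  cf_Op_lt Φ _ (N := 0) (fun m hm => by simp [hm.ne]) hn

lemma map_cst (φ : P →ₗ[R] Q) (v : P) : map φ (cst v : LS R P) = cst (φ v) :=
  ext fun n => by by_cases hn : n = 0 <;> simp [hn]

lemma cf_Xo_pow (k : ℕ) (A : LS R (LS R P)) (m : ℤ) : cf m ((Xo ^ k) A) = cf (m - k) A := by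
  induction k generalizing m with
  | zero => simp
  | succ k ih =>
    rw [pow_succ', Module.End.mul_apply, cf_Xo, ih]; push_cast; ring_nf

lemma cf_Xi_pow (k : ℕ) (A : LS R (LS R P)) (m n : ℤ) :
    cf n (cf m ((Xi ^ k) A)) = cf (n - k) (cf m A) := by
  induction k generalizing n with
  | zero => simp
  | succ k ih =>
    rw [pow_succ', Module.End.mul_apply, cf_Xi, cf_X, ih]; push_cast; ring_nf

lemma cf_add_pow (c : R) (k : ℕ) (A : LS R (LS R P)) (m n : ℤ) :
    cf n (cf m (((c • Xo + Xi) ^ k : Module.End R (LS R (LS R P))) A))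
      = ∑ j ∈ Finset.range (k + 1), (c ^ j * ((k.choose j : ℕ) : R)) •
          cf (n - k + j) (cf (m - j) A) := by
  rw [Commute.add_pow (Xo_comm_Xi.smul_left c), LinearMap.sum_apply, map_sum, map_sum]
  refine Finset.sum_congr rfl fun j hj => ?_
  have hj' : j ≤ k := by simp at hj; omega
  rw [(Nat.cast_commute (k.choose j) _).eq.symm, ← nsmul_eq_mul, LinearMap.smul_apply, map_nsmul,
    map_nsmul, smul_pow, Module.End.mul_apply, LinearMap.smul_apply, map_smul, map_smul,
    cf_Xo_pow, cf_Xi_pow, mul_smul, smul_comm, Nat.cast_smul_eq_nsmul]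
  rw [show n - ((k - j : ℕ) : ℤ) = n - k + j by omega]

lemma cf_add_pow' (c : R) (k : ℕ) (A : LS R (LS R P)) (m n : ℤ) :
    cf n (cf m (((c • Xi + Xo) ^ k : Module.End R (LS R (LS R P))) A))
      = ∑ j ∈ Finset.range (k + 1), (c ^ j * ((k.choose j : ℕ) : R)) •
          cf (n - j) (cf (m - k + j) A) := by
  rw [Commute.add_pow (Xo_comm_Xi.symm.smul_left c), LinearMap.sum_apply, map_sum, map_sum]
  refine Finset.sum_congr rfl fun j hj => ?_
  have hj' : j ≤ k := by simp at hj; omega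
  rw [(Nat.cast_commute (k.choose j) _).eq.symm, ← nsmul_eq_mul, LinearMap.smul_apply, map_nsmul,
    map_nsmul, smul_pow, Module.End.mul_apply, LinearMap.smul_apply, map_smul, map_smul,
    cf_Xi_pow, cf_Xo_pow, mul_smul, smul_comm, Nat.cast_smul_eq_nsmul]
  rw [show m - ((k - j : ℕ) : ℤ) = m - k + j by omega]

lemma exists_swap (B : LS R (LS R P)) (h : ∃ M : ℤ, ∀ m, ∀ n < M, cf n (cf m B) = 0) :
    ∃ B' : LS R (LS R P), Sw B B' := by
  obtain ⟨M, hM⟩ := h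
  obtain ⟨N, hN⟩ := exists_bound B
  refine ⟨mk (fun n => mk (fun m => cf n (cf m B)) ⟨N, fun m hm => by rw [hN m hm, map_zero]⟩)
    ⟨M, fun n hn => ext fun m => by rw [cf_mk, map_zero]; exact hM m n hn⟩, fun m n => rfl⟩

lemma swOp_add : SwOp (Xi + Xo : Module.End R (LS R (LS R P))) (Xi + Xo) := by
  have := (swOp_Xi (R := R) (P := P)).add swOp_Xo
  rwa [add_comm (Xo : Module.End R (LS R (LS R P))) Xi] at this

lemma Sw.cancel_add {A C : LS R (LS R P)} {k : ℕ}
    (h : Sw (((Xi + Xo) ^ k : Module.End R (LS R (LS R P))) A)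
      (((Xi + Xo) ^ k : Module.End R (LS R (LS R P))) C))
    (hC : ∃ M : ℤ, ∀ m, ∀ n < M, cf n (cf m C) = 0) : Sw A C := by
  obtain ⟨C', hC'⟩ := exists_swap C hC
  have h2 := (swOp_add.pow k) _ _ hC'
  have := h.symm.eq h2
  rw [injective_Xi_add_Xo_pow k this]
  exact hC'.symm

lemma swOp_smul (f : LaurentSeries R) {A B : LS R (LS R P)} (h : Sw A B) :
    Sw (f • A) (map (ml f) B) := by
  intro m n
  obtain ⟨N, hN⟩ := exists_bound_coeff f
  obtain ⟨M, hM⟩ := exists_bound A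
  rw [cf_smul f A m N (m - M + 1) hN fun q hq => hM q (by omega), cf_map, ml_apply, map_sum,
    cf_smul f (cf n B) m N (m - M + 1) hN fun q hq => by rw [← h, hM q (by omega), map_zero]]
  exact Finset.sum_congr rfl fun p _ => by rw [map_smul, h]

end More
end LS

open LS

lemma mulAddPow_cf {P : Type*} [AddCommGroup P] [Module ℂ P] (k : ℕ) (A : LS ℂ (LS ℂ P))
    (a b : ℤ) : mulAddPow k (fun a b => cf a (cf b A)) a b
      = cf a (cf b (((Xi + Xo) ^ k : Module.End ℂ (LS ℂ (LS ℂ P))) A)) := by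
  have := cf_add_pow (1 : ℂ) k A b a
  rw [one_smul, add_comm] at this
  rw [this]; simp [mulAddPow]

lemma mulAddPow_cf' {P : Type*} [AddCommGroup P] [Module ℂ P] (k : ℕ) (A : LS ℂ (LS ℂ P))
    (a b : ℤ) : mulAddPow k (fun a b => cf b (cf a A)) a b
      = cf b (cf a (((Xi + Xo) ^ k : Module.End ℂ (LS ℂ (LS ℂ P))) A)) := by
  have := cf_add_pow' (1 : ℂ) k A a b
  rw [one_smul] at this
  rw [this]; simp [mulAddPow]

lemma mulSubPow_cf {P : Type*} [AddCommGroup P] [Module ℂ P] (k : ℕ) (A : LS ℂ (LS ℂ P))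
    (a b : ℤ) : mulSubPow k (fun a b => cf a (cf b A)) a b
      = cf a (cf b (((Xi - Xo) ^ k : Module.End ℂ (LS ℂ (LS ℂ P))) A)) := by
  have := cf_add_pow (-1 : ℂ) k A b a
  rw [show ((-1 : ℂ) • Xo + Xi : Module.End ℂ (LS ℂ (LS ℂ P))) = Xi - Xo by
    rw [add_comm, sub_eq_add_neg]; congr 1; exact neg_one_smul ℂ (_ : Module.End ℂ (LS ℂ (LS ℂ P)))] at this
  rw [this]; rfl

lemma mulSubPow_cf' {P : Type*} [AddCommGroup P] [Module ℂ P] (k : ℕ) (A : LS ℂ (LS ℂ P))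
    (a b : ℤ) : mulSubPow k (fun a b => cf b (cf a A)) a b
      = cf b (cf a (((Xo - Xi) ^ k : Module.End ℂ (LS ℂ (LS ℂ P))) A)) := by
  have := cf_add_pow' (-1 : ℂ) k A a b
  rw [show ((-1 : ℂ) • Xi + Xo : Module.End ℂ (LS ℂ (LS ℂ P))) = Xo - Xi by
    rw [add_comm, sub_eq_add_neg]; congr 1; exact neg_one_smul ℂ (_ : Module.End ℂ (LS ℂ (LS ℂ P)))] at this
  rw [this]; rfl

lemma substAdd02_cf {P : Type*} [AddCommGroup P] [Module ℂ P] (A : LS ℂ (LS ℂ P)) (a b : ℤ) :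
    substAdd02 (fun a b => cf a (cf b A)) a b = cf a (cf b (Tp A)) := by
  rw [substAdd02, Tp_apply, E, cf_Op_finsum]
  obtain ⟨N, hN⟩ := exists_bound A
  have hK : b - N < ((b - N).natAbs + 1 : ℕ) := by omega
  rw [finsum_nat_eq_sum_range ((b - N).natAbs + 1), finsum_nat_eq_sum_range ((b - N).natAbs + 1),
    map_sum]
  · exact Finset.sum_congr rfl fun i _ => by rw [cf_expSeq_der]
  · intro i hi; rw [hN _ (by omega), map_zero]
  · intro i hi; rw [hN _ (by omega), map_zero, smul_zero]

namespace NLVA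

variable {V : Type*} [AddCommGroup V] [Module ℂ V] (𝒱 : NLVA V)

/-- The vertex operator map with values in Laurent series. -/
def Yl : V →ₗ[ℂ] V →ₗ[ℂ] LS ℂ V :=
  LinearMap.mk₂ ℂ (fun u v => LS.mk (𝒱.Y u v) (𝒱.trunc u v))
    (fun u u' v => LS.ext fun n => by simp; rfl)
    (fun c u v => LS.ext fun n => by simp; rfl)
    (fun u v v' => LS.ext fun n => by simp; rfl)
    (fun c u v => LS.ext fun n => by simp; rfl)

@[simp] lemma cf_Yl (u v : V) (n : ℤ) : cf n (𝒱.Yl u v) = 𝒱.Y u v n := rfl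

lemma Yl_one (v : V) : 𝒱.Yl 𝒱.one v = cst v := LS.ext fun n => by
  rw [cf_Yl, 𝒱.vacuum_left, cf_cst]

lemma D_apply (v : V) : 𝒱.D v = 𝒱.Y v 𝒱.one 1 := rfl

lemma weak_assoc' (u v w : V) : ∃ k : ℕ,
    Sw (((Xi + Xo) ^ k : Module.End ℂ (LS ℂ (LS ℂ V))) (Tp (map (𝒱.Yl u) (𝒱.Yl v w))))
      (((Xi + Xo) ^ k : Module.End ℂ (LS ℂ (LS ℂ V))) (map (𝒱.Yl.flip w) (𝒱.Yl u v))) := by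
  obtain ⟨k, hk⟩ := 𝒱.weak_assoc u v w
  refine ⟨k, fun b a => ?_⟩
  have h := hk a b
  have h1 : (substAdd02 fun m n => 𝒱.Y u (𝒱.Y v w n) m)
      = fun a b => cf a (cf b (Tp (map (𝒱.Yl u) (𝒱.Yl v w)))) := by
    funext a b
    rw [← substAdd02_cf]
    simp only [cf_map, cf_Yl]
  have h2 : (fun a' b' => 𝒱.Y (𝒱.Y u v a') w b')
      = fun a b => cf b (cf a (map (𝒱.Yl.flip w) (𝒱.Yl u v))) := by
    funext a b
    simp only [cf_map, cf_Yl, LinearMap.flip_apply]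
  rw [h1, h2, mulAddPow_cf, mulAddPow_cf'] at h
  exact h

lemma weak_assoc_of_le (u v w : V) : ∃ k₀ : ℕ, ∀ k, k₀ ≤ k →
    Sw (((Xi + Xo) ^ k : Module.End ℂ (LS ℂ (LS ℂ V))) (Tp (map (𝒱.Yl u) (𝒱.Yl v w))))
      (((Xi + Xo) ^ k : Module.End ℂ (LS ℂ (LS ℂ V))) (map (𝒱.Yl.flip w) (𝒱.Yl u v))) := by
  obtain ⟨k, hk⟩ := 𝒱.weak_assoc' u v w
  refine ⟨k, fun l hl => ?_⟩
  obtain ⟨d, rfl⟩ := Nat.exists_eq_add_of_le' hl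
  rw [pow_add, Module.End.mul_apply, Module.End.mul_apply]
  exact swOp_add.pow d _ _ hk

end NLVA

end

noncomputable section

lemma zchoose_eq_zero {n : ℤ} {k : ℕ} (h0 : 0 ≤ n) (h : n < k) : zchoose n k = 0 := by
  obtain ⟨m, rfl⟩ := Int.eq_ofNat_of_zero_le h0
  rw [zchoose, if_pos h0, Int.toNat_natCast, Nat.choose_eq_zero_of_lt (by omega)]; rfl

lemma zchoose_natCast (n k : ℕ) : zchoose n k = (n.choose k : ℕ) := by
  rw [zchoose, if_pos (by omega), Int.toNat_natCast]

namespace LS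

variable {R P Q M : Type*} [Field R] [CharZero R] [AddCommGroup P] [Module R P]
  [AddCommGroup Q] [Module R Q] [AddCommGroup M] [Module R M]

lemma cf_Tp_cst (f : LS R P) (m : ℕ) (n : ℤ) :
    cf n (cf m (Tp (cst f))) = ((zchoose (n + m) m : ℤ) : R) • cf (n + m) f := by
  rw [Tp_apply, E, Op_cst, cf_expSeq_der]

lemma cf_Tp_cst_neg (f : LS R P) {m : ℤ} (hm : m < 0) : cf m (Tp (cst f)) = 0 :=
  Op_cst_neg _ _ _ hm

lemma sw_Tp_cst (f : LS R P) (hf : ∀ n < 0, cf n f = 0) : Sw (Tp (cst f)) (Tp (cst f)) := by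
  have key : ∀ (m n : ℤ), n < 0 → cf n (cf m (Tp (cst f))) = 0 := by
    intro m n hn
    rcases lt_or_ge m 0 with hm | hm
    · rw [cf_Tp_cst_neg f hm, map_zero]
    · obtain ⟨m, rfl⟩ := Int.eq_ofNat_of_zero_le hm
      rw [cf_Tp_cst]
      rcases lt_or_ge (n + m) 0 with h | h
      · rw [hf _ h, smul_zero]
      · rw [zchoose_eq_zero h (by omega), Int.cast_zero, zero_smul]
  intro m n
  rcases lt_or_ge n 0 with hn | hn
  · rw [key m n hn, cf_Tp_cst_neg f hn, map_zero]
  · rcases lt_or_ge m 0 with hm | hm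
    · rw [key n m hm, cf_Tp_cst_neg f hm, map_zero]
    · obtain ⟨m, rfl⟩ := Int.eq_ofNat_of_zero_le hm
      obtain ⟨n, rfl⟩ := Int.eq_ofNat_of_zero_le hn
      rw [cf_Tp_cst, cf_Tp_cst, ← Nat.cast_add, ← Nat.cast_add, zchoose_natCast, zchoose_natCast,
        Nat.add_comm m n, Nat.choose_symm_add]

lemma Xi_pow_cst (k : ℕ) (f : LS R P) : (Xi ^ k) (cst f) = cst ((X ^ k) f) :=
  ext fun m => ext fun n => by
    rw [cf_Xi_pow, cf_cst, cf_cst]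
    split_ifs
    · rw [cf_X_pow]
    · simp

lemma Tp_Xi_pow (k : ℕ) (A : LS R (LS R P)) : Tp ((Xi ^ k) A)
    = ((Xi + Xo) ^ k : Module.End R (LS R (LS R P))) (Tp A) :=
  LinearMap.congr_fun (semiconj_Tp_Xi.pow_right k) A

lemma Tm_Xi_pow (k : ℕ) (A : LS R (LS R P)) : Tm ((Xi ^ k) A)
    = ((Xi - Xo) ^ k : Module.End R (LS R (LS R P))) (Tm A) :=
  LinearMap.congr_fun (semiconj_Tm_Xi.pow_right k) A

lemma Tm_add_pow (k : ℕ) (A : LS R (LS R P)) :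
    Tm (((Xi + Xo) ^ k : Module.End R (LS R (LS R P))) A) = (Xi ^ k) (Tm A) := by
  have h := (semiconj_Tm_Xi (R := R) (P := P)).add_right semiconj_Tm_Xo
  rw [sub_add_cancel] at h
  exact LinearMap.congr_fun (h.pow_right k) A

lemma Tm_Xo_pow (k : ℕ) (A : LS R (LS R P)) : Tm ((Xo ^ k) A) = (Xo ^ k) (Tm A) :=
  LinearMap.congr_fun (semiconj_Tm_Xo.pow_right k) A

lemma Tp_Xo_pow (k : ℕ) (A : LS R (LS R P)) : Tp ((Xo ^ k) A) = (Xo ^ k) (Tp A) :=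
  LinearMap.congr_fun (semiconj_Tp_Xo.pow_right k) A

lemma Tp_sub_pow (k : ℕ) (A : LS R (LS R P)) :
    Tp (((Xi - Xo) ^ k : Module.End R (LS R (LS R P))) A) = (Xi ^ k) (Tp A) := by
  have h := (semiconj_Tp_Xi (R := R) (P := P)).sub_right semiconj_Tp_Xo
  rw [add_sub_cancel_right] at h
  exact LinearMap.congr_fun (h.pow_right k) A

lemma E_D_unique {D : P →ₗ[R] P} {A : LS R P} {v : P} (h0 : cf 0 A = v)
    (hneg : ∀ n < 0, cf n A = 0) (h : der A = map D A) : A = E D (cst v) := by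
  apply ext; intro n
  rcases lt_or_ge n 0 with hn | hn
  · rw [hneg n hn, E, Op_cst_neg _ _ _ hn]
  · obtain ⟨n, rfl⟩ := Int.eq_ofNat_of_zero_le hn
    induction n with
    | zero => 
      rw [E, Op_cst, expSeq_zero, LinearMap.id_apply]; exact h0
    | succ n ih =>
      have hi : ((n : R) + 1) ≠ 0 := by exact_mod_cast Nat.succ_ne_zero n
      apply smul_right_injective _ hi
      have h1 := congrArg (cf (n : ℤ)) h
      rw [cf_der, cf_map, ih (by omega)] at h1
      rw [E, Op_cst] at h1 ⊢
      have h2 := LinearMap.congr_fun (expSeq_succ D n) v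
      simp only [LinearMap.smul_apply, LinearMap.comp_apply] at h2
      simp only
      rw [h2, ← h1]
      push_cast
      rfl

end LS

open LS

namespace NLVA

variable {V : Type*} [AddCommGroup V] [Module ℂ V] (𝒱 : NLVA V)

lemma map_flip_Yl_one (u w : V) : map (𝒱.Yl.flip w) (𝒱.Yl u 𝒱.one) = Tp (cst (𝒱.Yl u w)) := by
  obtain ⟨k₀, hk₀⟩ := 𝒱.weak_assoc_of_le u 𝒱.one w
  obtain ⟨N, hN⟩ := exists_bound (𝒱.Yl u w)
  have h := hk₀ (k₀ + N.natAbs) (by omega)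
  rw [Yl_one, map_cst, ← Tp_Xi_pow, Xi_pow_cst] at h
  have h2 := sw_Tp_cst ((X ^ (k₀ + N.natAbs)) (𝒱.Yl u w))
    (fun n hn => by rw [cf_X_pow]; exact hN _ (by omega))
  have h3 := h.eq h2
  rw [← Xi_pow_cst, Tp_Xi_pow] at h3
  exact injective_Xi_add_Xo_pow _ h3

lemma Yl_D (u w : V) : 𝒱.Yl (𝒱.D u) w = der (𝒱.Yl u w) := by
  have h := congrArg (cf 1) (𝒱.map_flip_Yl_one u w)
  rw [cf_map, Tp_apply, E, show (1 : ℤ) = (1 : ℕ) from rfl, Op_cst] at h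
  have h2 := LinearMap.congr_fun (expSeq_succ (der : LS ℂ V →ₗ[ℂ] LS ℂ V) 0) (𝒱.Yl u w)
  simp [expSeq_zero] at h2
  rw [h2] at h
  exact h

lemma Yl_one_right (u : V) : 𝒱.Yl u 𝒱.one = E 𝒱.D (cst u) := by
  refine E_D_unique (𝒱.creation_zero u) (fun n hn => 𝒱.creation_reg u n hn) ?_
  apply LS.ext; intro n
  have h : ∀ u n, cf n (der (𝒱.Yl u 𝒱.one)) = 𝒱.Y (𝒱.D u) 𝒱.one n := by
    intro u n; rw [← Yl_D]; rfl
  rcases lt_or_ge n 0 with hn | hn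
  · rw [h, 𝒱.creation_reg _ n hn, cf_map, cf_Yl, 𝒱.creation_reg _ n hn, map_zero]
  · obtain ⟨n, rfl⟩ := Int.eq_ofNat_of_zero_le hn
    rw [cf_map, D_apply, ← cf_Yl]
    have h3 : cf (n : ℤ) (map (𝒱.Yl.flip 𝒱.one) (𝒱.Yl u 𝒱.one))
        = expSeq der n (𝒱.Yl u 𝒱.one) := by
      rw [𝒱.map_flip_Yl_one, Tp_apply, E, Op_cst]
    rw [cf_map, LinearMap.flip_apply] at h3
    rw [h3, cf_expSeq_der, cf_der, add_comm (n : ℤ) 1]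
    congr 1
    have := zchoose_natCast (1 + n) n
    push_cast at this
    rw [this]
    rw [Nat.add_comm, Nat.choose_succ_self_right]; push_cast; ring

lemma D_Yl (u v : V) : map 𝒱.D (𝒱.Yl u v) = 𝒱.Yl u (𝒱.D v) + der (𝒱.Yl u v) := by
  obtain ⟨k, hk⟩ := 𝒱.weak_assoc' u v 𝒱.one
  have h := hk.cancel_add ⟨0, fun m n hn => by
    rw [cf_map]; exact 𝒱.creation_reg _ _ hn⟩
  apply LS.ext; intro n
  have h1 := h 1 n
  rw [cf_map, LinearMap.flip_apply] at h1
  change _ = 𝒱.D (cf n (𝒱.Yl u v)) at h1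
  rw [cf_map, ← h1, Tp_apply, E, cf_Op _ _ 1 0 2 (fun m hm => by
    rw [cf_map, cf_Yl, 𝒱.creation_reg _ _ hm, map_zero]) (by norm_num)]
  rw [Finset.sum_range_succ, Finset.sum_range_one, expSeq_zero]
  have h2 := LinearMap.congr_fun (expSeq_succ (der : LS ℂ V →ₗ[ℂ] LS ℂ V) 0) (𝒱.Yl u v)
  simp [expSeq_zero] at h2
  simp only [cf_map, cf_Yl, map_add, LinearMap.id_apply]
  have h3 : 𝒱.Y v 𝒱.one ((1 : ℤ) - (1 : ℕ)) = v := 𝒱.creation_zero v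
  rw [h3, h2]
  have h4 : 𝒱.Y v 𝒱.one ((1 : ℤ) - (0 : ℕ)) = 𝒱.D v := rfl
  rw [h4]

lemma one_ne_zero [Nontrivial V] : 𝒱.one ≠ 0 := by
  intro h
  obtain ⟨v, hv⟩ := exists_ne (0 : V)
  apply hv
  have := 𝒱.vacuum_left v 0
  rw [h] at this
  simpa using this.symm

lemma map_Yl_E_D (u : V) (B : LS ℂ V) :
    map (𝒱.Yl u) (E 𝒱.D B) = Tm (E ((map 𝒱.D).restrictScalars ℂ) (map (𝒱.Yl u) B)) := by
  have h := E_map_of_comm (D := 𝒱.D) (D' := (map 𝒱.D).restrictScalars ℂ + -der) (𝒱.Yl u) (by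
    ext v : 1
    simp [D_Yl]) B
  rw [← h, E_add, Tm_apply]
  rw [LinearMap.comp_neg, LinearMap.neg_comp]
  congr 1
  exact LinearMap.ext fun A => LS.ext fun n => by
    simp [cf_der]

end NLVA

end

noncomputable section

open LS

instance (priority := 10000) LS.laurentAlgebra {R : Type*} [CommRing R] :
    Algebra R (LaurentSeries R) := HahnSeries.instAlgebra

instance (priority := 10000) LS.smulCommClass_laurent {R : Type*} [CommRing R] :
    SMulCommClass (LaurentSeries R) R (LaurentSeries R) := Algebra.to_smulCommClass.symm

instance (priority := 10000) LS.isScalarTower_laurent {R : Type*} [CommRing R] :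
    IsScalarTower R (LaurentSeries R) (LaurentSeries R) := IsScalarTower.right

/-- The scalar extension of `P` to Laurent series. -/
abbrev KT (P : Type*) [AddCommGroup P] [Module ℂ P] := LaurentSeries ℂ ⊗[ℂ] P

namespace KT

variable {P Q M : Type*} [AddCommGroup P] [Module ℂ P] [AddCommGroup Q] [Module ℂ Q]
  [AddCommGroup M] [Module ℂ M]

/-- The `ℂ((x))`-linear extension of a map into Laurent series. -/
def ev (φ : P →ₗ[ℂ] LS ℂ Q) : KT P →ₗ[LaurentSeries ℂ] LS ℂ Q :=
  φ.liftBaseChange (LaurentSeries ℂ)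

@[simp] lemma ev_tmul (φ : P →ₗ[ℂ] LS ℂ Q) (f : LaurentSeries ℂ) (p : P) :
    ev φ (f ⊗ₜ p) = f • φ p := by simp [ev]

/-- The embedding of `ℂ((x)) ⊗ P` into `P((x))`. -/
def tl : KT P →ₗ[LaurentSeries ℂ] LS ℂ P := ev cst

@[simp] lemma tl_tmul (f : LaurentSeries ℂ) (p : P) : tl (f ⊗ₜ p) = f • cst p := ev_tmul _ _ _

/-- Base change of a linear map to Laurent series. -/
def bc (φ : P →ₗ[ℂ] Q) : KT P →ₗ[LaurentSeries ℂ] KT Q := φ.baseChange (LaurentSeries ℂ)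

@[simp] lemma bc_tmul (φ : P →ₗ[ℂ] Q) (f : LaurentSeries ℂ) (p : P) :
    bc φ (f ⊗ₜ p) = f ⊗ₜ φ p := rfl

lemma cf_smul_cst (f : LaurentSeries ℂ) (p : P) (n : ℤ) :
    cf n (f • cst p : LS ℂ P) = f.coeff n • p := by
  rw [cf_smul_finsum, finsum_eq_single _ n]
  · simp
  · intro m hm
    rw [cf_cst, if_neg (by omega), smul_zero]

lemma induction₁ {p : KT P → Prop} (h0 : p 0) (ht : ∀ f u, p (f ⊗ₜ u))
    (ha : ∀ s t, p s → p t → p (s + t)) (t) : p t :=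
  TensorProduct.induction_on t h0 ht ha

lemma cf_tl_bc (φ : P →ₗ[ℂ] Q) (t : KT P) (n : ℤ) : cf n (tl (bc φ t)) = φ (cf n (tl t)) := by
  induction t using KT.induction₁ with
  | h0 => simp
  | ht f p => simp [cf_smul_cst]
  | ha s t hs ht => simp only [map_add, hs, ht]

lemma tl_injective : Function.Injective (tl : KT P → LS ℂ P) := by
  rw [injective_iff_map_eq_zero]
  intro t ht
  let b := Module.Free.chooseBasis ℂ P
  have key : ∀ (t : KT P) i n, (TensorProduct.equivFinsuppOfBasisRight (M := LaurentSeries ℂ) b t i).coeff n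
      = b.repr (cf n (tl t)) i := by
    intro t i n
    induction t using KT.induction₁ with
    | h0 => simp
    | ht f p => simp [cf_smul_cst, mul_comm]
    | ha s t hs ht => simp [hs, ht]
  apply (TensorProduct.equivFinsuppOfBasisRight b).injective
  ext i n
  rw [key, ht]
  simp

lemma exists_tl (a : ℤ → P) (h : IsTensorLaurent a) : ∃ t : KT P, ∀ n, cf n (tl t) = a n := by
  obtain ⟨⟨N, hN⟩, F, hF, haF⟩ := h
  obtain ⟨s, rfl⟩ := hF
  classical
  have hc : ∀ n, ∃ c : P → ℂ, (∑ p ∈ s, c p • p) = a n := by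
    intro n
    have := haF n
    rw [Submodule.mem_span_finset] at this
    obtain ⟨f, -, h⟩ := this
    exact ⟨f, h⟩
  choose c hc using hc
  refine ⟨∑ p ∈ s, (HahnSeries.ofSuppBddBelow (fun n => if N ≤ n then c n p else 0) ?_) ⊗ₜ p,
    fun n => ?_⟩
  · refine ⟨N, fun n hn => ?_⟩
    by_contra h
    apply hn
    simp only
    rw [if_neg h]
  · rw [map_sum, map_sum]
    refine (Finset.sum_congr rfl fun p _ => ?_ :
      _ = ∑ p ∈ s, (if N ≤ n then c n p else 0) • p).trans ?_
    · rw [tl_tmul, cf_smul_cst]; rfl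
    · by_cases h : N ≤ n
      · simp only [if_pos h, hc]
      · simp only [if_neg h, hN n (by omega), zero_smul, Finset.sum_const_zero]

lemma isTensorLaurent_tl (t : KT P) : IsTensorLaurent fun n => cf n (tl t) := by
  refine ⟨exists_bound _, ?_⟩
  induction t using KT.induction₁ with
  | h0 => exact ⟨⊥, Submodule.fg_bot, fun n => by simp⟩
  | ht f p =>
    refine ⟨Submodule.span ℂ {p}, Submodule.fg_span_singleton p, fun n => ?_⟩
    simp only [tl_tmul, cf_smul_cst]
    exact Submodule.smul_mem _ _ (Submodule.mem_span_singleton_self p)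
  | ha s t hs ht =>
    obtain ⟨F, hF, h⟩ := hs
    obtain ⟨G, hG, h'⟩ := ht
    refine ⟨F ⊔ G, hF.sup hG, fun n => ?_⟩
    simp only [map_add]
    exact Submodule.add_mem_sup (h n) (h' n)

lemma induction₂ {p : KT (P ⊗[ℂ] Q) → Prop} (h0 : p 0)
    (ht : ∀ f u v, p (f ⊗ₜ (u ⊗ₜ v))) (ha : ∀ s t, p s → p t → p (s + t)) (t) : p t := by
  refine induction₁ h0 (fun f x => ?_) ha t
  induction x with
  | zero => rw [TensorProduct.tmul_zero]; exact h0
  | tmul u v => exact ht f u v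
  | add x y hx hy => rw [TensorProduct.tmul_add]; exact ha _ _ hx hy

end KT

namespace LS

variable {R P Q M : Type*} [Field R] [CharZero R] [AddCommGroup P] [Module R P]
  [AddCommGroup Q] [Module R Q] [AddCommGroup M] [Module R M]

lemma add_pow_smul (k : ℕ) (f : LaurentSeries R) (A : LS R (LS R P)) :
    ((Xi + Xo) ^ k : Module.End R (LS R (LS R P))) (f • A)
      = f • ((Xi + Xo) ^ k : Module.End R (LS R (LS R P))) A := by
  induction k with
  | zero => rfl
  | succ k ih =>
    rw [pow_succ', Module.End.mul_apply, Module.End.mul_apply, ih, LinearMap.add_apply,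
      LinearMap.add_apply, smul_add]
    congr 1
    · exact map_smul (map (X.restrictScalars R)) _ _
    · exact map_smul X _ _

lemma add_pow_map_ml (k : ℕ) (f : LaurentSeries R) (A : LS R (LS R P)) :
    ((Xi + Xo) ^ k : Module.End R (LS R (LS R P))) (map (ml f) A)
      = map (ml f) (((Xi + Xo) ^ k : Module.End R (LS R (LS R P))) A) := by
  induction k with
  | zero => rfl
  | succ k ih =>
    rw [pow_succ', Module.End.mul_apply, Module.End.mul_apply, ih, LinearMap.add_apply,
      LinearMap.add_apply, map_add]
    congr 1
    · apply ext; intro n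
      simp only [Xi, cf_map, LinearMap.restrictScalars_apply, ml_apply, map_smul]
    · exact (map_smul (map (ml f)) _ _).symm

end LS

namespace NLVA

open KT

variable {V : Type*} [AddCommGroup V] [Module ℂ V] (𝒱 : NLVA V)

/-- The `ℂ((x))`-linear extension of the vertex operator map. -/
def Yh : KT (V ⊗[ℂ] V) →ₗ[LaurentSeries ℂ] LS ℂ V := ev (TensorProduct.lift 𝒱.Yl)

@[simp] lemma Yh_tmul (f : LaurentSeries ℂ) (u v : V) :
    𝒱.Yh (f ⊗ₜ (u ⊗ₜ v)) = f • 𝒱.Yl u v := by simp [Yh]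

@[simp] lemma Yc_apply (n : ℤ) (u v : V) : 𝒱.Yc n u v = 𝒱.Y u v n := rfl

/-- Iterates `Y(Y(a,x₀)·,x₂)·`, outer variable `x₀`. -/
def Yit (a : V) (r : KT (V ⊗[ℂ] V)) : LS ℂ (LS ℂ V) :=
  LS.mk (fun n => 𝒱.Yh (bc (LinearMap.rTensor V (𝒱.Yc n a)) r)) (by
    induction r using KT.induction₂ with
    | h0 => exact ⟨0, fun n _ => by simp⟩
    | ht f u v =>
      obtain ⟨N, hN⟩ := 𝒱.trunc a u
      refine ⟨N, fun n hn => ?_⟩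
      have : 𝒱.Y a u n = 0 := hN n hn
      simp [this]
    | ha s t hs ht =>
      obtain ⟨N, hN⟩ := hs
      obtain ⟨M, hM⟩ := ht
      refine ⟨min N M, fun n hn => ?_⟩
      rw [map_add, map_add, hN n (by omega), hM n (by omega), add_zero])

@[simp] lemma cf_Yit (a : V) (r : KT (V ⊗[ℂ] V)) (n : ℤ) :
    cf n (𝒱.Yit a r) = 𝒱.Yh (bc (LinearMap.rTensor V (𝒱.Yc n a)) r) := rfl

lemma Yit_add (a : V) (r s : KT (V ⊗[ℂ] V)) : 𝒱.Yit a (r + s) = 𝒱.Yit a r + 𝒱.Yit a s :=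
  LS.ext fun n => by simp

lemma Yit_tmul (a : V) (f : LaurentSeries ℂ) (u v : V) :
    𝒱.Yit a (f ⊗ₜ (u ⊗ₜ v)) = map (ml f) (map (𝒱.Yl.flip v) (𝒱.Yl a u)) :=
  LS.ext fun n => by simp

lemma weak_assoc_Yit (a : V) (r : KT (V ⊗[ℂ] V)) : ∃ k₀ : ℕ, ∀ k, k₀ ≤ k →
    Sw (((Xi + Xo) ^ k : Module.End ℂ (LS ℂ (LS ℂ V))) (Tp (map (𝒱.Yl a) (𝒱.Yh r))))
      (((Xi + Xo) ^ k : Module.End ℂ (LS ℂ (LS ℂ V))) (𝒱.Yit a r)) := by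
  induction r using KT.induction₂ with
  | h0 =>
    refine ⟨0, fun k _ => ?_⟩
    have : 𝒱.Yit a 0 = 0 := LS.ext fun n => by simp
    rw [this]
    simp only [map_zero]
    intro m n; simp
  | ht f u v =>
    obtain ⟨k₀, h⟩ := 𝒱.weak_assoc_of_le a u v
    refine ⟨k₀, fun k hk => ?_⟩
    have := swOp_smul f (h k hk)
    rw [Yh_tmul, Yit_tmul, add_pow_map_ml, map_smul, Tp_apply, map_smul, add_pow_smul]
    exact this
  | ha s t hs ht =>
    obtain ⟨k₁, h₁⟩ := hs
    obtain ⟨k₂, h₂⟩ := ht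
    refine ⟨max k₁ k₂, fun k hk => ?_⟩
    have := (h₁ k (by omega)).add (h₂ k (by omega))
    rw [Yit_add]
    simp only [map_add]
    exact this

/-- The operators `Y(u)_n`. -/
def modes : Set (Module.End ℂ V) := {a | ∃ u n, a = 𝒱.Yc n u}

lemma isSimpleUnder_modes {𝒱 : NLVA V} (h : 𝒱.SelfIrreducible) : IsSimpleUnder 𝒱.modes := by
  refine ⟨h.1, fun P hP => h.2 P fun u p hp n => ?_⟩
  exact hP (𝒱.Yc n u) ⟨u, n, rfl⟩ p hp

lemma Yit_eq_zero (a : V) {r : KT (V ⊗[ℂ] V)} (hr : 𝒱.Yh r = 0) : 𝒱.Yit a r = 0 := by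
  obtain ⟨k, hk⟩ := 𝒱.weak_assoc_Yit a r
  have h := hk k le_rfl
  rw [hr] at h
  simp only [map_zero] at h
  have h0 : (((Xi + Xo) ^ k : Module.End ℂ (LS ℂ (LS ℂ V))) (𝒱.Yit a r)) = 0 :=
    h.eq (fun m n => by simp)
  exact injective_Xi_add_Xo_pow k (by rw [h0, map_zero])

lemma Yh_injective {𝒱 : NLVA V} (hirr : 𝒱.SelfIrreducible) (hcd : CountableDim V) :
    Function.Injective 𝒱.Yh := by
  rw [injective_iff_map_eq_zero]
  let e : V ⊗[ℂ] KT V ≃ₗ[ℂ] KT (V ⊗[ℂ] V) := TensorProduct.leftComm ℂ V (LaurentSeries ℂ) V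
  let K0 : Submodule ℂ (V ⊗[ℂ] KT V) :=
    LinearMap.ker ((𝒱.Yh.restrictScalars ℂ) ∘ₗ e.toLinearMap)
  have hmem : ∀ t, t ∈ K0 ↔ 𝒱.Yh (e t) = 0 := fun t => LinearMap.mem_ker
  have hcomm : ∀ (φ : Module.End ℂ V) t,
      e (LinearMap.rTensor (KT V) φ t) = bc (LinearMap.rTensor V φ) (e t) := by
    intro φ t
    have : e.toLinearMap ∘ₗ LinearMap.rTensor (KT V) φ
        = ((bc (LinearMap.rTensor V φ)).restrictScalars ℂ) ∘ₗ e.toLinearMap := by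
      ext u f v
      simp [e]
    exact LinearMap.congr_fun this t
  have hone : 𝒱.one ≠ 0 := by
    haveI := hirr.1
    exact 𝒱.one_ne_zero
  have hK0 : K0 = ⊥ := by
    refine (isSimpleUnder_modes hirr).tensor_eq_bot (M := KT V) hcd K0 ?_ 𝒱.one hone ?_
    · rintro _ ⟨a, n, rfl⟩ t ht
      rw [hmem] at ht ⊢
      rw [hcomm, ← cf_Yit, Yit_eq_zero 𝒱 a ht, map_zero]
    · intro m hm
      rw [hmem] at hm
      apply tl_injective
      rw [map_zero, ← hm]
      clear hm
      induction m using KT.induction₁ with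
      | h0 => simp
      | ht f v => simp [e, Yl_one]
      | ha s t hs ht => simp only [map_add, hs, ht, TensorProduct.tmul_add]
  intro t ht
  obtain ⟨s, rfl⟩ := e.surjective t
  have : s ∈ K0 := (hmem s).2 ht
  rw [hK0, Submodule.mem_bot] at this
  rw [this, map_zero]

end NLVA

end

noncomputable section

open LS

namespace IsIterLaurent

variable {P Q : Type*} [AddCommGroup P] [Module ℂ P] [AddCommGroup Q] [Module ℂ Q]

lemma comp {n : ℕ} {a : (Fin n → ℤ) → P} (ha : IsIterLaurent n a) (φ : P → Q) (h0 : φ 0 = 0) :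
    IsIterLaurent n fun k => φ (a k) := by
  induction n with
  | zero => trivial
  | succ n ih =>
    obtain ⟨⟨N, hN⟩, h⟩ := ha
    exact ⟨⟨N, fun k hk => by simp only [hN k hk, h0]⟩, fun m => ih (h m)⟩

/-- Separating the first index. -/
lemma cons {n : ℕ} {a : (Fin (n + 1) → ℤ) → P} (ha : IsIterLaurent (n + 1) a) :
    IsIterLaurent n (fun k => (fun l => a (Fin.cons l k) : ℤ → P)) ∧
      ∀ k, IsLaurent fun l => a (Fin.cons l k) := by
  induction n with
  | zero =>
    obtain ⟨⟨N, hN⟩, -⟩ := ha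
    exact ⟨trivial, fun k => ⟨N, fun l hl => hN _ hl⟩⟩
  | succ n ih =>
    obtain ⟨⟨N, hN⟩, h⟩ := ha
    refine ⟨⟨⟨N, fun k hk => funext fun l => hN _ hk⟩, fun m => ?_⟩, fun k => ?_⟩
    · have := (ih (h m)).1
      simp only [← Fin.cons_snoc_eq_snoc_cons] at this
      exact this
    · have := (ih (h (k (Fin.last n)))).2 (Fin.init k)
      simp only [← Fin.cons_snoc_eq_snoc_cons, Fin.snoc_init_self] at this
      exact this

/-- Adding a first index. -/
lemma of_cons {n : ℕ} {a : (Fin n → ℤ) → P} (ha : IsIterLaurent n a) (φ : P → ℤ → Q)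
    (h0 : φ 0 = 0) (hφ : ∀ p, IsLaurent (φ p)) :
    IsIterLaurent (n + 1) fun k => φ (a fun i => k i.succ) (k 0) := by
  induction n with
  | zero =>
    obtain ⟨N, hN⟩ := hφ (a default)
    refine ⟨⟨N, fun k hk => ?_⟩, fun m => trivial⟩
    show φ (a fun i => k i.succ) (k 0) = 0
    rw [Subsingleton.elim (fun i : Fin 0 => k i.succ) default]
    exact hN _ hk
  | succ n ih =>
    obtain ⟨⟨N, hN⟩, h⟩ := ha
    refine ⟨⟨N, fun k hk => ?_⟩, fun m => ?_⟩
    · show φ (a fun i => k i.succ) (k 0) = 0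
      rw [hN (fun i => k i.succ) hk, h0]; rfl
    · have h1 := ih (h m)
      have h2 : ∀ k : Fin (n + 1) → ℤ, (fun i : Fin (n + 1) => (Fin.snoc k m : Fin (n + 2) → ℤ) i.succ)
          = Fin.snoc (fun i : Fin n => k i.succ) m := fun k => by
        conv_lhs => rw [← Fin.cons_self_tail k, ← Fin.cons_snoc_eq_snoc_cons]
        rfl
      have h3 : ∀ k : Fin (n + 1) → ℤ, (Fin.snoc k m : Fin (n + 2) → ℤ) 0 = k 0 := fun k => by
        conv_lhs => rw [← Fin.cons_self_tail k, ← Fin.cons_snoc_eq_snoc_cons]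
        rfl
      simp only [h2, h3]
      exact h1

lemma finite_conv {n : ℕ} {a : (Fin n → ℤ) → P} {b : (Fin n → ℤ) → Q}
    (ha : IsIterLaurent n a) (hb : IsIterLaurent n b) (K : Fin n → ℤ) :
    {L : Fin n → ℤ | a L ≠ 0 ∧ b (fun i => K i - L i) ≠ 0}.Finite := by
  induction n with
  | zero => exact Set.toFinite _
  | succ n ih =>
    obtain ⟨⟨N, hN⟩, ha⟩ := ha
    obtain ⟨⟨M, hM⟩, hb⟩ := hb
    refine Set.Finite.subset (Set.Finite.biUnion (Set.finite_Icc N (K (Fin.last n) - M))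
      fun m _ => (ih (ha m) (hb (K (Fin.last n) - m)) (Fin.init K)).image
        fun k => (Fin.snoc k m : Fin (n + 1) → ℤ)) ?_
    rintro L ⟨h1, h2⟩
    simp only [Set.mem_iUnion, Set.mem_image, Set.mem_setOf_eq]
    refine ⟨L (Fin.last n), ?_, Fin.init L, ⟨?_, ?_⟩, Fin.snoc_init_self L⟩
    · constructor
      · by_contra h; exact h1 (hN _ (by omega))
      · by_contra h; exact h2 (hM _ (by show K _ - L _ < M; omega))
    · rwa [Fin.snoc_init_self]
    · convert h2 using 2
      ext i
      refine Fin.lastCases ?_ (fun i => ?_) i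
      · simp
      · simp [Fin.init]

end IsIterLaurent

namespace NLVA

open KT

variable {V : Type*} [AddCommGroup V] [Module ℂ V] (𝒱 : NLVA V)

lemma isIterLaurent_prodY (n : ℕ) (v : Fin n → V) : IsIterLaurent n (𝒱.prodY n v) := by
  induction n with
  | zero => trivial
  | succ n ih =>
    exact (ih fun i => v i.succ).of_cons (fun p => 𝒱.Y (v 0) p) (map_zero _) (fun p => 𝒱.trunc _ p)

lemma tmul_eq_zero_of_dual {M : Type*} [AddCommGroup M] [Module ℂ M] (t : V ⊗[ℂ] M)
    (h : ∀ φ : V →ₗ[ℂ] ℂ, TensorProduct.lid ℂ M (LinearMap.rTensor M φ t) = 0) : t = 0 := by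
  classical
  let b := Module.Free.chooseBasis ℂ V
  apply (TensorProduct.equivFinsuppOfBasisLeft b).injective
  rw [map_zero]
  ext i
  have key : ∀ t : V ⊗[ℂ] M, TensorProduct.equivFinsuppOfBasisLeft b t i
      = TensorProduct.lid ℂ M (LinearMap.rTensor M (b.coord i) t) := by
    intro t
    induction t with
    | zero => simp
    | tmul u v => simp
    | add s t hs ht => simp [hs, ht]
  rw [key, h]; rfl

/-- Prepending a vector to a pure tensor. -/
def tprodCons (n : ℕ) : V ⊗[ℂ] (PiTensorProduct ℂ fun _ : Fin n => V) →ₗ[ℂ]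
    PiTensorProduct ℂ fun _ : Fin (n + 1) => V :=
  TensorProduct.lift ((PiTensorProduct.lift (R := ℂ) (s := fun _ : Fin n => V)
    (E := PiTensorProduct ℂ fun _ : Fin (n + 1) => V)).toLinearMap ∘ₗ
    (PiTensorProduct.tprod ℂ (s := fun _ : Fin (n + 1) => V)).curryLeft)

lemma tprodCons_tmul (n : ℕ) (v : Fin (n + 1) → V) :
    tprodCons n (v 0 ⊗ₜ PiTensorProduct.tprod ℂ fun i => v i.succ)
      = PiTensorProduct.tprod ℂ v := by
  simp only [tprodCons, TensorProduct.lift.tmul, LinearMap.comp_apply, LinearEquiv.coe_coe,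
    PiTensorProduct.lift.tprod, MultilinearMap.curryLeft_apply]
  congr 1
  exact Fin.cons_self_tail v

lemma sum_tprod_eq_zero (hinj : Function.Injective 𝒱.Yh) (h1 : 𝒱.one ≠ 0) (n r : ℕ)
    (v : Fin r → Fin n → V) (f : Fin r → (Fin n → ℤ) → ℂ) (hf : ∀ j, IsIterLaurent n (f j))
    (h : ∀ K' : Fin n → ℤ, (∑ j : Fin r, ∑ᶠ L : Fin n → ℤ,
        f j L • 𝒱.prodY n (v j) fun i => K' i - L i) = 0) (L : Fin n → ℤ) :
    ∑ j : Fin r, f j L • PiTensorProduct.tprod ℂ (v j) = 0 := by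
  induction n with
  | zero =>
    have h2 := h L
    simp only [finsum_unique, prodY, ← Finset.sum_smul] at h2
    have h3 := (smul_eq_zero.mp h2).resolve_right h1
    have h4 : ∑ j, f j L = 0 := by
      rw [← h3]
      exact Finset.sum_congr rfl fun j _ => congrArg _ (Subsingleton.elim _ _)
    have : ∀ j, PiTensorProduct.tprod ℂ (v j) = PiTensorProduct.tprod ℂ (Fin.elim0 : Fin 0 → V) :=
      fun j => congrArg _ (Subsingleton.elim _ _)
    simp only [this, ← Finset.sum_smul, h4]
    exact zero_smul ℂ _
  | succ n ih =>
    have hF := fun j => (hf j).cons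
    let φ : Fin r → (Fin n → ℤ) → LaurentSeries ℂ := fun j L =>
      LS.mk (R := ℂ) (fun l => f j (Fin.cons l L)) ((hF j).2 L)
    have hφ : ∀ j L l, (φ j L).coeff l = f j (Fin.cons l L) := fun j L l => rfl
    have hφ0 : ∀ j L, φ j L ≠ 0 → (fun l => f j (Fin.cons l L)) ≠ 0 := fun j L h h' =>
      h (HahnSeries.ext (funext fun l => congrFun h' l))
    have hfin : ∀ j (K : Fin n → ℤ), {L : Fin n → ℤ | φ j L ≠ 0 ∧
        𝒱.prodY n (fun i => v j i.succ) (fun i => K i - L i) ≠ 0}.Finite := fun j K =>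
      ((hF j).1.finite_conv (𝒱.isIterLaurent_prodY n _) K).subset
        fun L hL => ⟨hφ0 j L hL.1, hL.2⟩
    let q : (Fin n → ℤ) → KT (V ⊗[ℂ] V) := fun K => ∑ j, ∑ᶠ L : Fin n → ℤ,
      φ j L ⊗ₜ (v j 0 ⊗ₜ 𝒱.prodY n (fun i => v j i.succ) fun i => K i - L i)
    have hsupp : ∀ j (K : Fin n → ℤ), Function.HasFiniteSupport fun L : Fin n → ℤ =>
      φ j L ⊗ₜ[ℂ] (v j 0 ⊗ₜ[ℂ] 𝒱.prodY n (fun i => v j i.succ) fun i => K i - L i) :=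
      fun j K => (hfin j K).subset fun L hL => by
        refine ⟨fun h => hL ?_, fun h => hL ?_⟩ <;> simp [h]
    have hq : ∀ K, q K = 0 := by
      intro K
      apply hinj
      rw [map_zero]
      apply LS.ext; intro k
      rw [map_zero, ← h (Fin.cons k K)]
      simp only [q, map_sum]
      refine Finset.sum_congr rfl fun j _ => ?_
      have e1 := ((cf (R := ℂ) (P := V) k).toAddMonoidHom.comp
        𝒱.Yh.toAddMonoidHom).map_finsum (hsupp j K)
      simp only [AddMonoidHom.comp_apply, LinearMap.toAddMonoidHom_coe] at e1
      rw [e1, ← finsum_comp_equiv (Fin.consEquiv fun _ : Fin (n + 1) => ℤ),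
        ← finsum_comp_equiv (Equiv.prodComm _ _), finsum_curry]
      · refine finsum_congr fun L => ?_
        rw [Yh_tmul, cf_smul_finsum]
        refine finsum_congr fun l => ?_
        rw [hφ]
        rfl
      · have := ((hf j).finite_conv (𝒱.isIterLaurent_prodY (n + 1) (v j)) (Fin.cons k K))
        have h4 := this.preimage (f := fun x : (Fin n → ℤ) × ℤ =>
            Fin.consEquiv (fun _ : Fin (n + 1) => ℤ) ((Equiv.prodComm _ _) x))
          ((Equiv.injective _).comp (Equiv.injective _)).injOn
        refine h4.subset fun x hx => ?_
        refine ⟨fun h => hx ?_, fun h => hx ?_⟩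
        · simp only [h, zero_smul]
        · simp only [h, smul_zero]
    rw [← Fin.cons_self_tail L]
    have hgoal : (∑ j, f j (Fin.cons (L 0) (Fin.tail L)) •
        (v j 0 ⊗ₜ[ℂ] PiTensorProduct.tprod ℂ (fun i : Fin n => v j i.succ))) = 0 := by
      apply tmul_eq_zero_of_dual
      intro ψ
      have h5 := ih (fun (j : Fin r) (i : Fin n) => v j i.succ)
        (fun j K => ψ (v j 0) * f j (Fin.cons (L 0) K))
        (fun j => (hF j).1.comp (fun g => ψ (v j 0) * g (L 0)) (by simp)) (by
          intro K
          have h6 := congrArg (fun t => TensorProduct.lid ℂ V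
            (LinearMap.rTensor V ψ (cf (L 0) (tl t)))) (hq K)
          simp only [map_zero] at h6
          rw [← h6]
          simp only [q, map_sum]
          refine Finset.sum_congr rfl fun j _ => ?_
          have e1 := (((TensorProduct.lid ℂ V).toLinearMap ∘ₗ LinearMap.rTensor V ψ ∘ₗ
            cf (R := ℂ) (P := V ⊗[ℂ] V) (L 0)).toAddMonoidHom.comp
              (tl (P := V ⊗[ℂ] V)).toAddMonoidHom).map_finsum (hsupp j K)
          simp only [AddMonoidHom.comp_apply, LinearMap.toAddMonoidHom_coe,
            LinearMap.comp_apply, LinearEquiv.coe_coe] at e1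
          rw [e1]
          refine finsum_congr fun l => ?_
          rw [tl_tmul, cf_smul_cst, hφ]
          simp [smul_smul, mul_comm]) (Fin.tail L)
      rw [map_sum, map_sum, ← h5]
      refine Finset.sum_congr rfl fun j _ => ?_
      simp [smul_smul, mul_comm]
    have h7 := congrArg (tprodCons n) hgoal
    rw [map_zero, map_sum] at h7
    rw [← h7]
    refine Finset.sum_congr rfl fun j _ => ?_
    rw [map_smul, tprodCons_tmul]

/-- Injectivity of `ℂ((x)) ⊗ V ⊗ V → V((x))` implies non-degeneracy. -/
lemma nonDegenerate_of_Yh_injective [Nontrivial V] (hinj : Function.Injective 𝒱.Yh) :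
    𝒱.NonDegenerate := by
  intro n _ r v f hf hli h j
  funext L
  have := 𝒱.sum_tprod_eq_zero hinj 𝒱.one_ne_zero n r v f hf h L
  exact (Fintype.linearIndependent_iff.mp hli) _ this j

end NLVA

end

noncomputable section

lemma CountableDim.tensor {U V : Type*} [AddCommGroup U] [Module ℂ U] [AddCommGroup V]
    [Module ℂ V] (hU : CountableDim U) (hV : CountableDim V) : CountableDim (U ⊗[ℂ] V) := by
  obtain ⟨s, hs, hs'⟩ := hU
  obtain ⟨t, ht, ht'⟩ := hV
  refine ⟨Set.image2 (fun a b => a ⊗ₜ[ℂ] b) s t, hs.image2 ht _, ?_⟩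
  have := Submodule.map₂_span_span ℂ (TensorProduct.mk ℂ U V) s t
  rw [hs', ht', TensorProduct.map₂_mk_top_top_eq_top] at this
  exact this.symm

namespace IsTwistedTensor

variable {U V : Type*} [AddCommGroup U] [Module ℂ U] [AddCommGroup V] [Module ℂ V]
  {𝒰 : NLVA U} {𝒱 : NLVA V} {Rop : TwistingOp 𝒰 𝒱} {𝒯 : NLVA (U ⊗[ℂ] V)}

lemma Y_left (h : IsTwistedTensor 𝒰 𝒱 Rop 𝒯) (u u' : U) (v' : V) (n : ℤ) :
    𝒯.Y (u ⊗ₜ 𝒱.one) (u' ⊗ₜ v') n = 𝒰.Y u u' n ⊗ₜ v' := by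
  rw [h.2, YRcoef]
  simp only [Rop.vac_left]
  rw [finsum_eq_single _ 0 (fun c hc => by simp [hc]), finsum_eq_single _ n]
  · simp [NLVA.Yc, 𝒱.vacuum_left]
  · intro a ha
    have : n - a ≠ 0 := by omega
    simp [NLVA.Yc, 𝒱.vacuum_left, this]

lemma Y_right (h : IsTwistedTensor 𝒰 𝒱 Rop 𝒯) (v v' : V) (n : ℤ) :
    𝒯.Y (𝒰.one ⊗ₜ v) (𝒰.one ⊗ₜ v') n = 𝒰.one ⊗ₜ 𝒱.Y v v' n := by
  rw [h.2, YRcoef]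
  simp only [Rop.vac_right]
  rw [finsum_eq_single _ 0 (fun c hc => by simp [hc]), finsum_eq_single _ 0]
  · simp [NLVA.Yc, 𝒰.vacuum_left]
  · intro a ha
    simp [NLVA.Yc, 𝒰.vacuum_left, ha]

lemma selfIrreducible (h : IsTwistedTensor 𝒰 𝒱 Rop 𝒯) (hirrU : 𝒰.SelfIrreducible)
    (hcdU : CountableDim U) (hirrV : 𝒱.SelfIrreducible) : 𝒯.SelfIrreducible := by
  have : Nontrivial U := hirrU.1
  have : Nontrivial V := hirrV.1
  refine ⟨inferInstance, fun P hP => ?_⟩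
  let M : Submodule ℂ V := P.comap (TensorProduct.mk ℂ U V 𝒰.one)
  have hM : ∀ v : V, v ∈ M ↔ 𝒰.one ⊗ₜ v ∈ P := fun v => Iff.rfl
  rcases hirrV.2 M (fun v m hm n => by
    rw [hM] at hm ⊢
    rw [← h.Y_right]
    exact hP _ _ hm n) with h0 | h1
  · left
    refine (NLVA.isSimpleUnder_modes hirrU).tensor_eq_bot (M := V) hcdU P ?_ 𝒰.one
      𝒰.one_ne_zero fun m hm => ?_
    · rintro _ ⟨u, n, rfl⟩ t ht
      have key : ∀ t : U ⊗[ℂ] V, LinearMap.rTensor V (𝒰.Yc n u) t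
          = 𝒯.Y (u ⊗ₜ 𝒱.one) t n := by
        intro t
        induction t with
        | zero => simp
        | tmul a b => rw [h.Y_left]; rfl
        | add s t hs ht => rw [map_add, hs, ht, map_add]; rfl
      have := hP (u ⊗ₜ 𝒱.one) t ht n
      rw [← key] at this
      exact this
    · have : m ∈ M := hm
      rw [h0] at this
      exact this
  · right
    rw [eq_top_iff, ← TensorProduct.span_tmul_eq_top, Submodule.span_le]
    rintro _ ⟨u, v, rfl⟩
    have hv : v ∈ M := h1 ▸ Submodule.mem_top
    have := hP (u ⊗ₜ 𝒱.one) _ hv 0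
    rw [TensorProduct.mk_apply, h.Y_left, 𝒰.creation_zero] at this
    exact this

end IsTwistedTensor

end

noncomputable section

open LS

namespace LS

variable {R P Q M : Type*} [Field R] [CharZero R] [AddCommGroup P] [Module R P]
  [AddCommGroup Q] [Module R Q] [AddCommGroup M] [Module R M]

/-- Multiplication by a scalar Laurent series in the inner variable of a double series. -/
def im : LaurentSeries R →ₗ[R] Module.End R (LS R (LS R P)) where
  toFun f := (map (ml f)).restrictScalars R
  map_add' f g := LinearMap.ext fun A => ext fun n => by simp [add_smul]
  map_smul' c f := LinearMap.ext fun A => ext fun n => by simp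

lemma im_apply (f : LaurentSeries R) (A : LS R (LS R P)) : im f A = map (ml f) A := rfl

@[simp] lemma cf_im (f : LaurentSeries R) (A : LS R (LS R P)) (n : ℤ) :
    cf n (im f A) = f • cf n A := by rw [im_apply, cf_map, ml_apply]

lemma im_mul (f g : LaurentSeries R) (A : LS R (LS R P)) : im (f * g) A = im f (im g A) :=
  ext fun n => by simp [mul_smul]

lemma im_cst (f : LaurentSeries R) (B : LS R P) : im f (cst B) = cst (f • B) := by
  rw [im_apply, map_cst, ml_apply]

lemma Tm_im (f : LaurentSeries R) (A : LS R (LS R P)) :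
    Tm (im f A) = Op (fun i => ((-1 : R) ^ i) • ml (dK i f)) (Tm A) := E_neg_der_map_ml f A

lemma Tp_im (f : LaurentSeries R) (A : LS R (LS R P)) :
    Tp (im f A) = Op (fun i => ml (dK i f)) (Tp A) := E_der_map_ml f A

/-- `e^{zD}` in the outer variable commutes with inner multiplication. -/
lemma E_map_im (D : P →ₗ[R] P) (f : LaurentSeries R) (A : LS R (LS R P)) :
    E ((map D).restrictScalars R) (im f A) = im f (E ((map D).restrictScalars R) A) :=
  E_map_of_comm _ (LinearMap.ext fun B => map_smul (map D) f B) A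

lemma der_map (φ : P →ₗ[R] Q) (A : LS R P) : der (map φ A) = map φ (der A) :=
  ext fun n => by simp

lemma E_map_Tm (D : P →ₗ[R] P) (A : LS R (LS R P)) :
    E ((map D).restrictScalars R) (Tm A) = Tm (E ((map D).restrictScalars R) A) := by
  have h : ((map D).restrictScalars R : LS R P →ₗ[R] LS R P) ∘ₗ (-der)
      = (-der) ∘ₗ ((map D).restrictScalars R : LS R P →ₗ[R] LS R P) :=
    LinearMap.ext fun B => by simp [der_map]
  rw [Tm_apply, Tm_apply, ← E_add h.symm, ← E_add h, add_comm]

lemma E_map_Tp (D : P →ₗ[R] P) (A : LS R (LS R P)) :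
    E ((map D).restrictScalars R) (Tp A) = Tp (E ((map D).restrictScalars R) A) := by
  have h : ((map D).restrictScalars R : LS R P →ₗ[R] LS R P) ∘ₗ der
      = der ∘ₗ ((map D).restrictScalars R : LS R P →ₗ[R] LS R P) :=
    LinearMap.ext fun B => by simp [der_map]
  rw [Tp_apply, Tp_apply, ← E_add h.symm, ← E_add h, add_comm]

lemma E_map_Xi (D : P →ₗ[R] P) (A : LS R (LS R P)) :
    E ((map D).restrictScalars R) (Xi A) = Xi (E ((map D).restrictScalars R) A) :=
  E_map_of_comm _ (LinearMap.ext fun B => by simp [X_apply]) A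

lemma E_map_Xi_pow (D : P →ₗ[R] P) (k : ℕ) (A : LS R (LS R P)) :
    E ((map D).restrictScalars R) ((Xi ^ k) A) = (Xi ^ k) (E ((map D).restrictScalars R) A) := by
  induction k with
  | zero => simp
  | succ n ih => rw [pow_succ', Module.End.mul_apply, Module.End.mul_apply, E_map_Xi, ih]

lemma Op_X_pow (Φ : ℕ → P →ₗ[R] Q) (k : ℕ) (A : LS R P) :
    Op Φ ((X ^ k : Module.End _ (LS R P)) A) = (X ^ k : Module.End _ (LS R Q)) (Op Φ A) := by
  induction k with
  | zero => simp
  | succ n ih => rw [pow_succ', Module.End.mul_apply, X_comm_Op, ih, pow_succ',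
      Module.End.mul_apply]

lemma E_X_pow (D : P →ₗ[R] P) (k : ℕ) (A : LS R P) :
    E D ((X ^ k : Module.End _ (LS R P)) A) = (X ^ k : Module.End _ (LS R P)) (E D A) :=
  Op_X_pow _ k A

lemma sub_pow_swap (A B : Module.End R P) (k : ℕ) :
    (A - B) ^ k = ((-1 : R) ^ k) • (B - A) ^ k := by
  rw [← smul_pow, neg_one_smul R (B - A), neg_sub]

lemma expSeq_neg (D : P →ₗ[R] P) (i : ℕ) : expSeq (-D) i = ((-1 : R) ^ i) • expSeq D i := by
  rw [expSeq, expSeq, ← neg_one_smul R D, smul_pow, smul_comm]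

lemma cf_expSeq_neg_der (i : ℕ) (A : LS R P) (n : ℤ) :
    cf n (expSeq (-der) i A) = ((-1 : R) ^ i) • ((zchoose (n + i) i : ℤ) : R) • cf (n + i) A := by
  rw [expSeq_neg, LinearMap.smul_apply, ← cf_expSeq_der]; rfl

end LS

lemma scalarMulSub_cf {P : Type*} [AddCommGroup P] [Module ℂ P] (f : LaurentSeries ℂ)
    (B : LS ℂ (LS ℂ P)) (m n : ℤ) :
    scalarMulSub f.coeff (fun m n => cf n (cf m B)) m n = cf n (cf m (Tm (im f (Tp B)))) := by
  rw [Tm_im, Tm_Tp, cf_Op_finsum, scalarMulSub]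
  obtain ⟨N, hN⟩ := exists_bound B
  have hs : ∀ i : ℕ, (((-1 : ℂ) ^ i) • ml (dK i f)) (cf (m - i) B) ≠ 0 → (i : ℤ) ≤ m - N := by
    intro i h
    by_contra h'
    rw [hN _ (by omega), map_zero] at h
    exact h rfl
  have hfs : Function.HasFiniteSupport fun i : ℕ =>
      (((-1 : ℂ) ^ i) • ml (dK i f)) (cf (m - i) B) :=
    (Set.finite_le_nat (m - N).toNat).subset fun i hi => by
      have := hs i hi
      show i ≤ _
      omega
  rw [show cf n (∑ᶠ i : ℕ, (((-1 : ℂ) ^ i) • ml (dK i f)) (cf (m - i) B))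
    = ∑ᶠ i : ℕ, cf n ((((-1 : ℂ) ^ i) • ml (dK i f)) (cf (m - i) B)) from
    (cf (R := ℂ) (P := P) n).toAddMonoidHom.map_finsum hfs]
  refine finsum_congr fun i => ?_
  rw [LinearMap.smul_apply, ml_apply, map_smul, cf_smul_finsum, smul_finsum,
    ← finsum_comp_equiv (Equiv.addRight (i : ℤ))]
  refine finsum_congr fun q => ?_
  simp only [Equiv.coe_addRight]
  rw [coeff_dK, smul_smul, ← mul_assoc]
  congr 3
  omega

namespace NLVA

open KT

variable {V : Type*} [AddCommGroup V] [Module ℂ V] (𝒱 : NLVA V)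

/-- The double series `Y(v, xᵢ)Y(u, xₒ)w`. -/
def YY (w : V) : V ⊗[ℂ] V →ₗ[ℂ] LS ℂ (LS ℂ V) :=
  TensorProduct.lift (LinearMap.mk₂ ℂ (fun v u => map (𝒱.Yl v) (𝒱.Yl u w))
    (fun a b c => LS.ext fun n => by simp) (fun r a b => LS.ext fun n => by simp)
    (fun a b c => LS.ext fun n => by simp) (fun r a b => LS.ext fun n => by simp))

@[simp] lemma YY_tmul (w v u : V) : 𝒱.YY w (v ⊗ₜ u) = map (𝒱.Yl v) (𝒱.Yl u w) := by
  simp [YY]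

/-- The double series `q ↦ f(xᵢ) T Y(v, xᵢ)Y(u, xₒ)w` for `q = f ⊗ v ⊗ u`. -/
def TYY (w : V) : KT (V ⊗[ℂ] V) →ₗ[ℂ] LS ℂ (LS ℂ V) :=
  TensorProduct.lift (LinearMap.lcomp ℂ _ (Tp ∘ₗ 𝒱.YY w) ∘ₗ im)

@[simp] lemma TYY_tmul (w : V) (f : LaurentSeries ℂ) (v u : V) :
    𝒱.TYY w (f ⊗ₜ (v ⊗ₜ u)) = im f (Tp (map (𝒱.Yl v) (𝒱.Yl u w))) := by
  simp [TYY]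

/-- The skew-symmetry relation `Y(u,x)v = e^{xD} Y(-x) q(-x)`. -/
def SkewRel (u v : V) (q : KT (V ⊗[ℂ] V)) : Prop := 𝒱.Yl u v = E 𝒱.D (nu (𝒱.Yh q))

/-- The `𝒮`-locality relation
`(x₁-x₂)^k Y(u,x₁)Y(v,x₂)w = (x₁-x₂)^k Y(x₂)(1⊗Y(x₁)) q(x₂-x₁) w`. -/
def LocRel (u v w : V) (k : ℕ) (q : KT (V ⊗[ℂ] V)) : Prop :=
  Sw (((Xi - Xo) ^ k : Module.End ℂ (LS ℂ (LS ℂ V))) (map (𝒱.Yl u) (𝒱.Yl v w)))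
    (((Xo - Xi) ^ k : Module.End ℂ (LS ℂ (LS ℂ V))) (Tm (𝒱.TYY w q)))

variable {𝒱}

lemma skewRel_of_locRel {u v : V} {k : ℕ} {q : KT (V ⊗[ℂ] V)}
    (h : 𝒱.LocRel u v 𝒱.one k q) : 𝒱.SkewRel u v q := by
  set Dh : LS ℂ V →ₗ[ℂ] LS ℂ V := (map 𝒱.D).restrictScalars ℂ with hDh
  set F := 𝒱.Yh q with hF
  have hYE : ∀ a b : V, map (𝒱.Yl a) (𝒱.Yl b 𝒱.one) = Tm (E Dh (cst (𝒱.Yl a b))) := by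
    intro a b
    rw [Yl_one_right, map_Yl_E_D, map_cst]
  have hT : 𝒱.TYY 𝒱.one q = E Dh (cst F) := by
    rw [hF]
    clear hF h
    induction q using KT.induction₂ with
    | h0 => simp
    | ht f a b => rw [TYY_tmul, hYE, Tp_Tm, ← E_map_im, im_cst, Yh_tmul]
    | ha s t hs ht => simp only [map_add, hs, ht]
  rw [LocRel, hT] at h
  set G : LS ℂ V := (X ^ k : Module.End _ (LS ℂ V)) (((-1 : ℂ) ^ k) • F) with hG
  have hB : ((Xo - Xi) ^ k : Module.End ℂ (LS ℂ (LS ℂ V))) (Tm (E Dh (cst F)))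
      = E Dh (Tm (cst G)) := by
    rw [sub_pow_swap, LinearMap.smul_apply, ← Tm_Xi_pow, ← E_map_Xi_pow, Xi_pow_cst, E_map_Tm, hG,
      LinearMap.map_smul_of_tower, cst.map_smul, LinearMap.map_smul_of_tower, Tm.map_smul]
  have hC : ∀ B : LS ℂ V, Tm (E Dh (cst B)) = E (Dh + -der) (cst B) := by
    intro B
    rw [Tm_apply, E_add]
    exact LinearMap.ext fun B => by simp [hDh, der_map]
  have hA : ((Xi - Xo) ^ k : Module.End ℂ (LS ℂ (LS ℂ V))) (map (𝒱.Yl u) (𝒱.Yl v 𝒱.one))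
      = E (Dh + -der) (cst ((X ^ k : Module.End _ (LS ℂ V)) (𝒱.Yl u v))) := by
    rw [hYE, ← Tm_Xi_pow, ← E_map_Xi_pow, Xi_pow_cst, hC]
  rw [hB, hA] at h
  have h00 : ∀ B : LS ℂ V, cf 0 (E (Dh + -der) (cst B)) = B := fun B => by
    have := Op_cst (expSeq (Dh + -der)) B 0
    rw [expSeq_zero] at this
    exact this
  have hG0 : ∀ m < 0, cf m G = 0 := by
    intro m hm
    have := h m 0
    rwa [E, Op_cst_neg _ _ _ hm, map_zero, E_map_Tm, hC, h00, eq_comm] at this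
  have hnu : map (cf 0) (Tm (cst G)) = nu G := by
    refine LS.ext fun n => ?_
    rw [cf_map, cf_nu]
    rcases lt_or_ge n 0 with hn | hn
    · rw [Tm_apply, E, Op_cst_neg _ _ _ hn, map_zero, hG0 n hn, smul_zero]
    · lift n to ℕ using hn
      rw [Tm_apply, E, Op_cst, cf_expSeq_neg_der, zero_add, zchoose_natCast]
      simp
  have hfin : (X ^ k : Module.End _ (LS ℂ V)) (𝒱.Yl u v) = E 𝒱.D (nu G) := by
    refine LS.ext fun n => ?_
    have := h 0 n
    rw [h00] at this
    rw [this, ← hnu, E_map_of_comm (D := Dh) (cf 0) (LinearMap.ext fun B => by simp [hDh]), cf_map]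
  apply X_pow_injective k
  rw [hfin, hG]
  have hX : ∀ (j : ℕ) (B : LS ℂ V), nu ((X ^ j : Module.End _ (LS ℂ V)) B)
      = ((-1 : ℂ) ^ j) • (X ^ j : Module.End _ (LS ℂ V)) (nu B) := by
    intro j B
    refine LS.ext fun n => ?_
    rw [cf_nu, cf_X_pow, map_smul, cf_X_pow, cf_nu, smul_smul, ← zpow_natCast,
      ← zpow_add₀ (by norm_num)]
    congr 2; omega
  rw [hX, nu.map_smul, LinearMap.map_smul_of_tower, LinearMap.map_smul_of_tower,
    LinearMap.map_smul_of_tower, smul_smul, ← mul_pow, neg_one_mul, neg_neg, one_pow, one_smul, E_X_pow]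

end NLVA

end

noncomputable section

namespace LS

section Nu

variable {R P : Type*} [Field R] [CharZero R] [AddCommGroup P] [Module R P]

lemma coeff_nuK (f : LaurentSeries R) (n : ℤ) : (nuK f).coeff n = (-1) ^ n * f.coeff n := rfl

lemma nuK_nuK (f : LaurentSeries R) : nuK (nuK f) = f := by
  ext n
  rw [coeff_nuK, coeff_nuK, ← mul_assoc, neg_one_zpow_mul_self, one_mul]

lemma nu_smul (f : LaurentSeries R) (A : LS R P) : nu (f • A) = nuK f • nu A := by
  refine ext fun n => ?_
  obtain ⟨N, hN⟩ := exists_bound_coeff f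
  obtain ⟨N', hN'⟩ := exists_bound A
  rw [cf_nu, cf_smul f A n N (n - N' + 1) hN fun q hq => hN' q (by omega),
    cf_smul (nuK f) (nu A) n N (n - N' + 1) (fun p hp => by rw [coeff_nuK, hN p hp, mul_zero])
      (fun q hq => by rw [cf_nu, hN' q (by omega), smul_zero]), Finset.smul_sum]
  refine Finset.sum_congr rfl fun p _ => ?_
  rw [coeff_nuK, cf_nu, smul_smul, smul_smul]
  congr 1
  rw [mul_right_comm, ← zpow_add₀ (by simp)]
  congr 2; omega

end Nu

section Prod

variable {P Q : Type*} [AddCommGroup P] [Module ℂ P] [AddCommGroup Q] [Module ℂ Q]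

/-- The product of Laurent series with values in a tensor product. -/
def pr (A : LS ℂ P) (B : LS ℂ Q) : LS ℂ (P ⊗[ℂ] Q) :=
  mk (fun n => ∑ᶠ a : ℤ, cf a A ⊗ₜ cf (n - a) B) (by
    obtain ⟨N, hN⟩ := exists_bound A
    obtain ⟨M, hM⟩ := exists_bound B
    refine ⟨N + M, fun n hn => finsum_eq_zero_of_forall_eq_zero fun a => ?_⟩
    rcases lt_or_ge a N with h | h
    · rw [hN a h, TensorProduct.zero_tmul]
    · rw [hM _ (by omega), TensorProduct.tmul_zero])

lemma cf_pr (A : LS ℂ P) (B : LS ℂ Q) (n : ℤ) :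
    cf n (pr A B) = ∑ᶠ a : ℤ, cf a A ⊗ₜ cf (n - a) B := rfl

lemma pr_finite (A : LS ℂ P) (B : LS ℂ Q) (n : ℤ) :
    Function.HasFiniteSupport fun a : ℤ => cf a A ⊗ₜ[ℂ] cf (n - a) B := by
  obtain ⟨N, hN⟩ := exists_bound A
  obtain ⟨M, hM⟩ := exists_bound B
  refine (Set.finite_Icc N (n - M)).subset fun a ha => ?_
  by_contra h
  rw [Set.mem_Icc, not_and_or] at h
  apply ha
  rcases h with h | h
  · show cf a A ⊗ₜ[ℂ] cf (n - a) B = 0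
    rw [hN a (by omega), TensorProduct.zero_tmul]
  · show cf a A ⊗ₜ[ℂ] cf (n - a) B = 0
    rw [hM (n - a) (by omega), TensorProduct.tmul_zero]

lemma pr_eq_left (A : LS ℂ P) (B : LS ℂ Q) (N : ℤ) (hN : ∀ m < N, cf m A = 0) :
    pr A B = (HahnSeries.single N 1 : LaurentSeries ℂ) •
      Op (fun i => TensorProduct.mk ℂ P Q (cf (N + i) A)) B := by
  refine ext fun n => ?_
  obtain ⟨M, hM⟩ := exists_bound B
  rw [cf_single_smul, one_smul, cf_pr, cf_Op _ B (n - N) M ((n - N - M).natAbs + 1) hM (by omega),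
    finsum_int_eq_sum_Ico N (N + ((n - N - M).natAbs + 1 : ℕ)), Int.Ico_eq_finset_map]
  · rw [add_sub_cancel_left, Int.toNat_natCast, Finset.sum_map]
    refine Finset.sum_congr rfl fun i _ => ?_
    simp [add_comm, sub_sub]
  · intro i hi; rw [hN i hi, TensorProduct.zero_tmul]
  · intro i hi; rw [hM _ (by omega), TensorProduct.tmul_zero]

lemma pr_eq_right (A : LS ℂ P) (B : LS ℂ Q) (N : ℤ) (hN : ∀ m < N, cf m B = 0) :
    pr A B = (HahnSeries.single N 1 : LaurentSeries ℂ) •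
      Op (fun i => (TensorProduct.mk ℂ P Q).flip (cf (N + i) B)) A := by
  refine ext fun n => ?_
  obtain ⟨M, hM⟩ := exists_bound A
  rw [cf_single_smul, one_smul, cf_pr, cf_Op _ A (n - N) M ((n - N - M).natAbs + 1) hM (by omega),
    ← finsum_comp_equiv (Equiv.subLeft n),
    finsum_int_eq_sum_Ico N (N + ((n - N - M).natAbs + 1 : ℕ)), Int.Ico_eq_finset_map]
  · rw [add_sub_cancel_left, Int.toNat_natCast, Finset.sum_map]
    refine Finset.sum_congr rfl fun i _ => ?_
    simp [add_comm, sub_sub]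
  · intro i hi
    rw [Equiv.subLeft_apply, sub_sub_cancel, hN i hi, TensorProduct.tmul_zero]
  · intro i hi
    rw [Equiv.subLeft_apply, hM _ (by omega), TensorProduct.zero_tmul]

lemma pr_smul_right (f : LaurentSeries ℂ) (A : LS ℂ P) (B : LS ℂ Q) :
    pr A (f • B) = f • pr A B := by
  obtain ⟨N, hN⟩ := exists_bound A
  rw [pr_eq_left A _ N hN, pr_eq_left A _ N hN, map_smul]
  exact (LinearMap.lsmul (LaurentSeries ℂ) (LS ℂ (P ⊗[ℂ] Q)) (HahnSeries.single N 1)).map_smul f _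

lemma pr_add_right (A : LS ℂ P) (B B' : LS ℂ Q) : pr A (B + B') = pr A B + pr A B' := by
  obtain ⟨N, hN⟩ := exists_bound A
  rw [pr_eq_left A _ N hN, pr_eq_left A _ N hN, pr_eq_left A _ N hN, map_add, smul_add]

lemma pr_smul_left (f : LaurentSeries ℂ) (A : LS ℂ P) (B : LS ℂ Q) :
    pr (f • A) B = f • pr A B := by
  obtain ⟨N, hN⟩ := exists_bound B
  rw [pr_eq_right _ B N hN, pr_eq_right A _ N hN, map_smul]
  exact (LinearMap.lsmul (LaurentSeries ℂ) (LS ℂ (P ⊗[ℂ] Q)) (HahnSeries.single N 1)).map_smul f _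

lemma pr_add_left (A A' : LS ℂ P) (B : LS ℂ Q) : pr (A + A') B = pr A B + pr A' B := by
  obtain ⟨N, hN⟩ := exists_bound B
  rw [pr_eq_right _ B N hN, pr_eq_right A _ N hN, pr_eq_right A' _ N hN, map_add, smul_add]

/-- `pr` as a bilinear map. -/
def prL : LS ℂ P →ₗ[LaurentSeries ℂ] LS ℂ Q →ₗ[LaurentSeries ℂ] LS ℂ (P ⊗[ℂ] Q) :=
  LinearMap.mk₂ _ pr pr_add_left pr_smul_left pr_add_right pr_smul_right

@[simp] lemma prL_apply (A : LS ℂ P) (B : LS ℂ Q) : prL A B = pr A B := rfl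

lemma nu_pr (A : LS ℂ P) (B : LS ℂ Q) : nu (pr A B) = pr (nu A) (nu B) := by
  refine ext fun n => ?_
  rw [cf_nu, cf_pr, cf_pr, smul_finsum]
  refine finsum_congr fun a => ?_
  rw [cf_nu, cf_nu, TensorProduct.smul_tmul_smul, ← zpow_add₀ (by simp), add_sub_cancel]

lemma Op_comm_pr {Φ : ℕ → P →ₗ[ℂ] Q} {D : P →ₗ[ℂ] P} {D' : Q →ₗ[ℂ] Q}
    (h : ∀ i, D' ∘ₗ Φ i = Φ i ∘ₗ D) (A : LS ℂ P) : E D' (Op Φ A) = Op Φ (E D A) := by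
  rw [E, E, Op_Op, Op_Op]
  congr 2
  funext n
  rw [conv, conv, ← Finset.sum_equiv (Equiv.prodComm ℕ ℕ)]
  · intro i; simp [add_comm]
  · rintro ⟨i, j⟩ -
    have h' : ∀ k i, (D' ^ k) ∘ₗ Φ i = Φ i ∘ₗ (D ^ k) := by
      intro k i
      induction k with
      | zero => rfl
      | succ k ih =>
        rw [pow_succ, pow_succ, Module.End.mul_eq_comp, Module.End.mul_eq_comp,
          LinearMap.comp_assoc, h, ← LinearMap.comp_assoc, ih, LinearMap.comp_assoc]
    simp only [expSeq, Equiv.prodComm_apply, Prod.swap_prod_mk]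
    rw [LinearMap.smul_comp, LinearMap.comp_smul, h']

lemma E_rTensor_pr (D : P →ₗ[ℂ] P) (A : LS ℂ P) (B : LS ℂ Q) :
    E (LinearMap.rTensor Q D) (pr A B) = pr (E D A) B := by
  obtain ⟨N, hN⟩ := exists_bound B
  rw [pr_eq_right _ B N hN, pr_eq_right _ B N hN, map_smul, Op_comm_pr (D := D)]
  intro i
  ext; simp

lemma E_lTensor_pr (D : Q →ₗ[ℂ] Q) (A : LS ℂ P) (B : LS ℂ Q) :
    E (LinearMap.lTensor P D) (pr A B) = pr A (E D B) := by
  obtain ⟨N, hN⟩ := exists_bound A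
  rw [pr_eq_left A _ N hN, pr_eq_left A _ N hN, map_smul, Op_comm_pr (D := D)]
  intro i
  ext; simp

lemma E_pr (D : P →ₗ[ℂ] P) (D' : Q →ₗ[ℂ] Q) (A : LS ℂ P) (B : LS ℂ Q) :
    E (LinearMap.rTensor Q D + LinearMap.lTensor P D') (pr A B) = pr (E D A) (E D' B) := by
  rw [E_add, E_rTensor_pr, E_lTensor_pr]
  rw [LinearMap.rTensor_comp_lTensor, LinearMap.lTensor_comp_rTensor]

end Prod

end LS

open LS

namespace KT

variable {A B P Q : Type*} [AddCommGroup P] [Module ℂ P] [AddCommGroup Q] [Module ℂ Q]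
  [AddCommGroup A] [Module ℂ A] [AddCommGroup B] [Module ℂ B]

lemma cf_ev' (φ : P →ₗ[ℂ] LS ℂ Q) (t : KT P) (n : ℤ) :
    (Function.HasFiniteSupport fun c : ℤ => cf (n - c) (φ (cf c (tl t)))) ∧
    cf n (ev φ t) = ∑ᶠ c : ℤ, cf (n - c) (φ (cf c (tl t))) := by
  induction t using KT.induction₁ with
  | h0 =>
    simp only [map_zero, finsum_zero, and_true]
    exact Set.finite_empty.subset fun x hx => hx rfl
  | ht f p =>
    simp only [tl_tmul, cf_smul_cst, map_smul, ev_tmul]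
    refine ⟨?_, cf_smul_finsum f (φ p) n⟩
    obtain ⟨N, hN⟩ := exists_bound_coeff f
    obtain ⟨M, hM⟩ := exists_bound (φ p)
    refine (Set.finite_Icc N (n - M)).subset fun a ha => ?_
    by_contra h
    rw [Set.mem_Icc, not_and_or] at h
    apply ha
    rcases h with h | h
    · show f.coeff a • _ = _
      rw [hN a (by omega), zero_smul]
    · show f.coeff a • cf _ (φ p) = _
      rw [hM _ (by omega), smul_zero]
  | ha s t hs ht =>
    simp only [map_add]
    refine ⟨hs.1.add ht.1, ?_⟩
    rw [finsum_add_distrib hs.1 ht.1, hs.2, ht.2]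

lemma cf_ev (φ : P →ₗ[ℂ] LS ℂ Q) (t : KT P) (n : ℤ) :
    cf n (ev φ t) = ∑ᶠ c : ℤ, cf (n - c) (φ (cf c (tl t))) := (cf_ev' φ t n).2

/-- The `ℂ((x))`-linear extension of a map with values in `ℂ((x)) ⊗ B`. -/
def hat (φ : A →ₗ[ℂ] KT B) : KT A →ₗ[LaurentSeries ℂ] KT B :=
  φ.liftBaseChange (LaurentSeries ℂ)

@[simp] lemma hat_tmul (φ : A →ₗ[ℂ] KT B) (f : LaurentSeries ℂ) (a : A) :
    hat φ (f ⊗ₜ a) = f • φ a := by simp [hat]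

lemma tl_hat (φ : A →ₗ[ℂ] KT B) (t : KT A) :
    tl (hat φ t) = ev (tl.restrictScalars ℂ ∘ₗ φ) t := by
  induction t using KT.induction₁ with
  | h0 => simp
  | ht f p => simp
  | ha s t hs ht => simp only [map_add, hs, ht]

/-- The map into `ℂ((x)) ⊗ B` with a given coefficient family. -/
def ofFam (Φ : ℤ → (A →ₗ[ℂ] B)) (h : ∀ t, IsTensorLaurent fun n => Φ n t) : A →ₗ[ℂ] KT B where
  toFun t := (exists_tl _ (h t)).choose
  map_add' s t := tl_injective (LS.ext fun n => by
    rw [map_add, map_add, (exists_tl _ (h _)).choose_spec, (exists_tl _ (h s)).choose_spec,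
      (exists_tl _ (h t)).choose_spec, map_add])
  map_smul' c t := tl_injective (LS.ext fun n => by
    rw [RingHom.id_apply, LinearMap.map_smul_of_tower, map_smul,
      (exists_tl _ (h _)).choose_spec, (exists_tl _ (h t)).choose_spec, map_smul])

lemma cf_tl_ofFam (Φ : ℤ → (A →ₗ[ℂ] B)) (h : ∀ t, IsTensorLaurent fun n => Φ n t) (t : A) (n : ℤ) :
    cf n (tl (ofFam Φ h t)) = Φ n t := (exists_tl _ (h t)).choose_spec n

lemma exists_fin_sum (q : KT (P ⊗[ℂ] Q)) : ∃ (r : ℕ) (F : Fin r → LaurentSeries ℂ)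
    (a : Fin r → P) (b : Fin r → Q), q = ∑ i, F i ⊗ₜ (a i ⊗ₜ b i) := by
  induction q using KT.induction₂ with
  | h0 => exact ⟨0, Fin.elim0, Fin.elim0, Fin.elim0, by simp⟩
  | ht f u v => exact ⟨1, fun _ => f, fun _ => u, fun _ => v, by simp⟩
  | ha s t hs ht =>
    obtain ⟨r, F, a, b, rfl⟩ := hs
    obtain ⟨r', F', a', b', rfl⟩ := ht
    refine ⟨r + r', Fin.append F F', Fin.append a a', Fin.append b b', ?_⟩
    simp [Fin.sum_univ_add]

end KT

namespace NLVA

open KT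

variable {V : Type*} [AddCommGroup V] [Module ℂ V] {𝒱 : NLVA V}

lemma mulSubPow_TYY {r : ℕ} (F : Fin r → LaurentSeries ℂ) (vv uu : Fin r → V) (k : ℕ) (w : V)
    (m n : ℤ) :
    mulSubPow k (fun a b => ∑ i, scalarMulSub (F i).coeff
      (fun a' b' => 𝒱.Y (vv i) (𝒱.Y (uu i) w a') b') a b) m n
    = cf n (cf m (((Xo - Xi) ^ k : Module.End ℂ (LS ℂ (LS ℂ V)))
        (Tm (𝒱.TYY w (∑ i, F i ⊗ₜ (vv i ⊗ₜ uu i)))))) := by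
  rw [← mulSubPow_cf']
  congr 1
  funext a b
  rw [map_sum, map_sum, map_sum, map_sum]
  refine Finset.sum_congr rfl fun i _ => ?_
  rw [TYY_tmul, ← scalarMulSub_cf]
  congr 1
  funext a b
  rw [cf_map]; rfl

lemma mulSubPow_Y (u v w : V) (k : ℕ) (m n : ℤ) :
    mulSubPow k (fun a b => 𝒱.Y u (𝒱.Y v w b) a) m n
    = cf m (cf n (((Xi - Xo) ^ k : Module.End ℂ (LS ℂ (LS ℂ V)))
        (map (𝒱.Yl u) (𝒱.Yl v w)))) := by
  rw [← mulSubPow_cf]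
  congr 1
  funext a b
  rw [cf_map]; rfl

lemma exists_locRel (h : SLocal 𝒱) (u v : V) : ∃ k q, ∀ w, 𝒱.LocRel u v w k q := by
  obtain ⟨r, uu, vv, f, k, hf, hl⟩ := h u v
  have hF : ∀ i, ∃ F : LaurentSeries ℂ, F.coeff = f i := fun i => by
    obtain ⟨N, hN⟩ := hf i
    exact ⟨(HahnModule.of ℂ).symm (LS.mk (R := ℂ) (f i) ⟨N, hN⟩), rfl⟩
  choose F hF using hF
  refine ⟨k, ∑ i, F i ⊗ₜ (vv i ⊗ₜ uu i), fun w n m => ?_⟩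
  rw [← mulSubPow_TYY, ← mulSubPow_Y, hl]
  simp only [hF]

lemma sLocal_of_locRel (h : ∀ u v, ∃ k q, ∀ w, 𝒱.LocRel u v w k q) : SLocal 𝒱 := by
  intro u v
  obtain ⟨k, q, hq⟩ := h u v
  obtain ⟨r, F, a, b, rfl⟩ := exists_fin_sum q
  refine ⟨r, b, a, fun i => (F i).coeff, k, fun i => exists_bound_coeff _, fun w m n => ?_⟩
  rw [mulSubPow_TYY, mulSubPow_Y]
  exact hq w n m

lemma exists_skewRel (h : SLocal 𝒱) (u v : V) : ∃ q, 𝒱.SkewRel u v q := by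
  obtain ⟨k, q, hq⟩ := exists_locRel h u v
  exact ⟨q, skewRel_of_locRel (hq _)⟩

end NLVA

end

noncomputable section

open LS KT

namespace IsTwistedTensor

variable {U V : Type*} [AddCommGroup U] [Module ℂ U] [AddCommGroup V] [Module ℂ V]
  {𝒰 : NLVA U} {𝒱 : NLVA V} {Rop : TwistingOp 𝒰 𝒱} {𝒯 : NLVA (U ⊗[ℂ] V)}

lemma D_eq (h : IsTwistedTensor 𝒰 𝒱 Rop 𝒯) :
    𝒯.D = LinearMap.rTensor V 𝒰.D + LinearMap.lTensor U 𝒱.D := by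
  ext u v
  change 𝒯.Y (u ⊗ₜ v) 𝒯.one 1 = 𝒰.Y u 𝒰.one 1 ⊗ₜ v + u ⊗ₜ 𝒱.Y v 𝒱.one 1
  rw [h.1, h.2, YRcoef]
  simp only [Rop.vac_right]
  rw [finsum_eq_single _ 0 (fun c hc => by simp [hc]), finsum_int_eq_sum_Ico 0 2]
  · rw [show Finset.Ico (0 : ℤ) 2 = {0, 1} from rfl, Finset.sum_pair (by decide)]
    simp [NLVA.Yc, 𝒰.creation_zero, 𝒱.creation_zero, add_comm]
  · intro i hi
    simp [NLVA.Yc, 𝒰.creation_reg u i hi]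
  · intro i hi
    simp [NLVA.Yc, 𝒱.creation_reg v (1 - i) (by omega)]

variable (𝒰 𝒱) in
/-- The map `a ⊗ b ↦ Y(u,x)a ⊗ Y(b,x)v`. -/
def sand (u : U) (v : V) : U ⊗[ℂ] V →ₗ[ℂ] LS ℂ (U ⊗[ℂ] V) :=
  TensorProduct.lift (LinearMap.mk₂ ℂ (fun a b => pr (𝒰.Yl u a) (𝒱.Yl b v))
    (fun a b c => by rw [map_add, pr_add_left])
    (fun r a b => by
      rw [map_smul, ← prL_apply, LinearMap.map_smul_of_tower, LinearMap.smul_apply, prL_apply])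
    (fun a b c => by rw [map_add, LinearMap.add_apply, pr_add_right])
    (fun r a b => by
      rw [map_smul, LinearMap.smul_apply, ← prL_apply, LinearMap.map_smul_of_tower, prL_apply]))

@[simp] lemma sand_tmul (u : U) (v : V) (a : U) (b : V) :
    sand 𝒰 𝒱 u v (a ⊗ₜ b) = pr (𝒰.Yl u a) (𝒱.Yl b v) := by simp [sand]

lemma cf_sand (u : U) (v : V) (n : ℤ) (t : U ⊗[ℂ] V) :
    cf n (sand 𝒰 𝒱 u v t)
      = ∑ᶠ a : ℤ, TensorProduct.map (𝒰.Yc a u) ((𝒱.Yc (n - a)).flip v) t := by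
  have key : (Function.HasFiniteSupport fun a : ℤ =>
      TensorProduct.map (𝒰.Yc a u) ((𝒱.Yc (n - a)).flip v) t) ∧ cf n (sand 𝒰 𝒱 u v t)
      = ∑ᶠ a : ℤ, TensorProduct.map (𝒰.Yc a u) ((𝒱.Yc (n - a)).flip v) t := by
    induction t with
    | zero =>
      simp only [map_zero, finsum_zero, and_true]
      exact Set.finite_empty.subset fun x hx => hx rfl
    | tmul a b =>
      rw [sand_tmul]
      exact ⟨pr_finite (𝒰.Yl u a) (𝒱.Yl b v) n, cf_pr _ _ _⟩
    | add s t hs ht =>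
      simp only [map_add]
      refine ⟨hs.1.add ht.1, ?_⟩
      rw [finsum_add_distrib hs.1 ht.1, hs.2, ht.2]
  exact key.2

/-- The twisting operator as a map into `ℂ((x)) ⊗ (U ⊗ V)`. -/
def _root_.TwistingOp.Rh (Rop : TwistingOp 𝒰 𝒱) : V ⊗[ℂ] U →ₗ[ℂ] KT (U ⊗[ℂ] V) :=
  ofFam Rop.Rc Rop.laurent

lemma nu_Yl (h : IsTwistedTensor 𝒰 𝒱 Rop 𝒯) (u u' : U) (v v' : V) :
    nu (𝒯.Yl (u ⊗ₜ v) (u' ⊗ₜ v')) = ev (nu ∘ₗ sand 𝒰 𝒱 u v') (Rop.Rh (v ⊗ₜ u')) := by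
  refine LS.ext fun n => ?_
  rw [cf_ev, cf_nu, NLVA.cf_Yl, h.2, YRcoef, smul_finsum]
  refine finsum_congr fun c => ?_
  rw [TwistingOp.Rh, cf_tl_ofFam, LinearMap.comp_apply, cf_nu, cf_sand, smul_finsum, smul_finsum]
  refine finsum_congr fun a => ?_
  rw [smul_smul]
  congr 1
  rw [zpow_sub₀ (by simp), eq_div_iff (zpow_ne_zero _ (by simp)), mul_assoc,
    LS.neg_one_zpow_mul_self, mul_one]

lemma exists_Rh_eq {Sc : ℤ → (U ⊗[ℂ] V →ₗ[ℂ] V ⊗[ℂ] U)} (hinv : IsInvPair Rop.Rc Sc)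
    (t : U ⊗[ℂ] V) : ∃ g, hat Rop.Rh g = 1 ⊗ₜ t := by
  obtain ⟨g, hg⟩ := exists_tl _ (hinv.1 t)
  refine ⟨g, tl_injective (LS.ext fun n => ?_)⟩
  rw [tl_hat, cf_ev, tl_tmul, one_smul, cf_cst, ← hinv.2.2, ← finsum_comp_equiv (Equiv.subLeft n)]
  refine finsum_congr fun c => ?_
  rw [Equiv.subLeft_apply, sub_sub_cancel, hg]
  exact cf_tl_ofFam _ _ _ _

/-- The embedding `g ⊗ (v ⊗ u) ↦ g(-x) ⊗ ((a ⊗ v) ⊗ (u ⊗ d))`. -/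
def insertMid (a : U) (d : V) :
    KT (V ⊗[ℂ] U) →ₗ[ℂ] KT ((U ⊗[ℂ] V) ⊗[ℂ] (U ⊗[ℂ] V)) :=
  TensorProduct.map
    { (LS.nuK : LaurentSeries ℂ →+* LaurentSeries ℂ).toAddMonoidHom with
      map_smul' := fun c f => by
        ext n
        change (LS.nuK (c • f)).coeff n = (c • LS.nuK f).coeff n
        rw [HahnSeries.coeff_smul, coeff_nuK, coeff_nuK, HahnSeries.coeff_smul, smul_eq_mul,
          smul_eq_mul, mul_left_comm] }
    (TensorProduct.map (TensorProduct.mk ℂ U V a) ((TensorProduct.mk ℂ U V).flip d))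

lemma insertMid_tmul (a : U) (d : V) (f : LaurentSeries ℂ) (v : V) (u : U) :
    insertMid a d (f ⊗ₜ (v ⊗ₜ u)) = LS.nuK f ⊗ₜ ((a ⊗ₜ v) ⊗ₜ (u ⊗ₜ d)) := rfl

lemma nu_Yh_insertMid (h : IsTwistedTensor 𝒰 𝒱 Rop 𝒯) (a : U) (d : V) (g : KT (V ⊗[ℂ] U)) :
    nu (𝒯.Yh (insertMid a d g)) = ev (nu ∘ₗ sand 𝒰 𝒱 a d) (hat Rop.Rh g) := by
  induction g using KT.induction₂ with
  | h0 => simp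
  | ht f v u =>
    rw [insertMid_tmul, NLVA.Yh_tmul, nu_smul, nuK_nuK, h.nu_Yl, hat_tmul, map_smul]
  | ha s t hs ht => simp only [map_add, hs, ht]

lemma pr_mem_range (h : IsTwistedTensor 𝒰 𝒱 Rop 𝒯) {Sc : ℤ → (U ⊗[ℂ] V →ₗ[ℂ] V ⊗[ℂ] U)}
    (hinv : IsInvPair Rop.Rc Sc) (p : KT (U ⊗[ℂ] U)) (s : KT (V ⊗[ℂ] V)) :
    pr (𝒰.Yh p) (𝒱.Yh s) ∈ LinearMap.range 𝒯.Yh := by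
  induction p using KT.induction₂ with
  | h0 => rw [map_zero, ← prL_apply, map_zero, LinearMap.zero_apply]; exact Submodule.zero_mem _
  | ht f a b =>
    rw [NLVA.Yh_tmul, pr_smul_left]
    refine Submodule.smul_mem _ _ ?_
    induction s using KT.induction₂ with
    | h0 => rw [map_zero, ← prL_apply, map_zero]; exact Submodule.zero_mem _
    | ht g c d =>
      rw [NLVA.Yh_tmul, pr_smul_right]
      refine Submodule.smul_mem _ _ ?_
      obtain ⟨r, hr⟩ := exists_Rh_eq hinv (b ⊗ₜ c)
      refine ⟨insertMid a d r, ?_⟩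
      rw [← nu_nu (𝒯.Yh _), h.nu_Yh_insertMid, hr, ev_tmul, one_smul, LinearMap.comp_apply,
        nu_nu, sand_tmul]
    | ha s t hs ht => rw [map_add, pr_add_right]; exact Submodule.add_mem _ hs ht
  | ha s t hs ht => rw [map_add, pr_add_left]; exact Submodule.add_mem _ hs ht

lemma exists_skewRel (h : IsTwistedTensor 𝒰 𝒱 Rop 𝒯) {Sc : ℤ → (U ⊗[ℂ] V →ₗ[ℂ] V ⊗[ℂ] U)}
    (hinv : IsInvPair Rop.Rc Sc) (hU : ∀ a b, ∃ q, 𝒰.SkewRel a b q)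
    (hV : ∀ a b, ∃ q, 𝒱.SkewRel a b q) (s t : U ⊗[ℂ] V) : ∃ q, 𝒯.SkewRel s t q := by
  suffices hs : 𝒯.Yl s t ∈ ((LinearMap.range 𝒯.Yh).restrictScalars ℂ).map
      (((E 𝒯.D).restrictScalars ℂ) ∘ₗ nu) by
    obtain ⟨_, ⟨q, rfl⟩, hq⟩ := hs
    exact ⟨q, hq.symm⟩
  induction s with
  | zero => rw [map_zero]; exact Submodule.zero_mem _
  | add a b ha hb => rw [map_add, LinearMap.add_apply]; exact Submodule.add_mem _ ha hb
  | tmul u v =>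
    induction t with
    | zero => rw [map_zero]; exact Submodule.zero_mem _
    | add a b ha hb => rw [map_add]; exact Submodule.add_mem _ ha hb
    | tmul u' v' =>
      refine ⟨E 𝒯.D (ev (nu ∘ₗ sand 𝒰 𝒱 u v') (Rop.Rh (v ⊗ₜ u'))), ?_, ?_⟩
      · generalize Rop.Rh (v ⊗ₜ u') = ρ
        change _ ∈ LinearMap.range 𝒯.Yh
        induction ρ using KT.induction₂ with
        | h0 => rw [map_zero, map_zero]; exact Submodule.zero_mem _
        | ha s t hs ht => rw [map_add, map_add]; exact Submodule.add_mem _ hs ht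
        | ht f a b =>
          obtain ⟨p, hp⟩ := hU u a
          obtain ⟨r, hr⟩ := hV b v'
          rw [ev_tmul, map_smul, LinearMap.comp_apply, sand_tmul, hp, hr, ← E_pr, ← h.D_eq,
            nu_E, E_E_neg, nu_pr, nu_nu, nu_nu]
          exact Submodule.smul_mem _ _ (h.pr_mem_range hinv p r)
      · rw [← h.nu_Yl, LinearMap.comp_apply, nu_E, nu_nu]
        exact E_E_neg _ _

end IsTwistedTensor

end

noncomputable section

open LS

namespace LS

variable {R P : Type*} [Field R] [CharZero R] [AddCommGroup P] [Module R P]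

lemma cf_cf_Op_eq_zero {Φ : ℕ → LS R P →ₗ[R] LS R P} {A : LS R (LS R P)} {m n : ℤ}
    (h : ∀ i : ℕ, cf n (Φ i (cf (m - i) A)) = 0) : cf n (cf m (Op Φ A)) = 0 := by
  obtain ⟨N, hN⟩ := exists_bound A
  rw [cf_Op Φ A m N (m - N + 1).toNat hN (by omega), map_sum]
  exact Finset.sum_eq_zero fun i _ => h i

/-- A double series without negative powers in either variable. -/
def Bireg (B : LS R (LS R P)) : Prop := ∀ m n : ℤ, m < 0 ∨ n < 0 → cf n (cf m B) = 0

lemma zchoose_mul_eq_zero {B : LS R (LS R P)} (hB : Bireg B) (i : ℕ) (m n : ℤ) (hn : n < 0) :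
    ((zchoose (n + i) i : ℤ) : R) • cf (n + i) (cf m B) = 0 := by
  rcases lt_or_ge (n + i) 0 with h | h
  · rw [hB m _ (Or.inr h), smul_zero]
  · rw [zchoose_eq_zero h (by omega), Int.cast_zero, zero_smul]

lemma Bireg.Tp {B : LS R (LS R P)} (hB : Bireg B) : Bireg (Tp B) := by
  intro m n hmn
  rw [Tp_apply]
  refine cf_cf_Op_eq_zero fun i => ?_
  rw [cf_expSeq_der]
  rcases hmn with hm | hn
  · rw [hB _ _ (Or.inl (by omega)), smul_zero]
  · exact zchoose_mul_eq_zero hB i _ n hn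

lemma Bireg.Tm {B : LS R (LS R P)} (hB : Bireg B) : Bireg (Tm B) := by
  intro m n hmn
  rw [Tm_apply]
  refine cf_cf_Op_eq_zero fun i => ?_
  rw [cf_expSeq_neg_der]
  rcases hmn with hm | hn
  · rw [hB _ _ (Or.inl (by omega)), smul_zero, smul_zero]
  · rw [zchoose_mul_eq_zero hB i _ n hn, smul_zero]

lemma Bireg.nu {B : LS R (LS R P)} (hB : Bireg B) : Bireg (nu B) := fun m n h => by
  rw [cf_nu, map_smul, hB m n h, smul_zero]

lemma Bireg.smul (c : R) {B : LS R (LS R P)} (hB : Bireg B) : Bireg (c • B) := fun m n h => by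
  rw [map_smul, map_smul, hB m n h, smul_zero]

/-- Exchange of the two variables of a double power series. -/
def swp : LS R (LS R P) →ₗ[R] LS R (LS R P) where
  toFun B := mk (fun m => mk (fun n => if 0 ≤ m ∧ 0 ≤ n then cf m (cf n B) else 0)
      ⟨0, fun n hn => if_neg (by omega)⟩)
    ⟨0, fun m hm => ext fun n => if_neg (by omega)⟩
  map_add' A B := ext fun m => ext fun n => by
    rw [map_add, map_add]
    simp only [cf_mk, map_add]
    split_ifs <;> simp
  map_smul' c A := ext fun m => ext fun n => by
    rw [map_smul, map_smul]
    simp only [cf_mk, map_smul, RingHom.id_apply]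
    split_ifs <;> simp

lemma cf_swp (B : LS R (LS R P)) (m n : ℤ) :
    cf n (cf m (swp B)) = if 0 ≤ m ∧ 0 ≤ n then cf m (cf n B) else 0 := rfl

lemma Bireg.sw {B : LS R (LS R P)} (hB : Bireg B) : Sw B (swp B) := fun m n => by
  rw [cf_swp]
  split_ifs with h
  · rfl
  · exact hB _ _ (by omega)

lemma Bireg.swp_eq {B C : LS R (LS R P)} (hB : Bireg B) (h : Sw B C) : swp B = C :=
  Sw.eq hB.sw h

lemma nu_Xo_pow (k : ℕ) (A : LS R (LS R P)) : nu ((Xo ^ k) A) = ((-1 : R) ^ k) • (Xo ^ k) (nu A) :=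
  ext fun n => by
    rw [map_smul, cf_nu, cf_Xo_pow, cf_Xo_pow, cf_nu, smul_smul, ← zpow_natCast,
      ← zpow_add₀ (by simp)]
    congr 2
    ring

lemma nu_Xi (A : LS R (LS R P)) : nu (Xi A) = Xi (nu A) := ext fun n => by
  rw [cf_nu, cf_Xi, cf_Xi, cf_nu, LinearMap.map_smul_of_tower]

lemma nu_Xi_pow (k : ℕ) (A : LS R (LS R P)) : nu ((Xi ^ k) A) = (Xi ^ k) (nu A) := by
  induction k with
  | zero => rfl
  | succ k ih => rw [pow_succ', Module.End.mul_apply, nu_Xi, ih, Module.End.mul_apply]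

lemma nu_Xi_add_Xo (A : LS R (LS R P)) :
    nu ((Xi + Xo : Module.End R (LS R (LS R P))) A)
      = (Xi - Xo : Module.End R (LS R (LS R P))) (nu A) := by
  have := nu_Xo_pow 1 A
  rw [pow_one, pow_one] at this
  rw [LinearMap.add_apply, map_add, nu_Xi, this, neg_one_smul, LinearMap.sub_apply, sub_eq_add_neg]

lemma nu_add_pow (k : ℕ) (A : LS R (LS R P)) :
    nu (((Xi + Xo : Module.End R (LS R (LS R P))) ^ k) A)
      = ((Xi - Xo : Module.End R (LS R (LS R P))) ^ k) (nu A) := by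
  induction k with
  | zero => rfl
  | succ k ih => rw [pow_succ', Module.End.mul_apply, nu_Xi_add_Xo, ih, pow_succ',
      Module.End.mul_apply]

/-- The double series `xₒ^a xᵢ^b v`. -/
def pol (a b : ℕ) (v : P) : LS R (LS R P) := (Xo ^ a) ((Xi ^ b) (cst (cst v)))

lemma cf_pol (a b : ℕ) (v : P) (m n : ℤ) :
    cf n (cf m (pol (R := R) a b v)) = if m = a ∧ n = b then v else 0 := by
  rw [pol, cf_Xo_pow, cf_Xi_pow, cf_cst]
  by_cases hm : m = a
  · by_cases hn : n = b
    · simp [hm, hn]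
    · simp [hm, hn, sub_eq_zero]
  · simp [hm, sub_eq_zero]

lemma sw_cst_cst (v : P) : Sw (cst (cst v) : LS R (LS R P)) (cst (cst v)) := fun m n => by
  rw [cf_cst, cf_cst]
  split_ifs <;> simp_all

lemma bireg_pol (a b : ℕ) (v : P) : Bireg (pol (R := R) a b v) := fun m n h => by
  rw [cf_pol, if_neg (by omega)]

lemma Tp_cst_cst (v : P) : Tp (cst (cst v) : LS R (LS R P)) = cst (cst v) := by
  refine ext fun m => ext fun n => ?_
  rcases lt_or_ge m 0 with hm | hm
  · rw [cf_Tp_cst_neg _ hm, cf_cst, if_neg hm.ne]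
  · lift m to ℕ using hm
    rw [cf_Tp_cst, cf_cst, cf_cst]
    rcases Nat.eq_zero_or_pos m with rfl | hm
    · simp [zchoose_zero]
    · rw [if_neg (by omega : ¬((m : ℤ) = 0)), map_zero]
      split_ifs with h
      · rw [h, zchoose_eq_zero le_rfl (by omega), Int.cast_zero, zero_smul]
      · rw [smul_zero]

lemma Tm_cst_cst (v : P) : Tm (cst (cst v) : LS R (LS R P)) = cst (cst v) := by
  nth_rewrite 1 [← Tp_cst_cst v]
  exact Tm_Tp _

lemma sw_Tm_swp_pol (a b : ℕ) (v : P) :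
    Sw (Tm (swp (pol (R := R) a b v))) (Tm (swp (Tp (nu (pol (R := R) a b v))))) := by
  have h1 : swp (pol (R := R) a b v) = (Xi ^ a) ((Xo ^ b) (cst (cst v))) :=
    (bireg_pol a b v).swp_eq (swOp_Xo.pow a _ _ (swOp_Xi.pow b _ _ (sw_cst_cst v)))
  have hn : nu (cst (cst v) : LS R (LS R P)) = cst (cst v) := ext fun n => by
    rw [cf_nu, cf_cst]; split_ifs with h <;> simp [h]
  have hnu : nu (pol (R := R) a b v) = ((-1 : R) ^ a) • pol a b v := by
    rw [pol, nu_Xo_pow, nu_Xi_pow, hn]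
  have h2 : Tp (pol (R := R) a b v)
      = (Xo ^ a) (((Xi + Xo : Module.End R (LS R (LS R P))) ^ b) (cst (cst v))) := by
    rw [pol, Tp_Xo_pow, Tp_Xi_pow, Tp_cst_cst]
  have h3 : swp (Tp (nu (pol (R := R) a b v)))
      = ((-1 : R) ^ a) • (Xi ^ a)
        (((Xi + Xo : Module.End R (LS R (LS R P))) ^ b) (cst (cst v))) := by
    rw [hnu, map_smul, map_smul, h2]
    congr 1
    exact (h2 ▸ (bireg_pol a b v).Tp).swp_eq
      (swOp_Xo.pow a _ _ (swOp_add.pow b _ _ (sw_cst_cst v)))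
  rw [h1, h3, map_smul, Tm_Xi_pow, Tm_Xi_pow, Tm_add_pow, Tm_Xo_pow, Tm_cst_cst,
    ← LinearMap.smul_apply, ← sub_pow_swap]
  exact (swOp_Xi.sub swOp_Xo).pow a _ _ (swOp_Xo.pow b _ _ (sw_cst_cst v))

lemma outer_Xi {A : LS R (LS R P)} {M : ℤ} (h : ∀ m < M, cf m A = 0) :
    ∀ m < M, cf m (Xi A) = 0 := fun m hm => by rw [cf_Xi, h m hm, map_zero]

lemma outer_Xo {A : LS R (LS R P)} {M : ℤ} (h : ∀ m < M, cf m A = 0) :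
    ∀ m < M, cf m (Xo A) = 0 := fun m hm => by rw [cf_Xo, h _ (by omega)]

lemma outer_add {A B : LS R (LS R P)} {M : ℤ} (h : ∀ m < M, cf m A = 0) (h' : ∀ m < M, cf m B = 0) :
    ∀ m < M, cf m (A + B) = 0 := fun m hm => by rw [map_add, h m hm, h' m hm, add_zero]

lemma outer_pow {Φ : Module.End R (LS R (LS R P))} {M : ℤ}
    (h : ∀ B, (∀ m < M, cf m B = 0) → ∀ m < M, cf m (Φ B) = 0) (k : ℕ) (A : LS R (LS R P))
    (hA : ∀ m < M, cf m A = 0) : ∀ m < M, cf m ((Φ ^ k) A) = 0 := by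
  induction k with
  | zero => exact hA
  | succ k ih => rw [pow_succ', Module.End.mul_apply]; exact h _ ih

/-- Vanishing of all coefficients of total degree at most `d`. -/
def Low (d : ℤ) (B : LS R (LS R P)) : Prop := ∀ m n : ℤ, m + n ≤ d → cf n (cf m B) = 0

lemma Low.Tp {d : ℤ} {B : LS R (LS R P)} (hB : Low d B) : Low d (Tp B) := by
  intro m n hmn
  rw [Tp_apply]
  refine cf_cf_Op_eq_zero fun i => ?_
  rw [cf_expSeq_der, hB _ _ (by omega), smul_zero]

lemma Low.Tm {d : ℤ} {B : LS R (LS R P)} (hB : Low d B) : Low d (Tm B) := by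
  intro m n hmn
  rw [Tm_apply]
  refine cf_cf_Op_eq_zero fun i => ?_
  rw [cf_expSeq_neg_der, hB _ _ (by omega), smul_zero, smul_zero]

lemma Low.nu {d : ℤ} {B : LS R (LS R P)} (hB : Low d B) : Low d (nu B) := fun m n h => by
  rw [cf_nu, map_smul, hB m n h, smul_zero]

lemma Low.swp {d : ℤ} {B : LS R (LS R P)} (hB : Low d B) : Low d (swp B) := fun m n h => by
  rw [cf_swp, hB n m (by omega), ite_self]

/-- The substitution `x₀ = x₁ - x₂` in a double power series, in terms of either variable. -/
lemma sw_Tm_swp {F : LS R (LS R P)} (hF : Bireg F) :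
    Sw (Tm (swp F)) (Tm (swp (Tp (nu F)))) := by
  intro m n
  set d : ℕ := (m + n).toNat with hd
  set G : LS R (LS R P) := ∑ a ∈ Finset.range (d + 1), ∑ b ∈ Finset.range (d + 1),
    pol a b (cf (b : ℤ) (cf (a : ℤ) F)) with hG
  have hlow : Low (m + n) (F - G) := by
    intro p q hpq
    rw [map_sub, map_sub, sub_eq_zero, hG]
    by_cases h : 0 ≤ p ∧ 0 ≤ q
    · obtain ⟨hp, hq⟩ := h
      lift p to ℕ using hp
      lift q to ℕ using hq
      simp only [map_sum, cf_pol]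
      rw [Finset.sum_eq_single_of_mem p (by simp; omega) (fun a _ ha => ?_),
        Finset.sum_eq_single_of_mem q (by simp; omega) (fun b _ hb => ?_)]
      · simp
      · rw [if_neg (by omega)]
      · exact Finset.sum_eq_zero fun b _ => by rw [if_neg (by omega)]
    · rw [hF _ _ (by omega)]
      simp only [map_sum, cf_pol]
      exact (Finset.sum_eq_zero fun a _ => Finset.sum_eq_zero fun b _ => by
        rw [if_neg (by omega)]).symm
  have hsw : Sw (Tm (swp G)) (Tm (swp (Tp (nu G)))) := by
    rw [hG]
    simp only [map_sum]
    exact Sw.sum _ fun a _ => Sw.sum _ fun b _ => sw_Tm_swp_pol a b _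
  have e : F = (F - G) + G := by abel
  rw [e]
  simp only [map_add]
  rw [hsw m n]
  congr 1
  have h1 := hlow.swp.Tm m n le_rfl
  have h2 := hlow.nu.Tp.swp.Tm n m (by omega)
  rw [map_sub] at h1 h2
  simp only [map_sub] at h1 h2 ⊢
  rw [h1, h2]

lemma sw_shift {K N : ℕ} {B C : LS R (LS R P)}
    (h : Sw (((Xi + Xo : Module.End R (LS R (LS R P))) ^ K) (Tp B))
      (((Xi + Xo : Module.End R (LS R (LS R P))) ^ K) C)) :
    Sw (Tp ((Xo ^ K) ((Xi ^ K) (((Xi - Xo : Module.End R (LS R (LS R P))) ^ N) B))))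
      ((Xo ^ N) ((Xi ^ K) (((Xi + Xo : Module.End R (LS R (LS R P))) ^ K) C))) := by
  have c1 : Commute ((Xi + Xo : Module.End R (LS R (LS R P))) ^ K) (Xi ^ N) :=
    ((Commute.refl Xi).add_left Xo_comm_Xi).pow_pow K N
  have c2 : Commute (Xo ^ N : Module.End R (LS R (LS R P))) (Xi ^ K) := Xo_comm_Xi.pow_pow N K
  rw [Tp_Xo_pow, Tp_Xi_pow, Tp_sub_pow, ← Module.End.mul_apply (_ ^ K) (Xi ^ N), c1.eq,
    ← Module.End.mul_apply (Xo ^ N) (Xi ^ K), c2.eq]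
  exact swOp_Xo.pow K _ _ (swOp_Xi.pow N _ _ h)

lemma Tp_nu_shift (K N : ℕ) (C : LS R (LS R P)) :
    (Xo ^ N) ((Xi ^ K) (((Xi + Xo : Module.End R (LS R (LS R P))) ^ K) (Tp (nu C))))
      = ((-1 : R) ^ N) • Tp (nu ((Xo ^ N) ((Xi ^ K)
        (((Xi + Xo : Module.End R (LS R (LS R P))) ^ K) C)))) := by
  rw [nu_Xo_pow, nu_Xi_pow, nu_add_pow, map_smul, Tp_Xo_pow, Tp_Xi_pow, Tp_sub_pow,
    smul_smul, ← mul_pow]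
  have c1 : Commute ((Xi + Xo : Module.End R (LS R (LS R P))) ^ K) (Xi ^ K) :=
    ((Commute.refl Xi).add_left Xo_comm_Xi).pow_pow K K
  rw [← Module.End.mul_apply (_ ^ K) (Xi ^ K), c1.eq]
  simp

lemma sw_of_bireg {F A B : LS R (LS R P)} {c : R} (hc : c * c = 1) (hF : Bireg F)
    (hG : Bireg (c • Tp (nu F))) (hA : Sw (Tp A) (c • Tp (nu F))) (hB : Sw (Tp B) F) :
    Sw A (c • B) := by
  have eA : A = c • Tm (swp (Tp (nu F))) := by
    rw [← Tm_Tp A, ← hG.swp_eq hA.symm]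
    simp only [map_smul]
  have eB : B = Tm (swp F) := by
    rw [← Tm_Tp B, hF.swp_eq hB.symm]
  rw [eA, eB]
  exact ((sw_Tm_swp hF).smul _).symm

lemma sw_cancel_shift {K : ℕ} {A B : LS R (LS R P)} {c : R}
    (h : Sw ((Xo ^ K) ((Xi ^ K) A)) (c • (Xo ^ K) ((Xi ^ K) B))) : Sw A (c • B) := by
  intro m n
  have := h (m + K) (n + K)
  rw [cf_Xo_pow, cf_Xi_pow, map_smul, map_smul, cf_Xo_pow, cf_Xi_pow] at this
  simp only [add_sub_cancel_right] at this
  rw [this, map_smul, map_smul]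

end LS

namespace NLVA

variable {V : Type*} [AddCommGroup V] [Module ℂ V] (𝒱 : NLVA V)

lemma weak_assoc_TYY (w : V) (q : KT (V ⊗[ℂ] V)) : ∃ k₀ : ℕ, ∀ k, k₀ ≤ k →
    Sw (((Xi + Xo) ^ k : Module.End ℂ (LS ℂ (LS ℂ V))) (𝒱.TYY w q))
      (((Xi + Xo) ^ k : Module.End ℂ (LS ℂ (LS ℂ V))) (map (𝒱.Yl.flip w) (𝒱.Yh q))) := by
  induction q using KT.induction₂ with
  | h0 =>
    refine ⟨0, fun k _ => ?_⟩
    simp only [map_zero]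
    intro m n; simp
  | ht f u v =>
    obtain ⟨k₀, h⟩ := 𝒱.weak_assoc_of_le u v w
    refine ⟨k₀, fun k hk => ?_⟩
    have := (swOp_smul f (h k hk).symm).symm
    rw [Yh_tmul, TYY_tmul, map_smul, add_pow_smul, im_apply, add_pow_map_ml]
    exact this
  | ha s t hs ht =>
    obtain ⟨k₁, h₁⟩ := hs
    obtain ⟨k₂, h₂⟩ := ht
    refine ⟨max k₁ k₂, fun k hk => ?_⟩
    have := (h₁ k (by omega)).add (h₂ k (by omega))
    simp only [map_add]
    exact this

variable {𝒱}

lemma SkewRel.locRel {u v : V} {q : KT (V ⊗[ℂ] V)} (h : 𝒱.SkewRel u v q) :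
    ∃ k, ∀ w, 𝒱.LocRel u v w k q := by
  obtain ⟨N₀, hN₀⟩ := exists_bound (𝒱.Yl u v)
  set N : ℕ := (-N₀).toNat with hN
  refine ⟨N, fun w => ?_⟩
  set A := map (𝒱.Yl u) (𝒱.Yl v w) with hA
  set T := 𝒱.TYY w q with hT
  set CA := map (𝒱.Yl.flip w) (𝒱.Yl u v) with hCA
  set Cq := map (𝒱.Yl.flip w) (𝒱.Yh q) with hCq
  have hC : CA = Tp (nu Cq) := by
    rw [hCA, hCq, nu_map, Tp_apply, h]
    exact (E_map_of_comm _ (LinearMap.ext fun a => (𝒱.Yl_D a w).symm) _).symm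
  obtain ⟨kA, hkA⟩ := 𝒱.weak_assoc_of_le u v w
  obtain ⟨kB, hkB⟩ := 𝒱.weak_assoc_TYY w q
  obtain ⟨MA, hMA⟩ := exists_bound A
  set K : ℕ := max (max kA kB) (-MA).toNat with hK
  have wA := hkA K (by omega)
  have wB := hkB K (by omega)
  rw [← hA, ← hCA] at wA
  rw [← hT, ← hCq] at wB
  set Ap := (Xo ^ K) ((Xi ^ K) (((Xi - Xo : Module.End ℂ (LS ℂ (LS ℂ V))) ^ N) A)) with hAp
  set Bp := (Xo ^ K) ((Xi ^ K) (((Xi - Xo : Module.End ℂ (LS ℂ (LS ℂ V))) ^ N) (Tm T))) with hBp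
  set GA := (Xo ^ N) ((Xi ^ K) (((Xi + Xo : Module.End ℂ (LS ℂ (LS ℂ V))) ^ K) CA)) with hGA
  set Gq := (Xo ^ N) ((Xi ^ K) (((Xi + Xo : Module.End ℂ (LS ℂ (LS ℂ V))) ^ K) Cq)) with hGq
  have sA : Sw (Tp Ap) GA := sw_shift wA
  have sB : Sw (Tp Bp) Gq := sw_shift (B := Tm T) (by rw [Tp_Tm]; exact wB)
  have hG : GA = ((-1 : ℂ) ^ N) • Tp (nu Gq) := by
    rw [hGA, hGq, hC, Tp_nu_shift]
  have bGA : Bireg GA := by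
    rintro m n (hm | hn)
    · rw [hGA, cf_Xo_pow, outer_pow (fun B hB => outer_Xi hB) (M := N₀) K _ (outer_pow
        (fun B hB => outer_add (outer_Xi hB) (outer_Xo hB)) K _ fun p hp => ?_) _ (by omega), map_zero]
      rw [hCA, cf_map, hN₀ p hp, map_zero]
    · rw [← sA n m]
      have : cf n (Tp Ap) = 0 := by
        rw [Tp_apply]
        refine cf_Op_lt _ _ (N := 0) (fun p hp => ?_) hn
        rw [hAp, cf_Xo_pow]
        refine outer_pow (fun B hB => outer_Xi hB) (M := MA) K _ (outer_pow
          (fun B hB => ?_) N _ hMA) _ (by omega)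
        intro p hp
        rw [LinearMap.sub_apply, map_sub, outer_Xi hB p hp, outer_Xo hB p hp, sub_zero]
      rw [this, map_zero]
  have hGq' : Gq = ((-1 : ℂ) ^ N) • nu (Tm GA) := by
    rw [hG, map_smul, Tm_Tp, map_smul, nu_nu, smul_smul, ← mul_pow]
    simp
  have bGq : Bireg Gq := by rw [hGq']; exact bGA.Tm.nu.smul _
  have hc : ((-1 : ℂ) ^ N) * (-1) ^ N = 1 := by rw [← mul_pow]; simp
  have := sw_cancel_shift (sw_of_bireg hc bGq (hG ▸ bGA) (hG ▸ sA) sB)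
  rw [← LinearMap.smul_apply, ← sub_pow_swap] at this
  exact this

end NLVA

end

noncomputable section

open LS

namespace LS

variable {R P : Type*} [Field R] [CharZero R] [AddCommGroup P] [Module R P]

lemma der_nu (A : LS R P) : der (nu A) = -nu (der A) := ext fun n => by
  rw [cf_der, cf_nu, map_neg, cf_nu, cf_der, smul_smul, smul_smul, ← neg_smul,
    zpow_add₀ (by simp)]
  congr 1
  simp
  ring

lemma der_E (D : P →ₗ[R] P) (A : LS R P) : der (E D A) = E D (der A + map D A) := ext fun n => by
  obtain ⟨N, hN⟩ := exists_bound A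
  set M := (n - N + 2).toNat with hM
  have hN1 : ∀ m < N - 1, cf m (der A + map D A) = 0 := fun m hm => by
    rw [map_add, cf_der, cf_map, hN _ (by omega), hN _ (by omega)]; simp
  rw [cf_der, E, cf_Op _ A (n + 1) N (M + 1) hN (by omega),
    cf_Op _ _ n (N - 1) M hN1 (by omega)]
  have e : ∀ i ∈ Finset.range M, expSeq D i (cf (n - i) (der A + map D A))
      = ((n : R) + 1 - i) • expSeq D i (cf (n + 1 - i) A)
        + ((i : R) + 1) • expSeq D (i + 1) (cf (n + 1 - (i + 1 : ℕ)) A) := by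
    intro i _
    have h := LinearMap.congr_fun (expSeq_succ' D i) (cf (n - i) A)
    simp only [LinearMap.smul_apply, LinearMap.comp_apply] at h
    rw [map_add, map_add, cf_der, cf_map, map_smul, ← h]
    push_cast
    congr 2
    · ring
    · congr 2; ring_nf
    · congr 2; ring_nf
  have e2 := Finset.sum_range_succ' (fun i : ℕ => (i : R) • expSeq D i (cf (n + 1 - i) A)) M
  have e3 := Finset.sum_range_succ (fun i : ℕ => ((n : R) + 1 - i) • expSeq D i (cf (n + 1 - i) A)) M
  have hz : expSeq D M (cf (n + 1 - M) A) = 0 := by rw [hN _ (by omega), map_zero]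
  rw [Finset.sum_congr rfl e, Finset.sum_add_distrib]
  rw [hz, smul_zero, add_zero] at e3
  rw [Nat.cast_zero, zero_smul, add_zero] at e2
  push_cast at e2 ⊢
  rw [← e2, ← e3, ← Finset.sum_add_distrib, Finset.smul_sum]
  refine Finset.sum_congr rfl fun i _ => ?_
  rw [← add_smul]
  congr 1
  ring

end LS

namespace KT

variable {P Q M : Type*} [AddCommGroup P] [Module ℂ P] [AddCommGroup Q] [Module ℂ Q]

/-- The substitution `x ↦ -x` on `ℂ((x)) ⊗ P`. -/
def nuT : KT P →ₗ[ℂ] KT P :=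
  LinearMap.rTensor P
    { toFun := nuK, map_add' := map_add nuK, map_smul' := fun c f => by
        refine HahnSeries.ext (funext fun n => ?_)
        simp [coeff_nuK]; ring : LaurentSeries ℂ →ₗ[ℂ] LaurentSeries ℂ }

@[simp] lemma nuT_tmul (f : LaurentSeries ℂ) (p : P) : nuT (f ⊗ₜ p) = nuK f ⊗ₜ p := rfl

lemma nu_cst (p : P) : nu (cst p : LS ℂ P) = cst p := LS.ext fun n => by
  rw [cf_nu, cf_cst]; split_ifs with h <;> simp [h]

lemma tl_nuT (t : KT P) : tl (nuT t) = nu (tl t) := by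
  induction t using KT.induction₁ with
  | h0 => simp
  | ht f p => rw [nuT_tmul, tl_tmul, tl_tmul, nu_smul, nu_cst]
  | ha s t hs ht => simp only [map_add, hs, ht]

/-- The `i`-th divided derivative on `ℂ((x)) ⊗ P`. -/
def dT (i : ℕ) : KT P →ₗ[ℂ] KT P :=
  LinearMap.rTensor P
    { toFun := dK i, map_add' := fun f g => HahnSeries.ext (funext fun n => by simp [coeff_dK, mul_add]),
      map_smul' := fun c f => HahnSeries.ext (funext fun n => by
        simp [coeff_dK, mul_left_comm]) : LaurentSeries ℂ →ₗ[ℂ] LaurentSeries ℂ }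

@[simp] lemma dT_tmul (i : ℕ) (f : LaurentSeries ℂ) (p : P) : dT i (f ⊗ₜ p) = dK i f ⊗ₜ p := rfl

lemma cf_tl_dT (i : ℕ) (t : KT P) (n : ℤ) :
    cf n (tl (dT i t)) = ((zchoose (n + i) i : ℤ) : ℂ) • cf (n + i) (tl t) := by
  induction t using KT.induction₁ with
  | h0 => simp
  | ht f p => rw [dT_tmul, tl_tmul, tl_tmul, cf_smul_cst, cf_smul_cst, coeff_dK, mul_smul]
  | ha s t hs ht => simp only [map_add, hs, ht, smul_add]

end KT

namespace NLVA

open KT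

variable {V : Type*} [AddCommGroup V] [Module ℂ V] {𝒱 : NLVA V}

lemma skewRel_iff {u v : V} {q : KT (V ⊗[ℂ] V)} :
    𝒱.SkewRel u v q ↔ 𝒱.Yh q = nu (E (-𝒱.D) (𝒱.Yl u v)) := by
  constructor
  · intro h
    rw [h, E_neg_E, nu_nu]
  · intro h
    rw [SkewRel, h, nu_nu, E_E_neg]

lemma SkewRel.unique (hinj : Function.Injective 𝒱.Yh) {u v : V} {q q' : KT (V ⊗[ℂ] V)}
    (h : 𝒱.SkewRel u v q) (h' : 𝒱.SkewRel u v q') : q = q' :=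
  hinj (by rw [skewRel_iff.mp h, skewRel_iff.mp h'])

/-- `S` is the skew-symmetry operator: `Y(u,x)v = e^{xD}Y(-x)S(-x)(v⊗u)`. -/
def IsSkewOp (𝒱 : NLVA V) (S : V ⊗[ℂ] V →ₗ[ℂ] KT (V ⊗[ℂ] V)) : Prop :=
  ∀ u v, 𝒱.SkewRel u v (S (v ⊗ₜ u))

lemma exists_isSkewOp (hinj : Function.Injective 𝒱.Yh) (h : ∀ u v, ∃ q, 𝒱.SkewRel u v q) :
    ∃ S, 𝒱.IsSkewOp S := by
  choose q hq using h
  refine ⟨TensorProduct.lift (LinearMap.mk₂ ℂ (fun v u => q u v) ?_ ?_ ?_ ?_), ?_⟩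
  case refine_5 => intro u v; rw [TensorProduct.lift.tmul, LinearMap.mk₂_apply]; exact hq u v
  all_goals
    intros
    apply hinj
    simp only [map_add, LinearMap.map_smul_of_tower, skewRel_iff.mp (hq _ _), LinearMap.add_apply,
      LinearMap.smul_apply, map_smul]

variable {S : V ⊗[ℂ] V →ₗ[ℂ] KT (V ⊗[ℂ] V)}

/-- The coefficients of an operator with values in Laurent series. -/
def coeffs (S : V ⊗[ℂ] V →ₗ[ℂ] KT (V ⊗[ℂ] V)) (n : ℤ) : V ⊗[ℂ] V →ₗ[ℂ] V ⊗[ℂ] V :=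
  cf n ∘ₗ tl.restrictScalars ℂ ∘ₗ S

lemma coeffs_apply (n : ℤ) (t : V ⊗[ℂ] V) : coeffs S n t = cf n (tl (S t)) := rfl

lemma cf_lift_Yl (n : ℤ) (t : V ⊗[ℂ] V) :
    cf n (TensorProduct.lift 𝒱.Yl t) = TensorProduct.lift (𝒱.Yc n) t := by
  induction t using TensorProduct.induction_on with
  | zero => simp
  | tmul a b => simp
  | add s t hs ht => simp only [map_add, hs, ht]

namespace IsSkewOp

lemma skewS (hS : 𝒱.IsSkewOp S) : SkewS 𝒱 (coeffs S) := by
  intro u v n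
  rw [← cf_Yl, hS u v, E, cf_Op_finsum, expD]
  refine finsum_congr fun j => ?_
  rw [expSeq, LinearMap.smul_apply, cf_nu, Yh, cf_ev]
  simp only [cf_lift_Yl, coeffs_apply]

lemma vac (hinj : Function.Injective 𝒱.Yh) (hS : 𝒱.IsSkewOp S) (v : V) (n : ℤ) :
    coeffs S n (𝒱.one ⊗ₜ v) = if n = 0 then 𝒱.one ⊗ₜ v else 0 := by
  have h : 𝒱.SkewRel v 𝒱.one (1 ⊗ₜ (𝒱.one ⊗ₜ v)) := by
    rw [SkewRel, Yl_one_right, Yh_tmul, one_smul, Yl_one, nu_cst]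
  rw [coeffs_apply, (hS v 𝒱.one).unique hinj h, tl_tmul, one_smul, cf_cst]

lemma Yh_eq (hS : 𝒱.IsSkewOp S) (q : KT (V ⊗[ℂ] V)) :
    𝒱.Yh q = E 𝒱.D (nu (𝒱.Yh (hat S (nuT (bc (TensorProduct.comm ℂ V V).toLinearMap q))))) := by
  induction q using KT.induction₂ with
  | h0 => simp
  | ht f u v =>
    rw [Yh_tmul, hS u v]
    simp [nu_smul, nuK_nuK]
  | ha s t hs ht => simp only [map_add, ← hs, ← ht]

lemma hat_nuT (hinj : Function.Injective 𝒱.Yh) (hS : 𝒱.IsSkewOp S) (t : V ⊗[ℂ] V) :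
    hat S (nuT (bc (TensorProduct.comm ℂ V V).toLinearMap (S (TensorProduct.comm ℂ V V t))))
      = 1 ⊗ₜ t := by
  induction t using TensorProduct.induction_on with
  | zero => simp
  | add s t hs ht => simp only [map_add, hs, ht, TensorProduct.tmul_add]
  | tmul u v =>
    apply hinj
    have h := hS u v
    rw [SkewRel, hS.Yh_eq, nu_E, E_E_neg, nu_nu] at h
    rw [TensorProduct.comm_tmul, ← h, Yh_tmul, one_smul]

lemma unitary (hinj : Function.Injective 𝒱.Yh) (hS : 𝒱.IsSkewOp S) : Unitary (coeffs S) := by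
  intro t n
  have h := congrArg (fun A => cf n (tl A)) (hS.hat_nuT hinj t)
  simp only [tl_hat, tl_tmul, one_smul, cf_cst, cf_ev] at h
  rw [← h, ← finsum_comp_equiv (Equiv.subLeft n)]
  refine finsum_congr fun c => ?_
  rw [Equiv.subLeft_apply, sub_sub_cancel, tl_nuT, cf_nu, cf_tl_bc, map_smul, map_smul]
  rfl

lemma der_Yh (q : KT (V ⊗[ℂ] V)) :
    der (𝒱.Yh q) = 𝒱.Yh (dT 1 q) + 𝒱.Yh (bc (LinearMap.rTensor V 𝒱.D) q) := by
  induction q using KT.induction₂ with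
  | h0 => simp
  | ht f u v => simp [der_smul, Yl_D]
  | ha s t hs ht => simp only [map_add, hs, ht]; abel

lemma S_rTensor_D (hinj : Function.Injective 𝒱.Yh) (hS : 𝒱.IsSkewOp S) (t : V ⊗[ℂ] V) :
    S (LinearMap.rTensor V 𝒱.D t) = dT 1 (S t) + bc (LinearMap.rTensor V 𝒱.D) (S t) := by
  induction t using TensorProduct.induction_on with
  | zero => simp
  | add s t hs ht => simp only [map_add, hs, ht]; abel
  | tmul v u =>
    rw [LinearMap.rTensor_tmul]
    refine (hS u _).unique hinj ?_
    have h := 𝒱.D_Yl u v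
    rw [hS u v, der_E, map_add, der_nu, der_Yh, ← map_add] at h
    have h2 : map 𝒱.D (E 𝒱.D (nu (𝒱.Yh (S (v ⊗ₜ u)))))
      = E 𝒱.D (map 𝒱.D (nu (𝒱.Yh (S (v ⊗ₜ u))))) := (E_map_of_comm _ rfl _).symm
    rw [h2, map_add (E 𝒱.D), map_neg (E 𝒱.D)] at h
    rw [SkewRel, map_add 𝒱.Yh]
    rw [← sub_eq_iff_eq_add] at h
    rw [← h]
    abel

lemma dcomm (hinj : Function.Injective 𝒱.Yh) (hS : 𝒱.IsSkewOp S) : DComm1 𝒱 (coeffs S) := by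
  intro t n
  rw [coeffs_apply, coeffs_apply, coeffs_apply, hS.S_rTensor_D hinj, map_add, map_add, cf_tl_bc,
    cf_tl_dT, sub_add_cancel_right, zchoose_eq]
  simp
  rw [← neg_smul]
  congr 1
  ring

end IsSkewOp

end NLVA

end

noncomputable section

open LS

lemma sum_Ico_natCast {A : Type*} [AddCommMonoid A] (f : ℤ → A) (J : ℕ) :
    ∑ p ∈ Finset.Ico (0 : ℤ) J, f p = ∑ j ∈ Finset.range J, f j :=
  (Finset.sum_nbij' (fun j : ℕ => (j : ℤ)) Int.toNat (by simp)
    (by simp; grind) (by simp) (by simp +contextual) (by simp)).symm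

namespace LS

variable {R P Q : Type*} [Field R] [CharZero R] [AddCommGroup P] [Module R P]
  [AddCommGroup Q] [Module R Q]

lemma Sw.nu {A B : LS R (LS R P)} (h : Sw A B) :
    Sw (LS.nu A) (LS.map LS.nu B) := fun m n => by
  simp [cf_nu, cf_map, h m n]

lemma cf_expSeq_map (D : P →ₗ[R] P) (i : ℕ) (n : ℤ) (A : LS R P) :
    cf n (expSeq ((LS.map D).restrictScalars R) i A) = expSeq D i (cf n A) := by
  have : ∀ i : ℕ, cf n ((((LS.map D).restrictScalars R : Module.End R (LS R P)) ^ i) A)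
      = ((D : Module.End R P) ^ i) (cf n A) := by
    intro i
    induction i with
    | zero => simp
    | succ i ih => rw [pow_succ', pow_succ', Module.End.mul_apply, Module.End.mul_apply, ← ih]; simp
  rw [expSeq, expSeq, LinearMap.smul_apply, LinearMap.smul_apply, ← this, map_smul]

lemma Sw.E_map (D : P →ₗ[R] P) {A B : LS R (LS R P)} (h : Sw A B) :
    Sw (E ((LS.map D).restrictScalars R) A) (LS.map ((E D).restrictScalars R) B) := fun m n => by
  obtain ⟨N, hN⟩ := exists_bound A
  have hN' : ∀ k < N, cf k (cf n B) = 0 := fun k hk => by rw [← h, hN k hk, map_zero]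
  rw [cf_map, LinearMap.restrictScalars_apply, E, E, cf_Op _ A m N (m - N + 1).toNat hN (by omega),
    cf_Op _ _ m N (m - N + 1).toNat hN' (by omega), map_sum]
  exact Finset.sum_congr rfl fun i _ => by rw [cf_expSeq_map, h]

lemma im_Op_dK (f : LaurentSeries R) (A : LS R (LS R P)) :
    Op (fun i => ((-1 : R) ^ i) • ml (dK i f)) (Tm A) = Tm (im f A) := (Tm_im f A).symm

lemma sw_Op_dK {g : LaurentSeries R} (hg : ∀ n < 0, g.coeff n = 0) {A B : LS R (LS R P)}
    (h : Sw A B) : Sw (Op (fun i => ((-1 : R) ^ i) • ml (dK i g)) A)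
      (Op (fun i => ((-1 : R) ^ i) • ml (dK i (nuK g))) B) := by
  have hz : ∀ (f : LaurentSeries R), (∀ n < 0, f.coeff n = 0) → ∀ (i : ℕ), ∀ n < 0,
      (dK i f).coeff n = 0 := by
    intro f hf i n hn
    rw [coeff_dK]
    rcases lt_or_ge (n + i) 0 with h | h
    · rw [hf _ h, mul_zero]
    · rw [zchoose_eq_zero h (by omega)]; simp
  have hg' : ∀ n < 0, (nuK g).coeff n = 0 := fun n hn => by rw [coeff_nuK, hg n hn]; simp
  intro m n
  obtain ⟨N, hN⟩ := exists_bound A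
  obtain ⟨L, hL⟩ := exists_bound B
  set I := (m - N + 1).toNat
  set J := (n - L + 1).toNat
  have hN' : ∀ k < N, ∀ l, cf k (cf l B) = 0 := fun k hk l => by rw [← h, hN k hk, map_zero]
  have hL' : ∀ k < L, ∀ l, cf k (cf l A) = 0 := fun k hk l => by rw [h, hL k hk, map_zero]
  rw [cf_Op _ A m N I hN (by omega), cf_Op _ B n L J hL (by omega), map_sum, map_sum]
  have e1 : ∀ i ∈ Finset.range I, cf n ((((-1 : R) ^ i) • ml (dK i g)) (cf (m - i) A))
      = ∑ j ∈ Finset.range J, ((-1 : R) ^ i) • (dK i g).coeff j • cf (n - j) (cf (m - i) A) := by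
    intro i _
    rw [LinearMap.smul_apply, ml_apply, map_smul, cf_smul _ _ n 0 J (hz g hg i)
      (fun q hq => hL' q (by omega) _), Finset.smul_sum, sum_Ico_natCast]
  have e2 : ∀ j ∈ Finset.range J, cf m ((((-1 : R) ^ j) • ml (dK j (LS.nuK g))) (cf (n - j) B))
      = ∑ i ∈ Finset.range I, ((-1 : R) ^ j) • (dK j (LS.nuK g)).coeff i
        • cf (m - i) (cf (n - j) B) := by
    intro j _
    rw [LinearMap.smul_apply, ml_apply, map_smul, cf_smul _ _ m 0 I (hz _ hg' j)
      (fun q hq => hN' q (by omega) _), Finset.smul_sum, sum_Ico_natCast]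
  rw [Finset.sum_congr rfl e1, Finset.sum_congr rfl e2, Finset.sum_comm]
  refine Finset.sum_congr rfl fun j _ => Finset.sum_congr rfl fun i _ => ?_
  rw [← h, smul_smul, smul_smul, coeff_dK, coeff_dK, coeff_nuK]
  congr 1
  have : ((zchoose ((j : ℤ) + i) i : ℤ) : R) = ((zchoose ((i : ℤ) + j) j : ℤ) : R) := by
    rw [← Nat.cast_add, ← Nat.cast_add, zchoose_natCast, zchoose_natCast, 
      add_comm j i, Nat.choose_symm_add]
  have e3 : ((-1 : R) ^ ((i : ℤ) + j)) = (-1) ^ i * (-1) ^ j := by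
    rw [← Nat.cast_add, zpow_natCast, pow_add]
  have e4 : ((-1 : R) ^ j) * (-1) ^ j = 1 := by rw [← mul_pow]; simp
  rw [this, e3, add_comm (j : ℤ) i]
  linear_combination (-(-1 : R) ^ i * ((zchoose ((i : ℤ) + j) j : ℤ) : R) * g.coeff (i + j)) * e4

lemma map_nu_Tp (A : LS R (LS R P)) : map nu (Tp A) = Tm (map nu A) := by
  have := E_map_of_comm (D := (der : LS R P →ₗ[R] LS R P)) (D' := -der) nu
    (LinearMap.ext fun B => by simp [der_nu]) A
  exact this.symm

lemma map_nu_Tm (A : LS R (LS R P)) : map nu (Tm A) = Tp (map nu A) := by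
  have := E_map_of_comm (D := -(der : LS R P →ₗ[R] LS R P)) (D' := der) nu
    (LinearMap.ext fun B => by simp [der_nu]) A
  exact this.symm

lemma map_nu_im (f : LaurentSeries R) (A : LS R (LS R P)) :
    map nu (im f A) = im (nuK f) (map nu A) := ext fun n => by simp [nu_smul]

lemma map_nu_Xo (A : LS R (LS R P)) : map nu (Xo A) = Xo (map nu A) := ext fun n => by simp

lemma map_nu_Xi (A : LS R (LS R P)) : map nu (Xi A) = -Xi (map nu A) := ext fun n => by
  refine ext fun m => ?_
  rw [cf_map, cf_Xi, map_neg, cf_Xi, map_neg, cf_map, cf_nu, cf_X, cf_X, cf_nu, ← neg_smul]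
  congr 1
  conv_lhs => rw [show m = m - 1 + 1 by ring, zpow_add₀ (by simp)]
  simp

lemma map_nu_add_pow (k : ℕ) (A : LS R (LS R P)) :
    map nu (((Xi + Xo) ^ k : Module.End R (LS R (LS R P))) A)
      = ((Xo - Xi) ^ k : Module.End R (LS R (LS R P))) (map nu A) := by
  induction k with
  | zero => simp
  | succ k ih =>
    rw [pow_succ', pow_succ', Module.End.mul_apply, Module.End.mul_apply, ← ih,
      LinearMap.add_apply, LinearMap.sub_apply, map_add, map_nu_Xi, map_nu_Xo]
    abel

lemma im_single_one (p : ℕ) (A : LS R (LS R P)) :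
    im (HahnSeries.single (p : ℤ) (1 : R)) A = (Xi ^ p) A := ext fun m => ext fun n => by
  rw [cf_im, cf_single_smul, one_smul, cf_Xi_pow]

lemma im_Xi_pow (f : LaurentSeries R) (k : ℕ) (A : LS R (LS R P)) :
    im f ((Xi ^ k) A) = (Xi ^ k) (im f A) := by
  rw [← im_single_one, ← im_single_one, ← im_mul, ← im_mul, mul_comm]

lemma E_map_sub_pow (D : P →ₗ[R] P) (k : ℕ) (A : LS R (LS R P)) :
    E ((map D).restrictScalars R) (((Xi - Xo) ^ k : Module.End R (LS R (LS R P))) A)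
      = ((Xi - Xo) ^ k : Module.End R (LS R (LS R P))) (E ((map D).restrictScalars R) A) := by
  rw [← Tm_Tp A, ← Tm_Xi_pow, E_map_Tm, E_map_Xi_pow, E_map_Tp, Tm_Xi_pow, E_map_Tm, E_map_Tp]

lemma map_restrict_sub_pow (φ : LS R P →ₗ[LaurentSeries R] LS R Q) (k : ℕ) (A : LS R (LS R P)) :
    map (φ.restrictScalars R) (((Xo - Xi) ^ k : Module.End R (LS R (LS R P))) A)
      = ((Xo - Xi) ^ k : Module.End R (LS R (LS R Q))) (map (φ.restrictScalars R) A) := by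
  induction k with
  | zero => simp
  | succ k ih =>
    rw [pow_succ', pow_succ', Module.End.mul_apply, Module.End.mul_apply, ← ih]
    refine ext fun n => ?_
    simp [X_apply]

end LS

namespace NLVA

open KT

variable {V : Type*} [AddCommGroup V] [Module ℂ V] {𝒱 : NLVA V}

lemma SkewRel.sw_term {b v : V} {r : KT (V ⊗[ℂ] V)} (h : 𝒱.SkewRel b v r)
    (f : LaurentSeries ℂ) (a : V) : ∃ L₀ : ℕ, ∀ L ≥ L₀,
    Sw (((Xi - Xo) ^ L : Module.End ℂ (LS ℂ (LS ℂ V))) (Tm (𝒱.TYY v (f ⊗ₜ (a ⊗ₜ b)))))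
      (((Xo - Xi) ^ L : Module.End ℂ (LS ℂ (LS ℂ V)))
        (map ((E 𝒱.D).restrictScalars ℂ) (map nu (Tp (im f (Tm (𝒱.Yit a r))))))) := by
  obtain ⟨k₀, hk₀⟩ := 𝒱.weak_assoc_Yit a r
  set M := LS.nu (map (𝒱.Yl a) (𝒱.Yh r)) with hM
  set C := 𝒱.Yit a r
  have hT : Tm (𝒱.TYY v (f ⊗ₜ (a ⊗ₜ b))) = E ((map 𝒱.D).restrictScalars ℂ) (Tm (im f M)) := by
    rw [TYY_tmul, show 𝒱.Yl b v = _ from h, map_Yl_E_D, Tp_Tm, ← E_map_im, E_map_Tm, hM, nu_map]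
  obtain ⟨p, hp⟩ : ∃ p : ℕ, ∀ n < 0, (HahnSeries.single (p : ℤ) (1 : ℂ) * f).coeff n = 0 := by
    obtain ⟨N, hN⟩ := exists_bound_coeff f
    refine ⟨(-N).toNat, fun n hn => ?_⟩
    rw [show n = (n - (-N).toNat) + (-N).toNat by ring, HahnSeries.coeff_single_mul_add,
      hN _ (by omega), mul_zero]
  refine ⟨k₀ + p, fun L hL => ?_⟩
  obtain ⟨K, rfl⟩ : ∃ K, L = K + p := ⟨L - p, by omega⟩
  have h1 : Sw (Tm ((Xi ^ K) M)) (((-1 : ℂ) ^ K) • Tm ((Xi ^ K) (Tp (map nu C)))) := by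
    have := (hk₀ K (by omega)).nu
    rw [nu_add_pow, map_nu_add_pow, Tp_apply, nu_E, ← Tm_apply, ← Tm_Xi_pow, sub_pow_swap,
      LinearMap.smul_apply] at this
    rwa [Tm_Xi_pow _ (Tp _), Tm_Tp]
  have h2 := sw_Op_dK hp h1
  rw [LinearMap.map_smul_of_tower, im_Op_dK, im_Op_dK] at h2
  have hnu : nuK (HahnSeries.single (p : ℤ) (1 : ℂ) * f)
      = ((-1 : ℂ) ^ p) • (HahnSeries.single (p : ℤ) (1 : ℂ) * nuK f) := by
    refine HahnSeries.ext (funext fun n => ?_)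
    rw [coeff_nuK, HahnSeries.coeff_smul, show n = (n - p) + p by ring,
      HahnSeries.coeff_single_mul_add, HahnSeries.coeff_single_mul_add, coeff_nuK,
      zpow_add₀ (by simp)]
    simp
    ring
  have hX : ∀ B : LS ℂ (LS ℂ V), (Xi ^ p) ((Xi ^ K) B) = (Xi ^ (K + p)) B := fun B => by
    rw [← Module.End.mul_apply, ← pow_add, add_comm]
  rw [im_mul, hnu, map_smul, LinearMap.smul_apply, im_mul, im_single_one, im_single_one, im_Xi_pow,
    im_Xi_pow, Tm.map_smul, smul_smul, hX, hX, ← pow_add, Tm_Xi_pow, Tm_Xi_pow,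
    ← LinearMap.smul_apply, ← sub_pow_swap] at h2
  have h3 := h2.E_map 𝒱.D
  rw [E_map_sub_pow, ← hT, map_restrict_sub_pow] at h3
  rw [map_nu_Tp, map_nu_im, map_nu_Tm]
  exact h3

variable {S : V ⊗[ℂ] V →ₗ[ℂ] KT (V ⊗[ℂ] V)}

lemma IsSkewOp.map_Yl_Yl (hS : 𝒱.IsSkewOp S) {u v w : V} {r : ℕ} {F : Fin r → LaurentSeries ℂ}
    {a b : Fin r → V} (hq : S (u ⊗ₜ w) = ∑ i, F i ⊗ₜ (a i ⊗ₜ b i)) :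
    map (𝒱.Yl w) (𝒱.Yl u v) = map ((E 𝒱.D).restrictScalars ℂ)
      (map nu (∑ i, Tp (im (F i) (Tm (𝒱.Yit (a i) (S (v ⊗ₜ b i))))))) := by
  obtain ⟨k, hk⟩ := (hS w u).locRel
  choose L₀ hL₀ using fun i => (hS (b i) v).sw_term (F i) (a i)
  set L := k + ∑ i, L₀ i with hL
  have h1 : Sw (((Xi - Xo) ^ L : Module.End ℂ (LS ℂ (LS ℂ V))) (Tm (𝒱.TYY v (S (u ⊗ₜ w)))))
      (((Xo - Xi) ^ L : Module.End ℂ (LS ℂ (LS ℂ V))) (map ((E 𝒱.D).restrictScalars ℂ)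
        (map nu (∑ i, Tp (im (F i) (Tm (𝒱.Yit (a i) (S (v ⊗ₜ b i))))))))) := by
    rw [hq]
    simp only [map_sum]
    refine Sw.sum _ fun i _ => hL₀ i L ?_
    exact (Finset.single_le_sum (f := L₀) (fun _ _ => Nat.zero_le _) (Finset.mem_univ i)).trans
      (Nat.le_add_left _ _)
  have h2 : Sw (((Xi - Xo) ^ L : Module.End ℂ (LS ℂ (LS ℂ V))) (Tm (𝒱.TYY v (S (u ⊗ₜ w)))))
      (((Xo - Xi) ^ L : Module.End ℂ (LS ℂ (LS ℂ V))) (map (𝒱.Yl w) (𝒱.Yl u v))) := by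
    have hX : ∀ (T : Module.End ℂ (LS ℂ (LS ℂ V))) B, (T ^ ∑ i, L₀ i) ((T ^ k) B) = (T ^ L) B :=
      fun T B => by rw [← Module.End.mul_apply, ← pow_add, add_comm]
    have := ((swOp_Xi.sub swOp_Xo).pow (∑ i, L₀ i) _ _ (hk v)).symm.smul ((-1 : ℂ) ^ L)
    rw [hX, hX, ← LinearMap.smul_apply, ← LinearMap.smul_apply, ← sub_pow_swap, ← sub_pow_swap] at this
    exact this
  have h3 := h2.eq h1
  rw [sub_pow_swap, LinearMap.smul_apply, LinearMap.smul_apply] at h3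
  exact injective_Xi_sub_Xo_pow L (smul_right_injective _ (pow_ne_zero _ (by norm_num)) h3)

end NLVA

end

noncomputable section

open LS

namespace LS

variable {R P Q P' Q' : Type*} [Field R] [CharZero R] [AddCommGroup P] [Module R P]
  [AddCommGroup Q] [Module R Q] [AddCommGroup P'] [Module R P'] [AddCommGroup Q'] [Module R Q']

lemma map_Op {Φ : ℕ → P →ₗ[R] Q} {Φ' : ℕ → P' →ₗ[R] Q'} (φ : P →ₗ[R] P') (ψ : Q →ₗ[R] Q')
    (h : ∀ i p, ψ (Φ i p) = Φ' i (φ p)) (A : LS R P) :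
    map ψ (Op Φ A) = Op Φ' (map φ A) := ext fun n => by
  obtain ⟨N, hN⟩ := exists_bound A
  have hN' : ∀ k < N, cf k (map φ A) = 0 := fun k hk => by rw [cf_map, hN k hk, map_zero]
  rw [cf_map, cf_Op Φ A n N (n - N + 1).toNat hN (by omega),
    cf_Op Φ' _ n N (n - N + 1).toNat hN' (by omega), map_sum]
  exact Finset.sum_congr rfl fun i _ => by rw [h, cf_map]

lemma Op_add_seq (Φ Ψ : ℕ → P →ₗ[R] Q) (A : LS R P) :
    Op (fun i => Φ i + Ψ i) A = Op Φ A + Op Ψ A := ext fun n => by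
  obtain ⟨N, hN⟩ := exists_bound A
  rw [map_add, cf_Op Φ A n N (n - N + 1).toNat hN (by omega),
    cf_Op Ψ A n N (n - N + 1).toNat hN (by omega), cf_Op _ A n N (n - N + 1).toNat hN (by omega),
    ← Finset.sum_add_distrib]
  rfl

lemma Op_smul_seq (c : R) (Φ : ℕ → P →ₗ[R] Q) (A : LS R P) :
    Op (fun i => c • Φ i) A = c • Op Φ A := ext fun n => by
  obtain ⟨N, hN⟩ := exists_bound A
  rw [map_smul, cf_Op Φ A n N (n - N + 1).toNat hN (by omega),
    cf_Op _ A n N (n - N + 1).toNat hN (by omega), Finset.smul_sum]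
  rfl

end LS

namespace KT

variable {P Q : Type*} [AddCommGroup P] [Module ℂ P] [AddCommGroup Q] [Module ℂ Q]

/-- Multiplication by `f` on `ℂ((z)) ⊗ P`, as a `ℂ`-linear map. -/
def ms : LaurentSeries ℂ →ₗ[ℂ] Module.End ℂ (KT P) := (Algebra.lsmul ℂ ℂ (KT P)).toLinearMap

@[simp] lemma ms_apply (f : LaurentSeries ℂ) (t : KT P) : ms f t = f • t := rfl

lemma dK_add (i : ℕ) (f g : LaurentSeries ℂ) : dK i (f + g) = dK i f + dK i g :=
  HahnSeries.ext (funext fun n => by simp [coeff_dK, mul_add])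

lemma dK_smul (i : ℕ) (c : ℂ) (f : LaurentSeries ℂ) : dK i (c • f) = c • dK i f :=
  HahnSeries.ext (funext fun n => by simp [coeff_dK, mul_left_comm])

/-- Multiplication by `f(z)` on `(ℂ((z)) ⊗ P)((x))`. -/
def mz : LaurentSeries ℂ →ₗ[ℂ] Module.End ℂ (LS ℂ (KT P)) :=
  LinearMap.mk₂ ℂ (fun f A => map (ms f) A)
    (fun f g A => LS.ext fun n => by rw [map_add, LS.map_add_left])
    (fun c f A => LS.ext fun n => by rw [map_smul, LS.map_smul_left]) (fun f A B => map_add _ A B)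
    (fun c f A => LinearMap.map_smul_of_tower _ c A)

@[simp] lemma cf_mz (f : LaurentSeries ℂ) (A : LS ℂ (KT P)) (n : ℤ) : cf n (mz f A) = f • cf n A := by
  simp [mz]

/-- Multiplication by `f(z+x)` on `(ℂ((z)) ⊗ P)((x))`. -/
def mp : LaurentSeries ℂ →ₗ[ℂ] Module.End ℂ (LS ℂ (KT P)) :=
  LinearMap.mk₂ ℂ (fun f A => Op (fun i => ms (dK i f)) A)
    (fun f g A => by rw [← Op_add_seq]; simp only [dK_add, map_add])
    (fun c f A => by rw [← Op_smul_seq]; simp only [dK_smul, map_smul]) (fun f A B => map_add _ A B)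
    (fun c f A => LinearMap.map_smul_of_tower _ c A)

lemma mp_apply (f : LaurentSeries ℂ) (A : LS ℂ (KT P)) :
    mp f A = Op (fun i => ms (dK i f)) A := rfl

end KT

namespace KT

variable {V : Type*} [AddCommGroup V] [Module ℂ V]

/-- `S` acting on the first two tensor factors. -/
def s12 (S : V ⊗[ℂ] V →ₗ[ℂ] KT (V ⊗[ℂ] V)) : (V ⊗[ℂ] V) ⊗[ℂ] V →ₗ[ℂ] KT ((V ⊗[ℂ] V) ⊗[ℂ] V) :=
  (TensorProduct.assoc ℂ _ _ _).toLinearMap ∘ₗ LinearMap.rTensor V S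

/-- `S` acting on the first and third tensor factors. -/
def s13 (S : V ⊗[ℂ] V →ₗ[ℂ] KT (V ⊗[ℂ] V)) : (V ⊗[ℂ] V) ⊗[ℂ] V →ₗ[ℂ] KT ((V ⊗[ℂ] V) ⊗[ℂ] V) :=
  (bc (swap23)).restrictScalars ℂ ∘ₗ s12 S ∘ₗ swap23

/-- `S` acting on the last two tensor factors. -/
def s23 (S : V ⊗[ℂ] V →ₗ[ℂ] KT (V ⊗[ℂ] V)) : (V ⊗[ℂ] V) ⊗[ℂ] V →ₗ[ℂ] KT ((V ⊗[ℂ] V) ⊗[ℂ] V) :=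
  (bc (TensorProduct.assoc ℂ V V V).symm.toLinearMap).restrictScalars ℂ ∘ₗ
    (TensorProduct.leftComm ℂ _ _ _).toLinearMap ∘ₗ LinearMap.lTensor V S ∘ₗ
      (TensorProduct.assoc ℂ V V V).toLinearMap

variable (S : V ⊗[ℂ] V →ₗ[ℂ] KT (V ⊗[ℂ] V))

lemma s12_tmul (t : V ⊗[ℂ] V) (c : V) :
    s12 S (t ⊗ₜ c) = bc ((TensorProduct.mk ℂ _ _).flip c) (S t) := by
  simp only [s12, LinearMap.comp_apply, LinearMap.rTensor_tmul]
  induction S t using KT.induction₁ with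
  | h0 => simp
  | ht f p => simp
  | ha s t hs ht => simp only [TensorProduct.add_tmul, map_add, hs, ht]

lemma s23_tmul (a b c : V) : s23 S ((a ⊗ₜ b) ⊗ₜ c)
    = bc ((TensorProduct.assoc ℂ V V V).symm.toLinearMap ∘ₗ TensorProduct.mk ℂ _ _ a)
      (S (b ⊗ₜ c)) := by
  simp only [s23, LinearMap.comp_apply, LinearEquiv.coe_coe, TensorProduct.assoc_tmul,
    LinearMap.lTensor_tmul]
  induction S (b ⊗ₜ c) using KT.induction₁ with
  | h0 => simp
  | ht f p => simp
  | ha s t hs ht => simp only [TensorProduct.tmul_add, map_add, hs, ht]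

lemma s13_tmul (a b c : V) {r : ℕ} {F : Fin r → LaurentSeries ℂ} {p q : Fin r → V}
    (h : S (a ⊗ₜ c) = ∑ i, F i ⊗ₜ (p i ⊗ₜ q i)) :
    s13 S ((a ⊗ₜ b) ⊗ₜ c) = ∑ i, F i ⊗ₜ ((p i ⊗ₜ b) ⊗ₜ q i) := by
  have : swap23 ((a ⊗ₜ b) ⊗ₜ c) = (a ⊗ₜ c) ⊗ₜ b := by simp [swap23]
  rw [s13, LinearMap.comp_apply, LinearMap.comp_apply, this, s12_tmul, h]
  simp [swap23]

end KT

namespace NLVA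

open KT

variable {V : Type*} [AddCommGroup V] [Module ℂ V] (𝒱 : NLVA V)

/-- The series `Y(a, x)b ⊗ c`. -/
def xs : (V ⊗[ℂ] V) ⊗[ℂ] V →ₗ[ℂ] LS ℂ (V ⊗[ℂ] V) :=
  TensorProduct.lift (LinearMap.mk₂ ℂ
    (fun t c => map ((TensorProduct.mk ℂ V V).flip c) (TensorProduct.lift 𝒱.Yl t))
    (fun s t c => by simp only [map_add])
    (fun r s c => by rw [map_smul, LinearMap.map_smul_of_tower])
    (fun s c d => by rw [map_add, LS.map_add_left])
    (fun r s c => by rw [map_smul, LS.map_smul_left]))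

@[simp] lemma xs_tmul (a b c : V) :
    𝒱.xs ((a ⊗ₜ b) ⊗ₜ c) = map ((TensorProduct.mk ℂ V V).flip c) (𝒱.Yl a b) := by
  simp [xs]

lemma cf_xs (t : (V ⊗[ℂ] V) ⊗[ℂ] V) (n : ℤ) :
    cf n (𝒱.xs t) = LinearMap.rTensor V (TensorProduct.lift (𝒱.Yc n)) t := by
  induction t using TensorProduct.induction_on with
  | zero => simp
  | tmul s c =>
    rw [xs, TensorProduct.lift.tmul, LinearMap.mk₂_apply, cf_map, cf_lift_Yl]; rfl
  | add s t hs ht => simp only [map_add, hs, ht]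

/-- The series `f(z) Y(a, x)b ⊗ c` for `f ⊗ a ⊗ b ⊗ c`. -/
def yz : KT ((V ⊗[ℂ] V) ⊗[ℂ] V) →ₗ[ℂ] LS ℂ (KT (V ⊗[ℂ] V)) :=
  TensorProduct.lift (LinearMap.lcomp ℂ _ ((map (TensorProduct.mk ℂ _ _ 1)).restrictScalars ℂ ∘ₗ 𝒱.xs)
    ∘ₗ mz)

lemma yz_tmul (f : LaurentSeries ℂ) (t : (V ⊗[ℂ] V) ⊗[ℂ] V) :
    𝒱.yz (f ⊗ₜ t) = mz f (map (TensorProduct.mk ℂ _ _ 1) (𝒱.xs t)) := rfl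

lemma cf_yz (r : KT ((V ⊗[ℂ] V) ⊗[ℂ] V)) (n : ℤ) :
    cf n (𝒱.yz r) = bc (LinearMap.rTensor V (TensorProduct.lift (𝒱.Yc n))) r := by
  induction r using KT.induction₁ with
  | h0 => simp
  | ht f p => simp [yz_tmul, cf_xs, TensorProduct.smul_tmul']
  | ha s t hs ht => simp only [map_add, hs, ht]

/-- The series `f(z+x) g(z) Y(a, x)b ⊗ c` for `f ⊗ g ⊗ a ⊗ b ⊗ c`. -/
def yp : KT (KT ((V ⊗[ℂ] V) ⊗[ℂ] V)) →ₗ[ℂ] LS ℂ (KT (V ⊗[ℂ] V)) :=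
  TensorProduct.lift (LinearMap.lcomp ℂ _ 𝒱.yz ∘ₗ mp)

lemma yp_tmul (f : LaurentSeries ℂ) (r : KT ((V ⊗[ℂ] V) ⊗[ℂ] V)) :
    𝒱.yp (f ⊗ₜ r) = mp f (𝒱.yz r) := rfl

lemma map_Yh_yz (a : V) (r : KT (V ⊗[ℂ] V)) : map (𝒱.Yh.restrictScalars ℂ)
    (𝒱.yz (bc ((TensorProduct.assoc ℂ V V V).symm.toLinearMap ∘ₗ TensorProduct.mk ℂ _ _ a) r))
      = 𝒱.Yit a r := LS.ext fun n => by
  rw [cf_map, cf_yz, cf_Yit]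
  induction r using KT.induction₂ with
  | h0 => simp
  | ht f u v => simp
  | ha s t hs ht => simp only [map_add, hs, ht]

lemma map_Yh_mp (f : LaurentSeries ℂ) (A : LS ℂ (KT (V ⊗[ℂ] V))) :
    map (𝒱.Yh.restrictScalars ℂ) (mp f A)
      = Tp (im f (Tm (map (𝒱.Yh.restrictScalars ℂ) A))) := by
  rw [Tp_im, Tp_Tm, mp_apply]
  exact map_Op _ _ (fun i p => by simp) A

variable {𝒱} {S : V ⊗[ℂ] V →ₗ[ℂ] KT (V ⊗[ℂ] V)}

/-- The hexagon identity `S(x₁)(Y(x₂)⊗1) = (Y(x₂)⊗1)S²³(x₁)S¹³(x₁+x₂)`, as an identity of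
series. -/
lemma IsSkewOp.hex_series (hinj : Function.Injective 𝒱.Yh) (hS : 𝒱.IsSkewOp S)
    (t : (V ⊗[ℂ] V) ⊗[ℂ] V) :
    map S (𝒱.xs t) = 𝒱.yp (LinearMap.lTensor _ (s23 S) (s13 S t)) := by
  induction t using TensorProduct.induction_on with
  | zero => simp
  | add s t hs ht => simp only [map_add, hs, ht]
  | tmul s w =>
    induction s using TensorProduct.induction_on with
    | zero => simp
    | add s t hs ht => simp only [TensorProduct.add_tmul, map_add, hs, ht]
    | tmul u v =>
      obtain ⟨r, F, a, b, hq⟩ := exists_fin_sum (S (u ⊗ₜ w))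
      refine LS.ext fun n => hinj ?_
      have h := congrArg (cf n) (hS.map_Yl_Yl (v := v) hq)
      have h' : ∀ A : LS ℂ (KT (V ⊗[ℂ] V)), 𝒱.Yh (cf n A) = cf n (map (𝒱.Yh.restrictScalars ℂ) A) :=
        fun A => by simp
      rw [h', h', s13_tmul S u v w hq]
      simp only [map_sum, LinearMap.lTensor_tmul, yp_tmul, s23_tmul, map_Yh_mp, map_Yh_yz] at h ⊢
      rw [cf_map, cf_map, xs_tmul, cf_map, LinearMap.flip_apply, TensorProduct.mk_apply,
        LinearMap.restrictScalars_apply, skewRel_iff.mp (hS w _), ← cf_map, h]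
      simp only [cf_map, LinearMap.restrictScalars_apply, map_sum, E_neg_E, nu_nu]

end NLVA

end

noncomputable section

open LS

section DoubleSum

variable {P : Type*} [AddCommGroup P]

/-- The double family `F` is finitely supported and sums to `s`. -/
def HasDSum (F : ℕ → ℤ → P) (s : P) : Prop :=
  (Function.support fun q : ℕ × ℤ => F q.1 q.2).Finite ∧ ∑ᶠ q : ℕ × ℤ, F q.1 q.2 = s

lemma HasDSum.eq {F : ℕ → ℤ → P} {s : P} (h : HasDSum F s) : ∑ᶠ (i : ℕ) (p : ℤ), F i p = s :=
  (finsum_curry (fun q : ℕ × ℤ => F q.1 q.2) h.1).symm.trans h.2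

lemma HasDSum.zero : HasDSum (fun _ _ => (0 : P)) 0 := ⟨by simp, by simp⟩

lemma HasDSum.add {F G : ℕ → ℤ → P} {s t : P} (hF : HasDSum F s) (hG : HasDSum G t) :
    HasDSum (fun i p => F i p + G i p) (s + t) :=
  ⟨(hF.1.union hG.1).subset (Function.support_add _ _), by
    rw [finsum_add_distrib hF.1 hG.1, hF.2, hG.2]⟩

lemma hasDSum_of_bounds {F : ℕ → ℤ → P} (I : ℕ) (f : ℕ → P)
    (hI : ∀ i, I ≤ i → ∀ p, F i p = 0) (hf : ∀ i < I, (Function.support (F i)).Finite ∧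
      ∑ᶠ p, F i p = f i) : HasDSum F (∑ i ∈ Finset.range I, f i) := by
  have hfin : (Function.support fun q : ℕ × ℤ => F q.1 q.2).Finite := by
    refine ((Finset.finite_toSet (Finset.range I)).biUnion (t := fun i =>
      (fun p => (i, p)) '' Function.support (F i)) fun i hi =>
        ((hf i (by simpa using hi)).1.image _)).subset ?_
    rintro ⟨i, p⟩ h
    have hi : i < I := by
      by_contra hi
      exact h (hI i (by omega) p)
    simp only [Finset.mem_coe, Finset.mem_range, Set.mem_iUnion]
    exact ⟨i, hi, p, h, rfl⟩
  refine ⟨hfin, ?_⟩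
  rw [finsum_curry _ hfin, finsum_nat_eq_sum_range I fun i hi => by
    simp only [hI i hi, finsum_zero]]
  exact Finset.sum_congr rfl fun i hi => (hf i (Finset.mem_range.mp hi)).2

end DoubleSum

namespace LS

variable {R : Type*} [Field R] [CharZero R]

lemma finite_support_coeff_mul (f g : LaurentSeries R) (n : ℤ) :
    (Function.support fun p => f.coeff p * g.coeff (n - p)).Finite := by
  obtain ⟨a, ha⟩ := exists_bound_coeff f
  obtain ⟨b, hb⟩ := exists_bound_coeff g
  refine (Set.finite_Icc a (n - b)).subset fun p hp => ?_
  by_contra hp'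
  rw [Set.mem_Icc, not_and_or] at hp'
  refine hp ?_
  rcases hp' with h | h
  · simp [ha p (by omega)]
  · simp [hb (n - p) (by omega)]

lemma coeff_dK_mul (f g : LaurentSeries R) (l : ℕ) (n : ℤ) :
    (Function.support fun p => (zchoose p l : R) * (f.coeff p * g.coeff (n - p + l))).Finite ∧
      ∑ᶠ p, (zchoose p l : R) * (f.coeff p * g.coeff (n - p + l)) = (dK l f * g).coeff n := by
  have e : ∀ p : ℤ, (dK l f).coeff (p - l) * g.coeff (n - (p - l))
      = (zchoose p l : R) * (f.coeff p * g.coeff (n - p + l)) := fun p => by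
    rw [coeff_dK, sub_add_cancel, mul_assoc]; congr 4; ring
  have hs := finite_support_coeff_mul (dK l f) g n
  constructor
  · refine (hs.preimage ((Equiv.subRight (l : ℤ)).injective.injOn)).subset fun p hp => ?_
    rw [Function.mem_support, ← e] at hp
    exact hp
  · conv_rhs => rw [coeff_mul_finsum, ← finsum_comp_equiv (Equiv.subRight (l : ℤ))]
    exact finsum_congr fun p => (e p).symm

end LS

namespace KT

variable {P Q : Type*} [AddCommGroup P] [Module ℂ P] [AddCommGroup Q] [Module ℂ Q]

lemma cf_tl_lTensor (φ : P →ₗ[ℂ] Q) (t : KT P) (n : ℤ) :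
    cf n (tl (LinearMap.lTensor (LaurentSeries ℂ) φ t)) = φ (cf n (tl t)) := by
  induction t using KT.induction₁ with
  | h0 => simp
  | ht f p => simp [tl_tmul, cf_smul_cst]
  | ha s t hs ht => simp only [map_add, hs, ht]

variable {V : Type*} [AddCommGroup V] [Module ℂ V] (S : V ⊗[ℂ] V →ₗ[ℂ] KT (V ⊗[ℂ] V))

lemma cf_tl_s12 (t : (V ⊗[ℂ] V) ⊗[ℂ] V) (n : ℤ) :
    cf n (tl (s12 S t)) = S12m (NLVA.coeffs S) n t := by
  induction t using TensorProduct.induction_on with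
  | zero => simp
  | tmul s c => rw [s12_tmul, cf_tl_bc]; rfl
  | add s t hs ht => simp only [map_add, hs, ht]

lemma cf_tl_s13 (t : (V ⊗[ℂ] V) ⊗[ℂ] V) (n : ℤ) :
    cf n (tl (s13 S t)) = S13m (NLVA.coeffs S) n t := by
  rw [s13, LinearMap.comp_apply, LinearMap.restrictScalars_apply, cf_tl_bc, LinearMap.comp_apply,
    cf_tl_s12]
  rfl

lemma cf_tl_s23 (t : (V ⊗[ℂ] V) ⊗[ℂ] V) (n : ℤ) :
    cf n (tl (s23 S t)) = S23m (NLVA.coeffs S) n t := by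
  induction t using TensorProduct.induction_on with
  | zero => simp
  | add s t hs ht => simp only [map_add, hs, ht]
  | tmul s c =>
    induction s using TensorProduct.induction_on with
    | zero => simp
    | add s t hs ht => simp only [TensorProduct.add_tmul, map_add, hs, ht]
    | tmul a b => rw [s23_tmul, cf_tl_bc]; simp [S23m, NLVA.coeffs_apply]

end KT

namespace NLVA

open KT

variable {V : Type*} [AddCommGroup V] [Module ℂ V] (𝒱 : NLVA V)

lemma cf_tl_cf_yp (Ψ : KT (KT ((V ⊗[ℂ] V) ⊗[ℂ] V))) (m n : ℤ) :
    HasDSum (fun i p => ((zchoose p i : ℤ) : ℂ) •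
      LinearMap.rTensor V (TensorProduct.lift (𝒱.Yc (n - i)))
        (cf (m - p + i) (tl (cf p (tl Ψ))))) (cf m (tl (cf n (𝒱.yp Ψ)))) := by
  induction Ψ using KT.induction₁ with
  | h0 => simpa using HasDSum.zero
  | ha s t hs ht => simpa only [map_add, smul_add] using hs.add ht
  | ht f r =>
    induction r using KT.induction₁ with
    | h0 => simpa using HasDSum.zero
    | ha s t hs ht => simpa only [TensorProduct.tmul_add, map_add, smul_add] using hs.add ht
    | ht g t =>
      obtain ⟨N, hN⟩ := exists_bound (𝒱.xs t)
      have e : ∀ (i : ℕ) (p : ℤ), ((zchoose p i : ℤ) : ℂ) •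
          LinearMap.rTensor V (TensorProduct.lift (𝒱.Yc (n - i)))
            (cf (m - p + i) (tl (cf p (tl (f ⊗ₜ[ℂ] (g ⊗ₜ[ℂ] t))))))
          = ((zchoose p i : ℂ) * (f.coeff p * g.coeff (m - p + i))) • cf (n - i) (𝒱.xs t) :=
        fun i p => by
          rw [tl_tmul, cf_smul_cst, LinearMap.map_smul_of_tower, map_smul, tl_tmul, cf_smul_cst,
            map_smul, map_smul, smul_smul, smul_smul, cf_xs, mul_assoc]
      simp only [e]
      have h := hasDSum_of_bounds (P := V ⊗[ℂ] V) (F := fun i p =>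
        ((zchoose p i : ℂ) * (f.coeff p * g.coeff (m - p + i))) • cf (n - i) (𝒱.xs t))
        (n - N + 1).toNat (fun i => (dK i f * g).coeff m • cf (n - i) (𝒱.xs t))
        (fun i hi p => by rw [hN _ (by omega), smul_zero]) (fun i _ => by
          obtain ⟨h₁, h₂⟩ := coeff_dK_mul f g i m
          refine ⟨h₁.subset fun p hp h0 => hp ?_, ?_⟩
          · exact (congrArg (· • cf (n - i) (𝒱.xs t)) h0).trans (zero_smul ℂ _)
          rw [← h₂, finsum_smul' h₁])
      convert h using 1
      have hN' : ∀ k < N, cf k (𝒱.yz (g ⊗ₜ t)) = 0 := fun k hk => by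
        rw [yz_tmul, cf_mz, cf_map, hN k hk, map_zero, smul_zero]
      rw [yp_tmul, mp_apply, cf_Op _ _ n N (n - N + 1).toNat hN' (by omega), map_sum, map_sum]
      refine Finset.sum_congr rfl fun i _ => ?_
      rw [yz_tmul, cf_mz, cf_map, ms_apply, TensorProduct.mk_apply,
        TensorProduct.smul_tmul', TensorProduct.smul_tmul', smul_eq_mul, smul_eq_mul, mul_one,
        tl_tmul, cf_smul_cst]

variable {𝒱} {S : V ⊗[ℂ] V →ₗ[ℂ] KT (V ⊗[ℂ] V)}

lemma IsSkewOp.hex (hinj : Function.Injective 𝒱.Yh) (hS : 𝒱.IsSkewOp S) :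
    HexY1 𝒱 (coeffs S) := fun t m n => by
  have h := (𝒱.cf_tl_cf_yp (LinearMap.lTensor _ (s23 S) (s13 S t)) m n).eq
  rw [← hS.hex_series hinj, cf_map, cf_xs] at h
  simp only [cf_tl_lTensor, cf_tl_s13, cf_tl_s23] at h
  exact h.symm

end NLVA

end

noncomputable section

open LS

lemma yangBaxter_conj {G : Type*} [Group G] {p s a b c : G} (hp : p * p = 1) (hs : s * s = 1)
    (hps : p * s * p = s * p * s)
    (h : (p * s * b * s * p) * (s * a * s) * c = c * (s * a * s) * (p * s * b * s * p)) :
    (p * s * c * s * p) * (s * (p * b⁻¹ * p) * s) * (p * a⁻¹ * p)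
      = (p * a⁻¹ * p) * (s * (p * b⁻¹ * p) * s) * (p * s * c * s * p) := by
  have hp' : p⁻¹ = p := inv_eq_of_mul_eq_one_left hp
  have hs' : s⁻¹ = s := inv_eq_of_mul_eq_one_left hs
  have pp (x : G) : p * (p * x) = x := by rw [← mul_assoc, hp, one_mul]
  have ss (x : G) : s * (s * x) = x := by rw [← mul_assoc, hs, one_mul]
  have psp (x : G) : p * (s * (p * x)) = s * (p * (s * x)) := by
    simpa only [mul_assoc] using congrArg (· * x) hps
  have psp' : p * (s * p) = s * (p * s) := by simpa only [mul_assoc] using hps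
  set X := s * (p * b * p) * s with hX
  set Y := p * a * p with hY
  set Z := p * s * c * s * p with hZ
  have hXYZ : X * Y * Z = Z * Y * X := by
    have := congrArg (fun x => (p * s) * x * (s * p)) h
    simp only [mul_assoc, pp, ss, psp, psp', hp, hs, mul_one, hX, hY, hZ] at this ⊢
    exact this
  have hX' : s * (p * b⁻¹ * p) * s = X⁻¹ := by
    simp only [hX, mul_inv_rev, hp', hs', mul_assoc]
  have hY' : p * a⁻¹ * p = Y⁻¹ := by
    simp only [hY, mul_inv_rev, hp', mul_assoc]
  rw [hX', hY']
  calc Z * X⁻¹ * Y⁻¹ = Y⁻¹ * X⁻¹ * (X * Y * Z) * X⁻¹ * Y⁻¹ := by group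
    _ = Y⁻¹ * X⁻¹ * (Z * Y * X) * X⁻¹ * Y⁻¹ := by rw [hXYZ]
    _ = Y⁻¹ * X⁻¹ * Z := by group

namespace KT

variable {B : Type*} [CommRing B] [Algebra ℂ B] {M N M' N' : Type*}
  [AddCommGroup M] [Module ℂ M] [AddCommGroup N] [Module ℂ N]
  [AddCommGroup M'] [Module ℂ M'] [AddCommGroup N'] [Module ℂ N']

/-- The substitution `x ↦ -x`, as an algebra map. -/
def nuA : LaurentSeries ℂ →ₐ[ℂ] LaurentSeries ℂ :=
  { nuK with
    commutes' := fun c => by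
      refine HahnSeries.ext (funext fun n => ?_)
      change (-1) ^ n * (algebraMap ℂ (LaurentSeries ℂ) c).coeff n = _
      rw [HahnSeries.algebraMap_apply, HahnSeries.C_apply, HahnSeries.coeff_single]
      split_ifs with h <;> simp [h] }

/-- Change of scalars along `τ`. -/
def bt (τ : LaurentSeries ℂ →ₐ[ℂ] B) : KT N →ₗ[ℂ] B ⊗[ℂ] N := LinearMap.rTensor N τ.toLinearMap

@[simp] lemma bt_tmul (τ : LaurentSeries ℂ →ₐ[ℂ] B) (f : LaurentSeries ℂ) (n : N) :
    bt τ (f ⊗ₜ n) = τ f ⊗ₜ n := rfl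

/-- The specialization of `φ` along `τ`, extended `B`-linearly. -/
def spec (τ : LaurentSeries ℂ →ₐ[ℂ] B) (φ : M →ₗ[ℂ] KT N) : B ⊗[ℂ] M →ₗ[B] B ⊗[ℂ] N :=
  (bt τ ∘ₗ φ).liftBaseChange B

@[simp] lemma spec_tmul (τ : LaurentSeries ℂ →ₐ[ℂ] B) (φ : M →ₗ[ℂ] KT N) (b : B) (m : M) :
    spec τ φ (b ⊗ₜ m) = b • bt τ (φ m) := by simp [spec]

lemma baseChange_hom_ext {X : Type*} [AddCommGroup X] [Module B X] [Module ℂ X]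
    [IsScalarTower ℂ B X] {φ ψ : B ⊗[ℂ] M →ₗ[B] X} (h : ∀ m, φ (1 ⊗ₜ m) = ψ (1 ⊗ₜ m)) : φ = ψ :=
  TensorProduct.AlgebraTensorModule.curry_injective (LinearMap.ext_ring (LinearMap.ext h))

lemma bt_bc (τ : LaurentSeries ℂ →ₐ[ℂ] B) (φ : M →ₗ[ℂ] N) (q : KT M) :
    bt τ (bc φ q) = φ.baseChange B (bt τ q) := by
  induction q using KT.induction₁ with
  | h0 => simp
  | ht f p => simp
  | ha s t hs ht => simp only [map_add, hs, ht]

lemma bt_smul (τ : LaurentSeries ℂ →ₐ[ℂ] B) (f : LaurentSeries ℂ) (q : KT M) :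
    bt τ (f • q) = τ f • bt τ q := by
  induction q using KT.induction₁ with
  | h0 => simp
  | ht g p => simp [TensorProduct.smul_tmul']
  | ha s t hs ht => simp only [map_add, smul_add, hs, ht]

lemma spec_bt (τ : LaurentSeries ℂ →ₐ[ℂ] B) (φ : M →ₗ[ℂ] KT N) (q : KT M) :
    spec τ φ (bt τ q) = bt τ (hat φ q) := by
  induction q using KT.induction₁ with
  | h0 => simp
  | ht g p => simp [bt_smul]
  | ha s t hs ht => simp only [map_add, hs, ht]

lemma bt_nuT (τ : LaurentSeries ℂ →ₐ[ℂ] B) (q : KT M) :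
    bt τ (nuT q) = bt (τ.comp nuA) q := by
  induction q using KT.induction₁ with
  | h0 => simp
  | ht g p => rfl
  | ha s t hs ht => simp only [map_add, hs, ht]

variable {V : Type*} [AddCommGroup V] [Module ℂ V] {S : V ⊗[ℂ] V →ₗ[ℂ] KT (V ⊗[ℂ] V)}

/-- The flip of the first two tensor factors. -/
def swap12 : (V ⊗[ℂ] V) ⊗[ℂ] V →ₗ[ℂ] (V ⊗[ℂ] V) ⊗[ℂ] V :=
  LinearMap.rTensor V (TensorProduct.comm ℂ V V).toLinearMap

lemma hom_ext₃ {X : Type*} [AddCommGroup X] [Module ℂ X] {φ ψ : (V ⊗[ℂ] V) ⊗[ℂ] V →ₗ[ℂ] X}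
    (h : ∀ a b c, φ ((a ⊗ₜ b) ⊗ₜ c) = ψ ((a ⊗ₜ b) ⊗ₜ c)) : φ = ψ :=
  TensorProduct.ext_threefold h

@[simp] lemma swap12_tmul (a b c : V) : swap12 ((a ⊗ₜ[ℂ] b) ⊗ₜ[ℂ] c) = (b ⊗ₜ a) ⊗ₜ c := rfl

@[simp] lemma swap23_tmul (a b c : V) : swap23 ((a ⊗ₜ[ℂ] b) ⊗ₜ[ℂ] c) = (a ⊗ₜ c) ⊗ₜ b := by
  simp [swap23]

lemma swap12_swap12 : (swap12 ∘ₗ swap12 : (V ⊗[ℂ] V) ⊗[ℂ] V →ₗ[ℂ] _) = LinearMap.id :=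
  hom_ext₃ fun a b c => by simp

lemma swap23_swap23 : (swap23 ∘ₗ swap23 : (V ⊗[ℂ] V) ⊗[ℂ] V →ₗ[ℂ] _) = LinearMap.id :=
  hom_ext₃ fun a b c => by simp

lemma swap_braid : (swap12 ∘ₗ swap23 ∘ₗ swap12 : (V ⊗[ℂ] V) ⊗[ℂ] V →ₗ[ℂ] _)
    = swap23 ∘ₗ swap12 ∘ₗ swap23 :=
  hom_ext₃ fun a b c => by simp

variable (S) in
lemma s23_eq (t : (V ⊗[ℂ] V) ⊗[ℂ] V) :
    s23 S t = bc swap12 (bc swap23 (s12 S (swap23 (swap12 t)))) := by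
  suffices s23 S = (bc (swap12 (V := V))).restrictScalars ℂ ∘ₗ
    (bc (swap23 (V := V))).restrictScalars ℂ ∘ₗ s12 S ∘ₗ swap23 ∘ₗ swap12 from LinearMap.congr_fun this t
  refine TensorProduct.ext_threefold fun a b c => ?_
  simp only [LinearMap.comp_apply, swap12_tmul, swap23_tmul, s23_tmul, s12_tmul,
    LinearMap.restrictScalars_apply]
  induction S (b ⊗ₜ c) using KT.induction₂ with
  | h0 => simp
  | ht f u v => simp
  | ha s t hs ht => simp only [map_add, hs, ht]

lemma hat_bc_s12 (q : KT (V ⊗[ℂ] V)) (c : V) :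
    hat (s12 S) (bc ((TensorProduct.mk ℂ _ _).flip c) q)
      = bc ((TensorProduct.mk ℂ _ _).flip c) (hat S q) := by
  induction q using KT.induction₁ with
  | h0 => simp
  | ht f p => simp [s12_tmul]
  | ha s t hs ht => simp only [map_add, hs, ht]

lemma nuT_bc (φ : M →ₗ[ℂ] N) (q : KT M) : nuT (bc φ q) = bc φ (nuT q) := by
  induction q using KT.induction₁ with
  | h0 => simp
  | ht f p => simp
  | ha s t hs ht => simp only [map_add, hs, ht]

lemma bc_swap12_bc (q : KT (V ⊗[ℂ] V)) (c : V) :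
    bc swap12 (bc ((TensorProduct.mk ℂ _ _).flip c) q)
      = bc ((TensorProduct.mk ℂ _ _).flip c) (bc (TensorProduct.comm ℂ V V).toLinearMap q) := by
  induction q using KT.induction₁ with
  | h0 => simp
  | ht f p => simp [swap12]
  | ha s t hs ht => simp only [map_add, hs, ht]

/-- The unitarity relation for `S`, on three tensor factors and after specialization. -/
lemma spec_s12_unitary
    (hS : ∀ t, hat S (nuT (bc (TensorProduct.comm ℂ V V).toLinearMap
      (S (TensorProduct.comm ℂ V V t)))) = 1 ⊗ₜ t)
    (τ : LaurentSeries ℂ →ₐ[ℂ] B) :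
    spec τ (s12 S) ∘ₗ swap12.baseChange B ∘ₗ spec (τ.comp nuA) (s12 S) ∘ₗ swap12.baseChange B
      = LinearMap.id := by
  refine baseChange_hom_ext fun t => ?_
  simp only [LinearMap.comp_apply, LinearMap.baseChange_tmul, spec_tmul, one_smul, ← bt_bc,
    ← bt_nuT, spec_bt, LinearMap.id_apply]
  have : hat (s12 S) (nuT (bc swap12 (s12 S (swap12 t)))) = 1 ⊗ₜ t := by
    induction t using TensorProduct.induction_on with
    | zero => simp
    | add s t hs ht => simp only [map_add, hs, ht, TensorProduct.tmul_add]
    | tmul s c =>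
      have e : swap12 (s ⊗ₜ[ℂ] c) = TensorProduct.comm ℂ V V s ⊗ₜ c := rfl
      rw [e, s12_tmul, bc_swap12_bc, nuT_bc, hat_bc_s12, hS]
      simp
  rw [← nuT_bc, this]
  simp

section Relabel

variable (S) (τ : LaurentSeries ℂ →ₐ[ℂ] B)

lemma spec_s13 : spec τ (s13 S)
    = swap23.baseChange B ∘ₗ spec τ (s12 S) ∘ₗ swap23.baseChange B := by
  refine baseChange_hom_ext fun t => ?_
  simp [s13, bt_bc]

lemma spec_s23 : spec τ (s23 S) = swap12.baseChange B ∘ₗ swap23.baseChange B ∘ₗ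
    spec τ (s12 S) ∘ₗ swap23.baseChange B ∘ₗ swap12.baseChange B := by
  refine baseChange_hom_ext fun t => ?_
  simp [s23_eq, bt_bc]

end Relabel

lemma comp_nuA_comp_nuA (τ : LaurentSeries ℂ →ₐ[ℂ] B) : (τ.comp nuA).comp nuA = τ :=
  AlgHom.ext fun f => congrArg τ (nuK_nuK f)

/-- A Yang–Baxter relation for `S`, after relabelling the tensor factors and inverting. -/
lemma spec_yangBaxter
    (hS : ∀ t, hat S (nuT (bc (TensorProduct.comm ℂ V V).toLinearMap
      (S (TensorProduct.comm ℂ V V t)))) = 1 ⊗ₜ t)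
    (σ ζ π : LaurentSeries ℂ →ₐ[ℂ] B)
    (h : spec π (s23 S) ∘ₗ spec ζ (s13 S) ∘ₗ spec σ (s12 S)
      = spec σ (s12 S) ∘ₗ spec ζ (s13 S) ∘ₗ spec π (s23 S)) :
    spec σ (s23 S) ∘ₗ spec (π.comp nuA) (s13 S) ∘ₗ spec (ζ.comp nuA) (s12 S)
      = spec (ζ.comp nuA) (s12 S) ∘ₗ spec (π.comp nuA) (s13 S) ∘ₗ spec σ (s23 S) := by
  let p : Module.End B (B ⊗[ℂ] ((V ⊗[ℂ] V) ⊗[ℂ] V)) := swap12.baseChange B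
  let s : Module.End B (B ⊗[ℂ] ((V ⊗[ℂ] V) ⊗[ℂ] V)) := swap23.baseChange B
  let A (τ : LaurentSeries ℂ →ₐ[ℂ] B) : Module.End B (B ⊗[ℂ] ((V ⊗[ℂ] V) ⊗[ℂ] V)) :=
    spec τ (s12 S)
  have hp : p * p = 1 := by
    rw [Module.End.mul_eq_comp, ← LinearMap.baseChange_comp, swap12_swap12,
      LinearMap.baseChange_id]; rfl
  have hs : s * s = 1 := by
    rw [Module.End.mul_eq_comp, ← LinearMap.baseChange_comp, swap23_swap23,
      LinearMap.baseChange_id]; rfl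
  have hps : p * s * p = s * p * s := by
    rw [mul_assoc, mul_assoc]
    simp only [Module.End.mul_eq_comp, p, s, ← LinearMap.baseChange_comp, swap_braid]
  have hA (τ : LaurentSeries ℂ →ₐ[ℂ] B) : A τ * (p * A (τ.comp nuA) * p) = 1 := by
    rw [mul_assoc]; exact spec_s12_unitary hS τ
  let u (τ : LaurentSeries ℂ →ₐ[ℂ] B) : (Module.End B (B ⊗[ℂ] ((V ⊗[ℂ] V) ⊗[ℂ] V)))ˣ :=
    ⟨A τ, p * A (τ.comp nuA) * p, hA τ, by
      have h := hA (τ.comp nuA)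
      rw [comp_nuA_comp_nuA] at h
      calc p * A (τ.comp nuA) * p * A τ = p * (A (τ.comp nuA) * (p * A τ * p)) * p := by
            simp only [mul_assoc, hp, mul_one]
        _ = 1 := by rw [h, mul_one, hp]⟩
  have h' := yangBaxter_conj (p := ⟨p, p, hp, hp⟩) (s := ⟨s, s, hs, hs⟩) (a := u ζ) (b := u π)
    (c := u σ) (Units.ext hp) (Units.ext hs) (Units.ext hps) (Units.ext (by
      simp only [spec_s13, spec_s23] at h
      exact h))
  have h'' := congrArg Units.val h'
  have hu (τ : LaurentSeries ℂ →ₐ[ℂ] B) : p * ↑(u τ)⁻¹ * p = A (τ.comp nuA) := by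
    change p * (p * A (τ.comp nuA) * p) * p = _
    rw [mul_assoc, mul_assoc, hp, mul_one, ← mul_assoc, hp, one_mul]
  simp only [Units.val_mul, hu] at h''
  simp only [spec_s13, spec_s23]
  exact h''

end KT

end

noncomputable section

open LS

lemma HasDSum.smul_const {P : Type*} [AddCommGroup P] [Module ℂ P] {F : ℕ → ℤ → ℂ} {s : ℂ}
    (h : HasDSum F s) (v : P) : HasDSum (fun i p => F i p • v) (s • v) := by
  refine ⟨h.1.subset fun q hq h0 => hq ?_, ?_⟩
  · exact (congrArg (· • v) h0).trans (zero_smul ℂ v)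
  · rw [← h.2, finsum_smul' h.1]

namespace LS

lemma dK_mul (l : ℕ) (f g : LaurentSeries ℂ) :
    dK l (f * g) = ∑ i ∈ Finset.range (l + 1), dK i f * dK (l - i) g := by
  have h := congrArg (cf (l : ℤ)) (E_der_map_ml f (cst (HahnModule.of ℂ g : LS ℂ ℂ)))
  have h0 : ∀ k < (0 : ℤ), cf k (E der (cst (HahnModule.of ℂ g : LS ℂ ℂ))) = 0 := fun k hk =>
    Op_cst_neg _ _ _ hk
  rw [map_cst, E, Op_cst, ← E, cf_Op _ _ _ 0 (l + 1) h0 (by push_cast; omega)] at h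
  have h₁ := congrArg (HahnModule.of ℂ).symm h
  have e : (HahnModule.of ℂ).symm (expSeq der l (ml f (HahnModule.of ℂ g : LS ℂ ℂ)))
      = dK l (f * g) := by
    rw [dK, ml_apply]; congr 2
  rw [e] at h₁
  rw [h₁]
  change (HahnModule.of ℂ).symm (∑ i ∈ _, _ : LS ℂ ℂ) = _
  refine Eq.trans (map_sum (⟨⟨(HahnModule.of ℂ).symm, rfl⟩, fun _ _ => rfl⟩ :
    LS ℂ ℂ →+ LaurentSeries ℂ) _ _) (Finset.sum_congr rfl fun i hi => ?_)
  have hi' : (l : ℤ) - i = ((l - i : ℕ) : ℤ) := by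
    rw [Finset.mem_range] at hi; omega
  rw [hi', E, Op_cst, ml_apply]
  exact HahnSeries.of_symm_smul_of_eq_mul

lemma dK_C (l : ℕ) (c : ℂ) :
    dK l (algebraMap ℂ (LaurentSeries ℂ) c) = if l = 0 then algebraMap ℂ _ c else 0 := by
  rcases l with _ | l
  · rw [dK_zero, if_pos rfl]
  · rw [if_neg (by omega)]
    refine HahnSeries.ext (funext fun n => ?_)
    rw [coeff_dK, HahnSeries.algebraMap_apply, HahnSeries.C_apply, HahnSeries.coeff_single]
    split_ifs with h
    · rw [h, zchoose_eq_zero le_rfl (by omega)]; simp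
    · simp

end LS

namespace KT

/-- Iterated Laurent series `ℂ((z))((x))`. -/
abbrev K2 := LaurentSeries (LaurentSeries ℂ)

instance (priority := 10000) K2.commRing : CommRing K2 := HahnSeries.instCommRing

instance (priority := 10000) K2.semiring : Semiring K2 := K2.commRing.toSemiring

instance (priority := 10000) K2.algebra : Algebra ℂ K2 := HahnSeries.instAlgebra

lemma algebraMap_K2 (c : ℂ) :
    (algebraMap ℂ K2 : ℂ → K2) c
      = (HahnSeries.C : LaurentSeries ℂ →+* K2) (algebraMap ℂ (LaurentSeries ℂ) c) := rfl

/-- `f ↦ f(z)`. -/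
def cz : LaurentSeries ℂ →ₐ[ℂ] K2 :=
  { (HahnSeries.C : LaurentSeries ℂ →+* K2) with commutes' := fun c => rfl }

/-- `f ↦ f(x)`. -/
def cx : LaurentSeries ℂ →ₐ[ℂ] K2 where
  toFun f := f.map (algebraMap ℂ (LaurentSeries ℂ))
  map_one' := HahnSeries.ext (funext fun n => by
    simp only [HahnSeries.map_coeff, HahnSeries.coeff_one]; split_ifs <;> simp)
  map_zero' := HahnSeries.ext (funext fun n => by simp)
  map_add' f g := HahnSeries.ext (funext fun n => by simp)
  map_mul' f g := HahnSeries.ext (funext fun n => by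
    rw [HahnSeries.map_coeff, coeff_mul_finsum, coeff_mul_finsum]
    refine ((algebraMap ℂ (LaurentSeries ℂ)).toAddMonoidHom.map_finsum
      (finite_support_coeff_mul f g n)).trans (finsum_congr fun p => ?_)
    simp)
  commutes' c := HahnSeries.ext (funext fun n => by
    have e : (algebraMap ℂ (LaurentSeries ℂ) c).coeff n = if n = 0 then c else 0 := by
      rw [HahnSeries.algebraMap_apply, HahnSeries.C_apply, HahnSeries.coeff_single]
      split_ifs <;> rfl
    rw [HahnSeries.map_coeff, e, algebraMap_K2, HahnSeries.C_apply, HahnSeries.coeff_single]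
    split_ifs <;> simp)

/-- `f ↦ f(z + x)`. -/
def tp : LaurentSeries ℂ →ₐ[ℂ] K2 where
  toFun f := HahnSeries.ofPowerSeries ℤ _ (PowerSeries.mk fun i => dK i f)
  map_one' := by
    rw [← map_one (HahnSeries.ofPowerSeries ℤ (LaurentSeries ℂ))]
    congr 1
    ext i : 1
    rw [PowerSeries.coeff_mk, PowerSeries.coeff_one, ← map_one (algebraMap ℂ (LaurentSeries ℂ)),
      dK_C]
  map_zero' := by
    rw [← map_zero (HahnSeries.ofPowerSeries ℤ (LaurentSeries ℂ))]
    congr 1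
    ext i : 1
    rw [PowerSeries.coeff_mk, ← map_zero (algebraMap ℂ (LaurentSeries ℂ)), dK_C]
    simp
  map_add' f g := by
    rw [← map_add]
    congr 1
    ext i : 1
    simp [dK_add]
  map_mul' f g := by
    rw [← map_mul]
    congr 1
    ext i : 1
    rw [PowerSeries.coeff_mk, PowerSeries.coeff_mul, dK_mul,
      Finset.Nat.sum_antidiagonal_eq_sum_range_succ_mk]
    simp
  commutes' c := by
    rw [algebraMap_K2, ← HahnSeries.ofPowerSeries_C]
    congr 1
    ext i : 1
    rw [PowerSeries.coeff_mk, PowerSeries.coeff_C, dK_C]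

@[simp] lemma coeff_cx (f : LaurentSeries ℂ) (n : ℤ) :
    (cx f).coeff n = algebraMap ℂ _ (f.coeff n) := rfl

lemma coeff_mul_cz (F : K2) (f : LaurentSeries ℂ) (n : ℤ) :
    (F * cz f).coeff n = F.coeff n * f := by
  have : cz f = HahnSeries.single 0 f := rfl
  rw [this, HahnSeries.coeff_mul_single_zero]

@[simp] lemma coeff_tp (f : LaurentSeries ℂ) (i : ℕ) : (tp f).coeff i = dK i f := by
  refine (HahnSeries.ofPowerSeries_apply_coeff _ i).trans ?_
  rw [PowerSeries.coeff_mk]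

lemma coeff_tp_neg (f : LaurentSeries ℂ) {n : ℤ} (hn : n < 0) : (tp f).coeff n = 0 := by
  refine HahnSeries.embDomain_notin_range ?_
  rintro ⟨m, hm⟩
  simp at hm
  omega

lemma coeff_tp_mul (f : LaurentSeries ℂ) (F : K2) (n N : ℤ) (M : ℕ)
    (hN : ∀ k < N, F.coeff k = 0) (hM : n - N < M) :
    (tp f * F).coeff n = ∑ i ∈ Finset.range M, dK i f * F.coeff (n - i) := by
  rw [coeff_mul_finsum, finsum_int_eq_sum_Ico 0 M
    (fun p hp => by rw [coeff_tp_neg f hp, zero_mul])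
    (fun p hp => by rw [hN _ (by omega), mul_zero]), sum_Ico_natCast]
  simp only [coeff_tp]

lemma hasDSum_coeff (f g h : LaurentSeries ℂ) (a b : ℤ) :
    HasDSum (fun i p => (zchoose p i : ℂ) * (f.coeff (b - i) * h.coeff p * g.coeff (a - p + i)))
      ((-1) ^ (a + b) *
        ((tp (nuA h) * (cx (nuA f) * cz (nuA g))).coeff b).coeff a) := by
  obtain ⟨N, hN⟩ := exists_bound_coeff f
  have hsign (i : ℕ) (p : ℤ) : (-1 : ℂ) ^ (a + b)
      * ((-1) ^ (b - i) * ((-1) ^ p * (-1) ^ (a - p + i))) = 1 := by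
    rw [← zpow_add₀ (by norm_num), ← zpow_add₀ (by norm_num),
      show b - i + (p + (a - p + i)) = a + b by ring, neg_one_zpow_mul_self]
  have key := hasDSum_of_bounds (F := fun i p =>
      (zchoose p i : ℂ) * (f.coeff (b - i) * h.coeff p * g.coeff (a - p + i)))
    (b - N + 1).toNat (fun i => (-1) ^ (a + b) * ((nuA f).coeff (b - i)
      * (dK i (nuA h) * nuA g).coeff a))
    (fun i hi p => by rw [hN _ (by omega)]; ring) (fun i _ => by
      obtain ⟨h₁, h₂⟩ := coeff_dK_mul (nuA h) (nuA g) i a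
      have e : ∀ p, (zchoose p i : ℂ) * (f.coeff (b - i) * h.coeff p * g.coeff (a - p + i))
          = ((-1) ^ (a + b) * (nuA f).coeff (b - i)) * ((zchoose p i : ℂ)
            * ((nuA h).coeff p * (nuA g).coeff (a - p + i))) := fun p => by
        change _ = ((-1) ^ (a + b) * ((-1) ^ (b - i) * f.coeff (b - i))) * ((zchoose p i : ℂ)
          * (((-1) ^ p * h.coeff p) * ((-1) ^ (a - p + i) * g.coeff (a - p + i))))
        linear_combination (-(zchoose p i : ℂ) * (f.coeff (b - i) * h.coeff p
          * g.coeff (a - p + i))) * hsign i p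
      simp only [e]
      refine ⟨h₁.subset fun p hp h0 => hp ?_, ?_⟩
      · change _ * _ = _
        exact (congrArg _ h0).trans (mul_zero _)
      · rw [← mul_finsum' _ _ h₁, h₂, mul_assoc])
  convert key using 1
  rw [coeff_tp_mul _ _ b N (b - N + 1).toNat (fun k hk => by
    rw [coeff_mul_cz, coeff_cx]
    change algebraMap ℂ (LaurentSeries ℂ) ((-1) ^ k * f.coeff k) * _ = _
    rw [hN k hk, mul_zero, map_zero, zero_mul]) (by omega), ← Finset.mul_sum]
  congr 1
  rw [HahnSeries.coeff_sum]
  refine Finset.sum_congr rfl fun i _ => ?_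
  rw [coeff_mul_cz, coeff_cx, mul_left_comm, ← Algebra.smul_def, HahnSeries.coeff_smul, smul_eq_mul]

end KT

end

noncomputable section

open LS

namespace KT

section Nest

variable {B : Type*} [CommRing B] [Algebra ℂ B] {M N X Y : Type*}
  [AddCommGroup M] [Module ℂ M] [AddCommGroup N] [Module ℂ N]
  [AddCommGroup X] [Module ℂ X] [AddCommGroup Y] [Module ℂ Y]

/-- The extension of `φ` acting on the coefficients. -/
def lT (φ : X →ₗ[ℂ] Y) : KT X →ₗ[ℂ] KT Y := LinearMap.lTensor (LaurentSeries ℂ) φ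

@[simp] lemma lT_tmul (φ : X →ₗ[ℂ] Y) (f : LaurentSeries ℂ) (x : X) :
    lT φ (f ⊗ₜ x) = f ⊗ₜ φ x := rfl

/-- `f ⊗ x ↦ τ f • g x`. -/
def nest (τ : LaurentSeries ℂ →ₐ[ℂ] B) (g : X →ₗ[ℂ] B ⊗[ℂ] M) : KT X →ₗ[ℂ] B ⊗[ℂ] M :=
  (g.liftBaseChange B).restrictScalars ℂ ∘ₗ bt τ

@[simp] lemma nest_tmul (τ : LaurentSeries ℂ →ₐ[ℂ] B) (g : X →ₗ[ℂ] B ⊗[ℂ] M)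
    (f : LaurentSeries ℂ) (x : X) : nest τ g (f ⊗ₜ x) = τ f • g x := by simp [nest]

lemma spec_bt_eq_nest (τ σ : LaurentSeries ℂ →ₐ[ℂ] B) (φ : M →ₗ[ℂ] KT N) (q : KT M) :
    spec τ φ (bt σ q) = nest σ (bt τ) (lT (Y := KT N) φ q) := by
  induction q using KT.induction₁ with
  | h0 => simp
  | ht g p => simp
  | ha s t hs ht => simp only [map_add, hs, ht]

lemma spec_nest (τ σ : LaurentSeries ℂ →ₐ[ℂ] B) (φ : M →ₗ[ℂ] KT N) (g : X →ₗ[ℂ] B ⊗[ℂ] M)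
    (q : KT X) : spec τ φ (nest σ g q) = nest σ ((spec τ φ).restrictScalars ℂ ∘ₗ g) q := by
  induction q using KT.induction₁ with
  | h0 => simp
  | ht g p => simp
  | ha s t hs ht => simp only [map_add, hs, ht]

lemma nest_lT (σ : LaurentSeries ℂ →ₐ[ℂ] B) (g : Y →ₗ[ℂ] B ⊗[ℂ] M) (φ : X →ₗ[ℂ] Y)
    (g' : X →ₗ[ℂ] B ⊗[ℂ] M) (h : ∀ x, g (φ x) = g' x) (q : KT X) :
    nest σ g (lT φ q) = nest σ g' q := by
  induction q using KT.induction₁ with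
  | h0 => simp
  | ht f p => simp [h]
  | ha s t hs ht => simp only [map_add, hs, ht]

lemma spec_spec_spec (α β γ : LaurentSeries ℂ →ₐ[ℂ] B) (φ ψ χ : M →ₗ[ℂ] KT M) (t : M) :
    spec α φ (spec β ψ (spec γ χ (1 ⊗ₜ t))) = nest γ (nest β (bt α))
      (lT (Y := KT (KT M)) (lT (Y := KT M) φ)
        (lT (Y := KT M) ψ (χ t))) := by
  rw [spec_tmul, one_smul, spec_bt_eq_nest, spec_nest]
  refine (nest_lT (X := KT M) (Y := KT (KT M)) γ _ _ _ fun q => ?_) _ |>.symm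
  exact (spec_bt_eq_nest α β φ q).symm

end Nest

section Coeff

variable {N : Type*} [AddCommGroup N] [Module ℂ N]

/-- The coefficient of `x ^ b z ^ a`. -/
def cc (a b : ℤ) : K2 ⊗[ℂ] N →ₗ[ℂ] N :=
  TensorProduct.lift (LinearMap.lsmul ℂ N ∘ₗ
    { toFun := fun F : K2 => (F.coeff b).coeff a
      map_add' := fun _ _ => rfl
      map_smul' := fun c F => rfl })

@[simp] lemma cc_tmul (a b : ℤ) (F : K2) (v : N) :
    cc a b (F ⊗ₜ v) = (F.coeff b).coeff a • v := rfl

lemma cf_tl_tmul (f : LaurentSeries ℂ) (v : N) (n : ℤ) :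
    cf n (tl (f ⊗ₜ v)) = f.coeff n • v := by
  rw [tl_tmul, cf_smul_cst]

lemma cf_tl_smul (c : ℂ) (q : KT N) (n : ℤ) : cf n (tl (c • q)) = c • cf n (tl q) := by
  rw [LinearMap.map_smul_of_tower tl, map_smul]

lemma cf_tl_lT {P Q : Type*} [AddCommGroup P] [Module ℂ P] [AddCommGroup Q] [Module ℂ Q]
    (φ : P →ₗ[ℂ] Q) (t : KT P) (n : ℤ) : cf n (tl (lT φ t)) = φ (cf n (tl t)) :=
  cf_tl_lTensor φ t n

lemma hasDSum_left (Ψ : KT (KT (KT N))) (a b : ℤ) :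
    HasDSum (fun i p => (zchoose p i : ℂ) •
        cf (b - i) (tl (cf p (tl (cf (a - p + i) (tl Ψ))))))
      ((-1 : ℂ) ^ (a + b) • cc a b
        (nest (cz.comp nuA) (nest (tp.comp nuA) (bt (cx.comp nuA))) Ψ)) := by
  induction Ψ using KT.induction₁ with
  | h0 => simpa using HasDSum.zero
  | ha s t hs ht => simpa only [map_add, smul_add] using hs.add ht
  | ht g Θ =>
  induction Θ using KT.induction₁ with
  | h0 => simpa using HasDSum.zero
  | ha s t hs ht => simpa only [map_add, smul_add, TensorProduct.tmul_add] using hs.add ht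
  | ht h q =>
  induction q using KT.induction₁ with
  | h0 => simpa using HasDSum.zero
  | ha s t hs ht => simpa only [map_add, smul_add, TensorProduct.tmul_add] using hs.add ht
  | ht f v =>
  convert (hasDSum_coeff f g h a b).smul_const v using 1
  · funext i p
    rw [cf_tl_tmul, cf_tl_smul, cf_tl_tmul, cf_tl_smul, cf_tl_smul, cf_tl_tmul]
    simp only [smul_smul]
    congr 1; ring
  · simp only [nest_tmul, bt_tmul, TensorProduct.smul_tmul', cc_tmul, smul_smul, smul_eq_mul,
      AlgHom.comp_apply]
    congr 4; ring

lemma hasDSum_right (Ψ : KT (KT (KT N))) (a b : ℤ) :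
    HasDSum (fun i p => (zchoose p i : ℂ) •
        cf (a - p + i) (tl (cf p (tl (cf (b - i) (tl Ψ))))))
      ((-1 : ℂ) ^ (a + b) • cc a b
        (nest (cx.comp nuA) (nest (tp.comp nuA) (bt (cz.comp nuA))) Ψ)) := by
  induction Ψ using KT.induction₁ with
  | h0 => simpa using HasDSum.zero
  | ha s t hs ht => simpa only [map_add, smul_add] using hs.add ht
  | ht f Θ =>
  induction Θ using KT.induction₁ with
  | h0 => simpa using HasDSum.zero
  | ha s t hs ht => simpa only [map_add, smul_add, TensorProduct.tmul_add] using hs.add ht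
  | ht h q =>
  induction q using KT.induction₁ with
  | h0 => simpa using HasDSum.zero
  | ha s t hs ht => simpa only [map_add, smul_add, TensorProduct.tmul_add] using hs.add ht
  | ht g v =>
  convert (hasDSum_coeff f g h a b).smul_const v using 1
  · funext i p
    rw [cf_tl_tmul, cf_tl_smul, cf_tl_tmul, cf_tl_smul, cf_tl_smul, cf_tl_tmul]
    simp only [smul_smul]
    congr 1; ring
  · simp only [nest_tmul, bt_tmul, TensorProduct.smul_tmul', cc_tmul, smul_smul, smul_eq_mul,
      AlgHom.comp_apply]
    congr 4; ring

end Coeff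

end KT

open KT

variable {V : Type*} [AddCommGroup V] [Module ℂ V] {S : V ⊗[ℂ] V →ₗ[ℂ] KT (V ⊗[ℂ] V)}

/-- The quantum Yang–Baxter equation follows from its form with specialized parameters. -/
lemma NLVA.qybe_of_spec
    (hS : ∀ t, hat S (nuT (bc (TensorProduct.comm ℂ V V).toLinearMap
      (S (TensorProduct.comm ℂ V V t)))) = 1 ⊗ₜ t)
    (h : spec tp (s23 S) ∘ₗ spec cz (s13 S) ∘ₗ spec (cx.comp nuA) (s12 S)
      = spec (cx.comp nuA) (s12 S) ∘ₗ spec cz (s13 S) ∘ₗ spec tp (s23 S)) :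
    QYBE (NLVA.coeffs S) := by
  intro t a b
  have key := LinearMap.congr_fun (spec_yangBaxter hS _ _ _ h) (1 ⊗ₜ t)
  simp only [LinearMap.comp_apply, spec_spec_spec] at key
  have h₁ := (hasDSum_right (lT
    (lT (Y := KT ((V ⊗[ℂ] V) ⊗[ℂ] V)) (s12 S))
      (lT (Y := KT ((V ⊗[ℂ] V) ⊗[ℂ] V)) (s13 S) (s23 S t))) a b).eq
  have h₂ := (hasDSum_left (lT
    (lT (Y := KT ((V ⊗[ℂ] V) ⊗[ℂ] V)) (s23 S))
      (lT (Y := KT ((V ⊗[ℂ] V) ⊗[ℂ] V)) (s13 S) (s12 S t))) a b).eq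
  rw [← key] at h₁
  rw [← h₁] at h₂
  simp only [cf_tl_lT, cf_tl_s12, cf_tl_s13, cf_tl_s23] at h₂
  exact h₂.symm

end

noncomputable section

open LS

namespace LS

variable {R P Q : Type*} [Field R] [CharZero R] [AddCommGroup P] [Module R P]
  [AddCommGroup Q] [Module R Q]

/-- The inverse of `E D`. -/
def Ei (D : P →ₗ[R] P) : LS R P →ₗ[LaurentSeries R] LS R P := E (-D)

lemma E_Ei (D : P →ₗ[R] P) (A : LS R P) : E D (Ei D A) = A := E_E_neg D A

lemma Ei_E (D : P →ₗ[R] P) (A : LS R P) : Ei D (E D A) = A := E_neg_E D A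

lemma nu_E_eq_Ei (D : P →ₗ[R] P) (A : LS R P) : nu (E D A) = Ei D (nu A) := nu_E D A

lemma nu_Ei (D : P →ₗ[R] P) (A : LS R P) : nu (Ei D A) = E D (nu A) := by
  conv_rhs => rw [← nu_nu (E D (nu A)), nu_E_eq_Ei, nu_nu]

lemma Ei_map_of_comm {D : P →ₗ[R] P} {D' : Q →ₗ[R] Q} (φ : P →ₗ[R] Q)
    (h : D' ∘ₗ φ = φ ∘ₗ D) (A : LS R P) : Ei D' (map φ A) = map φ (Ei D A) := by
  conv_lhs => rw [← E_Ei D A, ← E_map_of_comm φ h, Ei_E]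

end LS

namespace KT

variable {P Q : Type*} [AddCommGroup P] [Module ℂ P] [AddCommGroup Q] [Module ℂ Q]

/-- Regard a series with coefficients in `ℂ((z)) ⊗ P` as a vector over `ℂ((z))((x))`. -/
def lw : LS ℂ (KT P) ≃+ LS (LaurentSeries ℂ) (KT P) where
  toFun A := LS.mk (fun n => cf n A) (exists_bound A)
  invFun A := LS.mk (fun n => cf n A) (exists_bound A)
  left_inv A := LS.ext fun n => rfl
  right_inv A := LS.ext fun n => rfl
  map_add' A B := LS.ext fun n => rfl

@[simp] lemma cf_lw (A : LS ℂ (KT P)) (n : ℤ) : cf n (lw A) = cf n A := rfl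

@[simp] lemma cf_lw_symm (A : LS (LaurentSeries ℂ) (KT P)) (n : ℤ) :
    cf n (lw.symm A) = cf n A := rfl

lemma lw_mz (f : LaurentSeries ℂ) (A : LS ℂ (KT P)) : lw (mz f A) = cz f • lw A := by
  refine LS.ext fun n => ?_
  have : cz f = HahnSeries.single 0 f := rfl
  rw [this, cf_single_smul, cf_lw, cf_lw, cf_mz, sub_zero]

lemma lw_mp (f : LaurentSeries ℂ) (A : LS ℂ (KT P)) : lw (mp f A) = tp f • lw A := by
  refine LS.ext fun n => ?_
  obtain ⟨N, hN⟩ := exists_bound A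
  rw [cf_smul (tp f) (lw A) n 0 (n - N + 1).toNat (fun p hp => coeff_tp_neg f hp)
    (fun q hq => hN _ (by omega)), sum_Ico_natCast, cf_lw, mp_apply,
    cf_Op _ A n N (n - N + 1).toNat hN (by omega)]
  simp only [coeff_tp, ms_apply, cf_lw]

lemma lw_smul (f : LaurentSeries ℂ) (A : LS ℂ (KT P)) : lw (f • A) = cx f • lw A := by
  refine LS.ext fun n => ?_
  obtain ⟨N, hN⟩ := exists_bound A
  obtain ⟨M, hM⟩ := exists_bound_coeff f
  rw [cf_lw, cf_smul f A n M (n - N + 1) hM (fun q hq => hN _ (by omega)),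
    cf_smul (cx f) (lw A) n M (n - N + 1) (fun p hp => by rw [coeff_cx, hM p hp, map_zero])
    (fun q hq => hN _ (by omega))]
  simp only [coeff_cx, algebraMap_smul, cf_lw]

lemma E_dT_mz (f : LaurentSeries ℂ) (A : LS ℂ (KT P)) :
    E (dT 1) (mz f A) = mp f (E (dT 1) A) := by
  have := E_map (P := KT P) (Q := KT P) (D := dT 1) (D' := dT 1)
    (fun i => (ms (dK i f) : KT P →ₗ[ℂ] KT P)) (fun i => ?_) A
  · rw [dK_zero] at this
    exact this
  · ext g p
    change dK 1 (dK i f * g) ⊗ₜ[ℂ] p - (dK i f * dK 1 g) ⊗ₜ[ℂ] p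
      = ((i : ℂ) + 1) • ((dK (i + 1) f * g) ⊗ₜ[ℂ] p)
    rw [← TensorProduct.sub_tmul, TensorProduct.smul_tmul', dK_mul]
    congr 1
    simp only [Finset.sum_range_succ, Finset.sum_range_zero, dK_zero, dK_dK_one, zero_add,
      Nat.sub_zero, Nat.sub_self, add_sub_cancel_left, smul_mul_assoc]

lemma Ei_dT_mp (f : LaurentSeries ℂ) (A : LS ℂ (KT P)) :
    Ei (dT 1) (mp f A) = mz f (Ei (dT 1) A) := by
  conv_lhs => rw [← E_Ei (dT 1) A, ← E_dT_mz, Ei_E]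

/-- Series with coefficients in `P`, viewed with coefficients in `ℂ((z)) ⊗ P`. -/
def up : LS ℂ P →ₗ[LaurentSeries ℂ] LS ℂ (KT P) :=
  map (TensorProduct.mk ℂ (LaurentSeries ℂ) P 1 : P →ₗ[ℂ] KT P)

@[simp] lemma cf_up (B : LS ℂ P) (n : ℤ) : cf n (up B) = 1 ⊗ₜ cf n B := cf_map _ _ _

lemma E_dT_up (B : LS ℂ P) : E (dT 1) (up B) = up B := by
  rw [up, E_map_of_comm (D := 0), E_zero]
  ext p
  have : dK 1 (1 : LaurentSeries ℂ) = 0 := by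
    rw [← map_one (algebraMap ℂ (LaurentSeries ℂ)), dK_C, if_neg one_ne_zero]
  simp [this]

end KT

end

noncomputable section

open LS

namespace KT

variable {P Q : Type*} [AddCommGroup P] [Module ℂ P] [AddCommGroup Q] [Module ℂ Q]
  {P' : Type*} [AddCommGroup P'] [Module (LaurentSeries ℂ) P']

lemma K2.mul_smul (F G : K2) (A : LS (LaurentSeries ℂ) P') : (F * G) • A = F • G • A :=
  SemigroupAction.mul_smul F G A

lemma K2.smul_add (F : K2) (A B : LS (LaurentSeries ℂ) P') : F • (A + B) = F • A + F • B :=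
  _root_.smul_add F A B

lemma K2.add_smul (F G : K2) (A : LS (LaurentSeries ℂ) P') : (F + G) • A = F • A + G • A :=
  _root_.add_smul F G A

lemma K2.smul_zero (F : K2) : F • (0 : LS (LaurentSeries ℂ) P') = 0 :=
  _root_.smul_zero F

/-- The coefficient of `z ^ m`. -/
def lam (m : ℤ) : KT P →ₗ[ℂ] P := cf m ∘ₗ (tl : KT P →ₗ[LaurentSeries ℂ] LS ℂ P).restrictScalars ℂ

lemma lam_tmul (m : ℤ) (f : LaurentSeries ℂ) (p : P) : lam m (f ⊗ₜ p) = f.coeff m • p :=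
  cf_tl_tmul f p m

/-- The coefficient of `z ^ m` in a series in `ℂ((z))((x))`. -/
def cm (m : ℤ) : K2 →ₗ[ℂ] LaurentSeries ℂ where
  toFun F := F.map (⟨fun f => f.coeff m, rfl⟩ : ZeroHom (LaurentSeries ℂ) ℂ)
  map_add' F G := HahnSeries.ext (funext fun n => rfl)
  map_smul' c F := HahnSeries.ext (funext fun n => rfl)

lemma coeff_cm (m : ℤ) (F : K2) (n : ℤ) : (cm m F).coeff n = (F.coeff n).coeff m := rfl

lemma map_lam_smul (m : ℤ) (F : K2) (B : LS ℂ P) :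
    map (lam m) (lw.symm (F • lw (up B))) = cm m F • B := by
  refine LS.ext fun n => ?_
  obtain ⟨N, hN⟩ := exists_bound B
  obtain ⟨M, hM⟩ := exists_bound_coeff F
  rw [cf_map, cf_lw_symm, cf_smul F (lw (up B)) n M (n - N + 1) hM
    (fun q hq => by rw [cf_lw, cf_up, hN q (by omega), TensorProduct.tmul_zero]),
    cf_smul (cm m F) B n M (n - N + 1) (fun p hp => by rw [coeff_cm, hM p hp]; rfl)
    (fun q hq => hN _ (by omega)), map_sum]
  refine Finset.sum_congr rfl fun p _ => ?_
  rw [cf_lw, cf_up, TensorProduct.smul_tmul', lam_tmul, smul_eq_mul, mul_one, coeff_cm]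

/-- Contraction of the last factor with `γ`. -/
def ctr (N : Type*) [AddCommGroup N] [Module ℂ N] (γ : P →ₗ[ℂ] ℂ) : N ⊗[ℂ] P →ₗ[ℂ] N :=
  (TensorProduct.rid ℂ N).toLinearMap ∘ₗ LinearMap.lTensor N γ

@[simp] lemma ctr_tmul (γ : P →ₗ[ℂ] ℂ) (a : Q) (p : P) : ctr Q γ (a ⊗ₜ p) = γ p • a := by
  simp [ctr]

lemma nu_mz (f : LaurentSeries ℂ) (A : LS ℂ (KT P)) : nu (mz f A) = mz f (nu A) :=
  nu_map _ _

lemma nu_up (B : LS ℂ P) : nu (up B) = up (nu B) := nu_map _ _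

lemma algebraMap_smul_lw (c : ℂ) (A : LS ℂ (KT P)) :
    (algebraMap ℂ K2 c : K2) • lw A = lw (c • A) := by
  have h : (algebraMap ℂ K2 c : K2) = cz (algebraMap ℂ (LaurentSeries ℂ) c) := rfl
  rw [h, ← lw_mz]
  refine congrArg lw (LS.ext fun n => ?_)
  rw [cf_mz, algebraMap_smul, map_smul]

lemma eq_zero_of_forall_dual {A : Type*} [AddCommGroup A] [Module ℂ A] (w : A ⊗[ℂ] P)
    (h : ∀ γ : P →ₗ[ℂ] ℂ, LinearMap.lTensor A γ w = 0) : w = 0 := by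
  classical
  have b := Module.Basis.ofVectorSpace ℂ P
  apply (TensorProduct.equivFinsuppOfBasisRight b).injective
  rw [map_zero]
  refine Finsupp.ext fun i => ?_
  have key (t : A ⊗[ℂ] P) : TensorProduct.equivFinsuppOfBasisRight b t i
      = TensorProduct.rid ℂ A (LinearMap.lTensor A (b.coord i) t) := by
    induction t using TensorProduct.induction_on with
    | zero => simp
    | tmul a p => simp
    | add s t hs ht => simp only [map_add, Finsupp.add_apply, hs, ht]
  rw [key, h, map_zero]
  rfl

end KT

namespace NLVA

open KT

variable {V : Type*} [AddCommGroup V] [Module ℂ V] (𝒱 : NLVA V)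

/-- The series `Y(a, -x)b ⊗ c`. -/
def rho : (V ⊗[ℂ] V) ⊗[ℂ] V →ₗ[ℂ] LS ℂ (V ⊗[ℂ] V) := nu ∘ₗ 𝒱.xs

lemma rho_apply (t : (V ⊗[ℂ] V) ⊗[ℂ] V) : 𝒱.rho t = nu (𝒱.xs t) := rfl

/-- The series `F(z, x) Y(a, -x)b ⊗ c` for `F ⊗ a ⊗ b ⊗ c`. -/
def yM : K2 ⊗[ℂ] ((V ⊗[ℂ] V) ⊗[ℂ] V) →+ LS (LaurentSeries ℂ) (KT (V ⊗[ℂ] V)) :=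
  TensorProduct.liftAddHom
    (AddMonoidHom.mk' (fun F : K2 => AddMonoidHom.mk' (fun t => F • lw (up (𝒱.rho t)))
      (fun s t => by simp only [map_add, K2.smul_add]))
      (fun F G => AddMonoidHom.ext fun t => K2.add_smul F G _))
    (fun c F t => by
      change (c • F) • lw (up (𝒱.rho t)) = F • lw (up (𝒱.rho (c • t)))
      rw [map_smul, Algebra.smul_def, mul_comm, K2.mul_smul, algebraMap_smul_lw]
      congr 2
      exact (LinearMap.map_smul_of_tower _ c _).symm)

lemma yM_tmul (F : K2) (t : (V ⊗[ℂ] V) ⊗[ℂ] V) :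
    𝒱.yM (F ⊗ₜ t) = F • lw (up (𝒱.rho t)) := rfl

lemma yM_smul (F : K2) (w : K2 ⊗[ℂ] ((V ⊗[ℂ] V) ⊗[ℂ] V)) : 𝒱.yM (F • w) = F • 𝒱.yM w := by
  induction w using TensorProduct.induction_on with
  | zero => simp [K2.smul_zero]
  | tmul G t => rw [TensorProduct.smul_tmul', yM_tmul, yM_tmul, smul_eq_mul, K2.mul_smul]
  | add s t hs ht => simp only [smul_add, map_add, hs, ht, K2.smul_add]

variable {𝒱}

lemma ev_rho_injective (hinj : Function.Injective 𝒱.Yh) : Function.Injective (ev 𝒱.rho) := by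
  rw [injective_iff_map_eq_zero]
  intro q hq
  have key (γ : V →ₗ[ℂ] ℂ) (q : KT ((V ⊗[ℂ] V) ⊗[ℂ] V)) : map (ctr V γ) (ev 𝒱.rho q)
      = nu (𝒱.Yh (nuT (bc (ctr (V ⊗[ℂ] V) γ) q))) := by
    induction q using KT.induction₁ with
    | h0 => simp
    | ha s t hs ht => simp only [map_add, hs, ht]
    | ht f p =>
      rw [ev_tmul, bc_tmul, nuT_tmul, Yh, ev_tmul, nu_smul, nuK_nuK, map_smul, rho_apply, ← nu_map]
      congr 2
      induction p using TensorProduct.induction_on with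
      | zero => simp
      | add s t hs ht => simp only [map_add, hs, ht]
      | tmul s c =>
        refine LS.ext fun n => ?_
        rw [cf_map, cf_xs, LinearMap.rTensor_tmul, ctr_tmul, ctr_tmul, map_smul,
          LinearMap.map_smul_of_tower, cf_lift_Yl]
  have h (γ : V →ₗ[ℂ] ℂ) : bc (ctr (V ⊗[ℂ] V) γ) q = 0 := by
    have h₁ := key γ q
    rw [hq, map_zero] at h₁
    have h₂ := congrArg nu h₁
    rw [nu_nu, map_zero] at h₂
    have h₃ := hinj (h₂.symm.trans (map_zero 𝒱.Yh).symm)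
    have h₄ (r : KT (V ⊗[ℂ] V)) : nuT (nuT r) = r := by
      induction r using KT.induction₁ with
      | h0 => simp
      | ha s t hs ht => simp only [map_add, hs, ht]
      | ht f p => rw [nuT_tmul, nuT_tmul, nuK_nuK]
    rw [← h₄ (bc (ctr (V ⊗[ℂ] V) γ) q), h₃, map_zero]
  have h' (γ : V →ₗ[ℂ] ℂ) (q : KT ((V ⊗[ℂ] V) ⊗[ℂ] V)) : bc (ctr (V ⊗[ℂ] V) γ) q
      = ctr (KT (V ⊗[ℂ] V)) γ
        ((TensorProduct.assoc ℂ (LaurentSeries ℂ) (V ⊗[ℂ] V) V).symm q) := by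
    induction q using KT.induction₁ with
    | h0 => simp
    | ha s t hs ht => simp only [map_add, hs, ht]
    | ht f p =>
      induction p using TensorProduct.induction_on with
      | zero => simp
      | add s t hs ht => rw [TensorProduct.tmul_add, map_add, map_add, map_add, hs, ht]
      | tmul s c => simp
  apply (TensorProduct.assoc ℂ (LaurentSeries ℂ) (V ⊗[ℂ] V) V).symm.injective
  rw [map_zero]
  refine eq_zero_of_forall_dual (P := V) (A := KT (V ⊗[ℂ] V)) _ fun γ => ?_
  apply (TensorProduct.rid ℂ (KT (V ⊗[ℂ] V))).injective
  rw [map_zero, ← h γ, h']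
  rfl

lemma yM_injective (hinj : Function.Injective 𝒱.Yh) : Function.Injective 𝒱.yM := by
  rw [injective_iff_map_eq_zero]
  intro w hw
  have key (m : ℤ) (w : K2 ⊗[ℂ] ((V ⊗[ℂ] V) ⊗[ℂ] V)) : map (lam m) (lw.symm (𝒱.yM w))
      = ev 𝒱.rho (LinearMap.rTensor _ (cm m) w) := by
    induction w using TensorProduct.induction_on with
    | zero => simp
    | tmul F t => rw [yM_tmul, map_lam_smul, LinearMap.rTensor_tmul, ev_tmul]
    | add s t hs ht => simp only [map_add, hs, ht]
  have h0 (m : ℤ) : LinearMap.rTensor ((V ⊗[ℂ] V) ⊗[ℂ] V) (cm m) w = 0 := by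
    apply ev_rho_injective hinj
    rw [← key, hw]; simp
  refine eq_zero_of_forall_dual w fun γ => (TensorProduct.rid ℂ _).injective ?_
  rw [map_zero]
  refine HahnSeries.ext (funext fun n => HahnSeries.ext (funext fun m => ?_))
  have h1 (w : K2 ⊗[ℂ] ((V ⊗[ℂ] V) ⊗[ℂ] V)) :
      cm m (TensorProduct.rid ℂ _ (LinearMap.lTensor K2 γ w))
      = TensorProduct.rid ℂ _ (LinearMap.lTensor _ γ (LinearMap.rTensor _ (cm m) w)) := by
    induction w using TensorProduct.induction_on with
    | zero => simp
    | tmul F t => simp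
    | add s t hs ht => simp only [map_add, hs, ht]
  have h2 := h1 w
  rw [h0, map_zero, map_zero] at h2
  exact congrArg (fun f : LaurentSeries ℂ => f.coeff n) h2

variable (𝒱)

lemma yM_nest (r : KT (KT ((V ⊗[ℂ] V) ⊗[ℂ] V))) :
    𝒱.yM (nest cz (bt tp) r) = lw (E (dT 1) (nu (𝒱.yp r))) := by
  induction r using KT.induction₁ with
  | h0 => simp
  | ha s t hs ht => simp only [map_add, hs, ht]
  | ht f r =>
    rw [nest_tmul, yM_smul, yp_tmul, ← nu_Ei, Ei_dT_mp, nu_mz, nu_Ei, lw_mz]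
    congr 1
    induction r using KT.induction₁ with
    | h0 => simp
    | ha s t hs ht => simp only [map_add, hs, ht]
    | ht g t =>
      rw [bt_tmul, yM_tmul, yz_tmul, nu_mz, E_dT_mz, lw_mp]
      congr 2
      exact ((congrArg _ (nu_up (𝒱.xs t))).trans (E_dT_up _)).symm

end NLVA

end

noncomputable section

open LS

namespace LS

variable {R P : Type*} [Field R] [CharZero R] [AddCommGroup P] [Module R P]

lemma E_comm {D D' : P →ₗ[R] P} (h : D ∘ₗ D' = D' ∘ₗ D) (A : LS R P) :
    E D (E D' A) = E D' (E D A) := by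
  rw [← E_add h, ← E_add h.symm, add_comm]

lemma Ei_comm {D D' : P →ₗ[R] P} (h : D ∘ₗ D' = D' ∘ₗ D) (A : LS R P) :
    E D (Ei D' A) = Ei D' (E D A) := by
  conv_lhs => rw [← Ei_E D' (E D (Ei D' A)), ← E_comm h, E_Ei]

lemma Ei_Ei_comm {D D' : P →ₗ[R] P} (h : D ∘ₗ D' = D' ∘ₗ D) (A : LS R P) :
    Ei D (Ei D' A) = Ei D' (Ei D A) := by
  conv_lhs => rw [← E_Ei D A, ← Ei_comm h, Ei_E]

end LS

lemma KT.mz_apply {P : Type*} [AddCommGroup P] [Module ℂ P] (f : LaurentSeries ℂ)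
    (A : LS ℂ (KT P)) :
    mz f A = map (P := KT P) (Q := KT P) (ms f : KT P →ₗ[ℂ] KT P) A := rfl

namespace NLVA

open KT

variable {V : Type*} [AddCommGroup V] [Module ℂ V] (𝒱 : NLVA V)

/-- The operator `D ⊗ 1` acting on coefficients. -/
def DL : KT (V ⊗[ℂ] V) →ₗ[ℂ] KT (V ⊗[ℂ] V) :=
  (bc (LinearMap.rTensor V 𝒱.D)).restrictScalars ℂ

lemma DL_apply (q : KT (V ⊗[ℂ] V)) : 𝒱.DL q = bc (LinearMap.rTensor V 𝒱.D) q := rfl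

lemma dT_DL : dT 1 ∘ₗ 𝒱.DL = 𝒱.DL ∘ₗ dT 1 := by
  refine LinearMap.ext fun q => ?_
  simp only [LinearMap.comp_apply, DL_apply]
  induction q using KT.induction₁ with
  | h0 => simp
  | ha s t hs ht => simp only [map_add, hs, ht]
  | ht f p => simp

lemma Ei_DL_mz (f : LaurentSeries ℂ) (A : LS ℂ (KT (V ⊗[ℂ] V))) :
    Ei 𝒱.DL (mz f A) = mz f (Ei 𝒱.DL A) := by
  have h : 𝒱.DL ∘ₗ (ms f : KT (V ⊗[ℂ] V) →ₗ[ℂ] KT (V ⊗[ℂ] V)) = ms f ∘ₗ 𝒱.DL :=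
    LinearMap.ext fun q => map_smul (bc (LinearMap.rTensor V 𝒱.D)) f q
  rw [mz_apply, mz_apply, Ei_map_of_comm _ h]

lemma Ei_DL_mp (f : LaurentSeries ℂ) (A : LS ℂ (KT (V ⊗[ℂ] V))) :
    Ei 𝒱.DL (mp f A) = mp f (Ei 𝒱.DL A) := by
  conv_lhs => rw [← E_Ei (dT 1) A, ← E_dT_mz, ← Ei_comm 𝒱.dT_DL, Ei_DL_mz,
    ← Ei_Ei_comm 𝒱.dT_DL, E_dT_mz, E_Ei]

lemma Ei_DL_up (A : LS ℂ (V ⊗[ℂ] V)) :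
    Ei 𝒱.DL (up A) = up (Ei (LinearMap.rTensor V 𝒱.D) A) :=
  Ei_map_of_comm _ (LinearMap.ext fun q => by simp [DL_apply]) A

lemma yM_bt (q : KT ((V ⊗[ℂ] V) ⊗[ℂ] V)) :
    𝒱.yM (bt (cx.comp nuA) q) = lw (up (ev 𝒱.rho (nuT q))) := by
  induction q using KT.induction₁ with
  | h0 => simp
  | ha s t hs ht => simp only [map_add, hs, ht]
  | ht f p =>
    rw [bt_tmul, yM_tmul, nuT_tmul, ev_tmul, map_smul, lw_smul]
    rfl

variable {𝒱} {S : V ⊗[ℂ] V →ₗ[ℂ] KT (V ⊗[ℂ] V)}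

lemma IsSkewOp.xs_swap12 (hS : 𝒱.IsSkewOp S) (t : (V ⊗[ℂ] V) ⊗[ℂ] V) :
    𝒱.xs (swap12 t) = E (LinearMap.rTensor V 𝒱.D) (ev 𝒱.rho (nuT (s12 S t))) := by
  have key (r : KT (V ⊗[ℂ] V)) (c : V) :
      ev 𝒱.rho (nuT (bc ((TensorProduct.mk ℂ _ _).flip c) r))
        = map ((TensorProduct.mk ℂ V V).flip c) (nu (𝒱.Yh r)) := by
    induction r using KT.induction₁ with
    | h0 => simp
    | ha s t hs ht => simp only [map_add, hs, ht]
    | ht f p =>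
      rw [bc_tmul, nuT_tmul, ev_tmul, Yh, ev_tmul, nu_smul, map_smul, rho_apply, ← nu_map]
      rfl
  refine LinearMap.congr_fun (hom_ext₃ (φ := 𝒱.xs ∘ₗ swap12)
    (ψ := (E (LinearMap.rTensor V 𝒱.D)).restrictScalars ℂ ∘ₗ
      (ev 𝒱.rho).restrictScalars ℂ ∘ₗ nuT ∘ₗ s12 S) fun a b c => ?_) t
  simp only [LinearMap.comp_apply, LinearMap.restrictScalars_apply]
  rw [swap12_tmul, xs_tmul, s12_tmul, key, hS b a]
  exact (E_map_of_comm _ (LinearMap.ext fun v => by simp) _).symm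

lemma IsSkewOp.yM_left (hinj : Function.Injective 𝒱.Yh) (hS : 𝒱.IsSkewOp S)
    (q : KT ((V ⊗[ℂ] V) ⊗[ℂ] V)) :
    𝒱.yM (spec tp (s23 S) (spec cz (s13 S) (bt (cx.comp nuA) q)))
      = lw (E (dT 1) (map S (ev 𝒱.rho (nuT q)))) := by
  induction q using KT.induction₁ with
  | h0 => simp
  | ha s t hs ht => simp only [map_add, hs, ht]
  | ht f t =>
    have h1 : bt (cx.comp nuA) (f ⊗ₜ[ℂ] t)
        = cx (nuA f) • ((1 : K2) ⊗ₜ[ℂ] t) := by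
      rw [TensorProduct.smul_tmul', smul_eq_mul, mul_one]; rfl
    rw [h1, map_smul, map_smul, yM_smul, spec_tmul, one_smul, spec_bt_eq_nest, yM_nest, nuT_tmul,
      ev_tmul, map_smul, map_smul, lw_smul, rho_apply, ← nu_map, hS.hex_series hinj]
    rfl

lemma IsSkewOp.yM_right (hS : 𝒱.IsSkewOp S) (r : KT (KT ((V ⊗[ℂ] V) ⊗[ℂ] V))) :
    𝒱.yM (spec (cx.comp nuA) (s12 S) (nest tp (bt cz) r))
      = lw (Ei 𝒱.DL (𝒱.yp (lT (X := KT ((V ⊗[ℂ] V) ⊗[ℂ] V))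
        ((bc swap12).restrictScalars ℂ) r))) := by
  induction r using KT.induction₁ with
  | h0 => simp
  | ha s t hs ht => simp only [map_add, hs, ht]
  | ht f r =>
    rw [nest_tmul, map_smul, yM_smul, lT_tmul, yp_tmul, Ei_DL_mp, lw_mp]
    congr 1
    induction r using KT.induction₁ with
    | h0 => simp
    | ha s t hs ht => simp only [map_add, hs, ht]
    | ht g t =>
      have h1 : bt cz (g ⊗ₜ[ℂ] t) = cz g • ((1 : K2) ⊗ₜ[ℂ] t) := by
        rw [TensorProduct.smul_tmul', smul_eq_mul, mul_one]; rfl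
      rw [h1, map_smul, yM_smul, spec_tmul, one_smul, yM_bt, LinearMap.restrictScalars_apply,
        bc_tmul, yz_tmul, Ei_DL_mz, lw_mz]
      congr 2
      refine Eq.trans ?_ (Ei_DL_up 𝒱 _).symm
      rw [hS.xs_swap12, Ei_E]

lemma s23_eq_s13 (t : (V ⊗[ℂ] V) ⊗[ℂ] V) : s23 S t = bc swap12 (s13 S (swap12 t)) := s23_eq S t

lemma bc_swap12_bc_swap12 (q : KT ((V ⊗[ℂ] V) ⊗[ℂ] V)) : bc swap12 (bc swap12 q) = q := by
  induction q using KT.induction₁ with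
  | h0 => simp
  | ha s t hs ht => simp only [map_add, hs, ht]
  | ht f t =>
    rw [bc_tmul, bc_tmul]
    exact congrArg _ (LinearMap.congr_fun swap12_swap12 t)

lemma s13_swap12 (t : (V ⊗[ℂ] V) ⊗[ℂ] V) : s13 S (swap12 t) = bc swap12 (s23 S t) := by
  rw [s23_eq_s13, bc_swap12_bc_swap12]

lemma s23_swap12 (t : (V ⊗[ℂ] V) ⊗[ℂ] V) : s23 S (swap12 t) = bc swap12 (s13 S t) := by
  rw [s23_eq_s13]
  congr 2
  exact LinearMap.congr_fun swap12_swap12 t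

lemma IsSkewOp.map_E (hinj : Function.Injective 𝒱.Yh) (hS : 𝒱.IsSkewOp S)
    (B : LS ℂ (V ⊗[ℂ] V)) :
    map (P := V ⊗[ℂ] V) (Q := KT (V ⊗[ℂ] V)) S (E (LinearMap.rTensor V 𝒱.D) B)
      = E 𝒱.DL (E (dT 1) (map S B)) := by
  rw [← E_add 𝒱.dT_DL]
  have h : (dT 1 + 𝒱.DL) ∘ₗ S = S ∘ₗ LinearMap.rTensor V 𝒱.D :=
    LinearMap.ext fun t => (hS.S_rTensor_D hinj t).symm
  exact (E_map_of_comm (P := V ⊗[ℂ] V) (Q := KT (V ⊗[ℂ] V)) S h B).symm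

/-- The quantum Yang–Baxter equation for the skew-symmetry operator. -/
lemma IsSkewOp.qybe (hinj : Function.Injective 𝒱.Yh) (hS : 𝒱.IsSkewOp S) :
    QYBE (coeffs S) := by
  refine qybe_of_spec (hS.hat_nuT hinj) (baseChange_hom_ext fun t => yM_injective hinj ?_)
  simp only [LinearMap.comp_apply]
  have hl : spec (cx.comp nuA) (s12 S) ((1 : K2) ⊗ₜ[ℂ] t) = bt (cx.comp nuA) (s12 S t) := by
    rw [spec_tmul, one_smul]
  have hr : spec tp (s23 S) ((1 : K2) ⊗ₜ[ℂ] t) = bt tp (s23 S t) := by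
    rw [spec_tmul, one_smul]
  rw [hl, hr, hS.yM_left hinj, spec_bt_eq_nest, hS.yM_right]
  have h : lT (X := KT ((V ⊗[ℂ] V) ⊗[ℂ] V)) (Y := KT ((V ⊗[ℂ] V) ⊗[ℂ] V))
      ((bc swap12).restrictScalars ℂ) (lT (s13 S) (s23 S t))
      = LinearMap.lTensor _ (s23 S) (s13 S (swap12 t)) := by
    rw [s13_swap12]
    induction s23 S t using KT.induction₁ with
    | h0 => simp
    | ha s t hs ht => simp only [map_add, hs, ht]
    | ht f t => rw [lT_tmul, lT_tmul, bc_tmul, LinearMap.lTensor_tmul, s23_swap12]; rfl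
  rw [h, ← hS.hex_series hinj, hS.xs_swap12, hS.map_E hinj, Ei_E]

end NLVA

end

/-- If `U` and `V` are weak quantum vertex algebras, irreducible as
modules over themselves and of countable dimension, then `U ⊗_R V` is irreducible
over itself and is a non-degenerate quantum vertex algebra (Proposition 3.10). -/
theorem statement_15 {U V : Type*} [AddCommGroup U] [Module ℂ U]
    [AddCommGroup V] [Module ℂ V]
    (𝒰 : NLVA U) (𝒱 : NLVA V) (hU : SLocal 𝒰) (hV : SLocal 𝒱)
    (Rop : TwistingOp 𝒰 𝒱)
    (Sc : ℤ → (U ⊗[ℂ] V →ₗ[ℂ] V ⊗[ℂ] U)) (hinv : IsInvPair Rop.Rc Sc)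
    (𝒯 : NLVA (U ⊗[ℂ] V)) (h𝒯 : IsTwistedTensor 𝒰 𝒱 Rop 𝒯)
    (hirrU : NLVA.SelfIrreducible 𝒰) (hcdU : CountableDim U)
    (hirrV : NLVA.SelfIrreducible 𝒱) (hcdV : CountableDim V) :
    NLVA.SelfIrreducible 𝒯 ∧ 𝒯.NonDegenerate ∧ SLocal 𝒯 ∧
      ∃ Q : QVA (U ⊗[ℂ] V), Q.alg = 𝒯 := by
  obtain ⟨hirr, hcd, hskew⟩ : 𝒯.SelfIrreducible ∧ CountableDim (U ⊗[ℂ] V) ∧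
      ∀ s t, ∃ q, 𝒯.SkewRel s t q :=
    ⟨h𝒯.selfIrreducible hirrU hcdU hirrV, hcdU.tensor hcdV,
      h𝒯.exists_skewRel hinv (NLVA.exists_skewRel hU) (NLVA.exists_skewRel hV)⟩
  have hinj : Function.Injective 𝒯.Yh := NLVA.Yh_injective hirr hcd
  have : Nontrivial (U ⊗[ℂ] V) := hirr.1
  have hloc : SLocal 𝒯 := NLVA.sLocal_of_locRel fun s t => by
    obtain ⟨q, hq⟩ := hskew s t
    obtain ⟨k, hk⟩ := hq.locRel
    exact ⟨k, q, hk⟩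
  obtain ⟨S, hS⟩ := NLVA.exists_isSkewOp hinj hskew
  exact ⟨hirr, 𝒯.nonDegenerate_of_Yh_injective hinj, hloc,
    { alg := 𝒯
      sloc := hloc
      Sc := NLVA.coeffs S
      laurent := fun t => KT.isTensorLaurent_tl (S t)
      qybe := hS.qybe hinj
      unitary := hS.unitary hinj
      vac := hS.vac hinj
      dcomm := hS.dcomm hinj
      skew := hS.skewS
      hex := hS.hex hinj }, rfl⟩
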